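/- Central limit theorem: let f : Δ → ℝ be a Borel function that is uniformly bounded π-a.s., let δ > 0, and consider the time-δ chain (x_{nδ})_{n≥0}. Define σ_f² = var_π(f(x_0)) + 2 Σ_{i=1}^∞ cov_π(f(x_0), f(x_{iδ})), where the subscript π indicates that the chain is started from the stationary distribution π. If σ_f² < ∞, then for every initial distribution of x_0, the normalized ergodic averages √n ( (1/n) Σ_{i=0}^{n−1} f(x_{iδ}) − E_π[f] ) converge in distribution, as n → ∞, to the normal law N(0, σ_f²). -/

import Mathlib

open MeasureTheory Set Filter

noncomputable section

/-- The open set `U ⊂ ℝ^m` with which the open simplex `Δ` is identified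
(via `y = Ē - ∑ i, x i`). -/
def simU (m : ℕ) (E : ℝ) : Set (Fin m → ℝ) := {x | (∀ i, 0 < x i) ∧ ∑ i, x i < E}

/-- The state space `Δ`. -/
abbrev Delta (m : ℕ) (E : ℝ) : Type := ↥(simU m E)

/-- The tank energy `y = Ē - ∑ i, x i`. -/
def tank (m : ℕ) (E : ℝ) (x : Delta m E) : ℝ := E - ∑ i, x.1 i

/-- The energy exchange map on the ambient space: particle `i` gets energy
`y + (1-u²) x^i`, and the new tank energy is `u² x^i`. -/
def T0 (m : ℕ) (E : ℝ) (i : Fin m) (u : ℝ) (x : Fin m → ℝ) : Fin m → ℝ :=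
  Function.update x i ((E - ∑ j, x j) + (1 - u ^ 2) * x i)

lemma T0_mem {m : ℕ} {E : ℝ} {i : Fin m} {u : ℝ} {x : Fin m → ℝ}
    (hx : x ∈ simU m E) (hu : u ∈ Ioo (0:ℝ) 1) : T0 m E i u x ∈ simU m E := by
  obtain ⟨hpos, hsum⟩ := hx
  obtain ⟨hu0, hu1⟩ := hu
  have hy : 0 < E - ∑ j, x j := sub_pos.mpr hsum
  have hu2 : 0 < 1 - u ^ 2 := by nlinarith
  have hxi := hpos i
  constructor
  · intro j
    rcases eq_or_ne j i with rfl | hj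
    · simp only [T0, Function.update_self]
      nlinarith
    · simpa [T0, Function.update_of_ne hj] using hpos j
  · have h1 : ∑ j, T0 m E i u x j
        = ((E - ∑ j, x j) + (1 - u ^ 2) * x i) + ∑ j ∈ Finset.univ \ {i}, x j := by
      simp only [T0]
      rw [Finset.sum_update_of_mem (Finset.mem_univ i)]
    have h2 : ∑ j ∈ Finset.univ \ {i}, x j = (∑ j, x j) - x i := by
      rw [← Finset.erase_eq]
      exact Finset.sum_erase_eq_sub (Finset.mem_univ i)
    rw [h1, h2]
    nlinarith [mul_pos (mul_pos hu0 hu0) hxi]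

/-- The energy exchange map `T_{i,u} : Δ → Δ` (defined to be the identity for
`u ∉ (0,1)`, which is a probability-zero event). -/
def Texch (m : ℕ) (E : ℝ) (i : Fin m) (u : ℝ) (x : Delta m E) : Delta m E :=
  if hu : u ∈ Ioo (0:ℝ) 1 then ⟨T0 m E i u x.1, T0_mem x.2 hu⟩ else x

/-- The uniform distribution on `(0,1)`. -/
def unif01 : Measure ℝ := volume.restrict (Ioo (0:ℝ) 1)

/-- The uniformization constant `Λ = √(m Ē)`, an upper bound for the total jump rate. -/
def Lam (m : ℕ) (E : ℝ) : ℝ := Real.sqrt (m * E)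

/-- The total jump rate `∑ i, √(x^i)`. -/
def jumpRate (m : ℕ) (E : ℝ) (x : Delta m E) : ℝ := ∑ i, Real.sqrt (x.1 i)

/-- One step of the uniformized embedded chain: with probability `1 - r(x)/Λ` stay put,
and with probability `√(x^i)/Λ` particle `i` exchanges energy with the tank, with
`u` drawn uniformly from `(0,1)`. -/
def ustep (m : ℕ) (E : ℝ) (x : Delta m E) : Measure (Delta m E) :=
  ENNReal.ofReal (1 - jumpRate m E x / Lam m E) • Measure.dirac x
  + (ENNReal.ofReal (Lam m E))⁻¹ •
      Measure.sum (fun i : Fin m =>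
        ENNReal.ofReal (Real.sqrt (x.1 i)) • Measure.map (fun u => Texch m E i u x) unif01)

/-- `n`-fold iterate of the uniformized chain. -/
def ustepIter (m : ℕ) (E : ℝ) : ℕ → Delta m E → Measure (Delta m E)
  | 0 => fun x => Measure.dirac x
  | (n+1) => fun x => (ustep m E x).bind (ustepIter m E n)

/-- The transition probabilities `P^t(x, ·)` of the energy-exchange jump process,
constructed by uniformization: `P^t = ∑ₙ e^{-Λt} (Λt)ⁿ/n! Kⁿ`. -/
def Pt (m : ℕ) (E : ℝ) (t : ℝ) (x : Delta m E) : Measure (Delta m E) :=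
  Measure.sum (fun n : ℕ =>
    ENNReal.ofReal (Real.exp (-(Lam m E) * t) * ((Lam m E) * t) ^ n / n.factorial) •
      ustepIter m E n x)

/-- Lebesgue measure on `Δ ≅ U`. -/
def lebU (m : ℕ) (E : ℝ) : Measure (Delta m E) := Measure.comap Subtype.val volume

/-- The (unnormalized) measure with density `y^{-1/2}` w.r.t. Lebesgue measure on `U`. -/
def piPre (m : ℕ) (E : ℝ) : Measure (Delta m E) :=
  (lebU m E).withDensity (fun x => ENNReal.ofReal ((tank m E x) ^ (-(1/2) : ℝ)))

/-- The invariant probability measure `π`, with density `Z⁻¹ y^{-1/2}`. -/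
def piMeasure (m : ℕ) (E : ℝ) : Measure (Delta m E) :=
  (piPre m E Set.univ)⁻¹ • piPre m E

/-- Total variation distance between two (finite) measures:
`sup_A |μ(A) - ν(A)|`. -/
def tvDist {X : Type*} [MeasurableSpace X] (μ ν : Measure X) : ℝ :=
  ⨆ A : {A : Set X // MeasurableSet A}, |(μ A.1).toReal - (ν A.1).toReal|

end

/-- `Xp` is a (time-homogeneous) Markov chain on `S` under `ℙ` with one-step transition
kernel `K`: the joint law of `(X_0,…,X_n, X_{n+1})` is the law of `(X_0,…,X_n)`
composed with `K` applied to the last coordinate. -/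
def IsMarkovChainWith {Ω : Type} [MeasurableSpace Ω] (ℙ : Measure Ω)
    {S : Type*} [MeasurableSpace S] (K : S → Measure S) (Xp : ℕ → Ω → S) : Prop :=
  (∀ n, Measurable (Xp n)) ∧
  ∀ n : ℕ,
    Measure.map (fun ω => ((fun i : Fin (n+1) => Xp i.1 ω), Xp (n+1) ω)) ℙ
      = (Measure.map (fun ω => (fun i : Fin (n+1) => Xp i.1 ω)) ℙ).bind
          (fun v => (K (v (Fin.last n))).map (fun z => (v, z)))

namespace ECT
open MeasureTheory ProbabilityTheory Filter Topology Set

section basics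
variable {S : Type} [MeasurableSpace S]

/-- Bounded measurable real functions. -/
structure BM (φ : S → ℝ) : Prop where
  meas : Measurable φ
  bdd : ∃ C, ∀ x, |φ x| ≤ C

noncomputable def op (Q : Kernel S S) (φ : S → ℝ) (x : S) : ℝ := ∫ z, φ z ∂Q x

lemma BM.const (c : ℝ) : BM (fun _ : S => c) := ⟨measurable_const, |c|, fun _ => le_rfl⟩

lemma BM.add {φ ψ : S → ℝ} (h : BM φ) (k : BM ψ) : BM (fun x => φ x + ψ x) := by
  obtain ⟨C, hC⟩ := h.bdd
  obtain ⟨D, hD⟩ := k.bdd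
  exact ⟨h.meas.add k.meas, C + D, fun x => (abs_add_le _ _).trans (add_le_add (hC x) (hD x))⟩

lemma BM.sub {φ ψ : S → ℝ} (h : BM φ) (k : BM ψ) : BM (fun x => φ x - ψ x) := by
  obtain ⟨C, hC⟩ := h.bdd
  obtain ⟨D, hD⟩ := k.bdd
  exact ⟨h.meas.sub k.meas, C + D, fun x => (abs_sub _ _).trans (add_le_add (hC x) (hD x))⟩

lemma BM.mul {φ ψ : S → ℝ} (h : BM φ) (k : BM ψ) : BM (fun x => φ x * ψ x) := by
  obtain ⟨C, hC⟩ := h.bdd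
  obtain ⟨D, hD⟩ := k.bdd
  refine ⟨h.meas.mul k.meas, C * D, fun x => ?_⟩
  rw [abs_mul]
  exact mul_le_mul (hC x) (hD x) (abs_nonneg _) ((abs_nonneg _).trans (hC x))

lemma BM.abs {φ : S → ℝ} (h : BM φ) : BM (fun x => |φ x|) := by
  obtain ⟨C, hC⟩ := h.bdd
  exact ⟨h.meas.abs, C, fun x => by simpa using hC x⟩

lemma BM.sum {ι : Type*} {s : Finset ι} {φ : ι → S → ℝ} (h : ∀ i ∈ s, BM (φ i)) :
    BM (fun x => ∑ i ∈ s, φ i x) := by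
  classical
  induction s using Finset.induction_on with
  | empty => simpa using BM.const 0
  | insert a s ha ih =>
    simp only [Finset.sum_insert ha]
    exact (h a (by simp)).add (ih fun i hi => h i (by simp [hi]))

lemma BM.pos_bdd {φ : S → ℝ} (h : BM φ) : ∃ C, 0 < C ∧ ∀ x, |φ x| ≤ C := by
  obtain ⟨C, hC⟩ := h.bdd
  exact ⟨max C 1, by positivity, fun x => (hC x).trans (le_max_left _ _)⟩

lemma BM.integrable {φ : S → ℝ} (h : BM φ) (μ : Measure S) [IsFiniteMeasure μ] :
    Integrable φ μ := by
  obtain ⟨C, hC⟩ := h.bdd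
  exact Integrable.of_bound h.meas.aestronglyMeasurable C (ae_of_all _ hC)

lemma BM.comp {T : Type} [MeasurableSpace T] {φ : S → ℝ} (h : BM φ) {g : T → S}
    (hg : Measurable g) : BM (fun x => φ (g x)) := by
  obtain ⟨C, hC⟩ := h.bdd
  exact ⟨h.meas.comp hg, C, fun x => hC _⟩

variable {Q : Kernel S S} [IsMarkovKernel Q]

lemma op_bound {φ : S → ℝ} {C : ℝ} (h : ∀ x, |φ x| ≤ C) (x : S) : |op Q φ x| ≤ C := by
  unfold op
  have := norm_integral_le_of_norm_le_const (f := φ) (μ := Q x) (ae_of_all _ h)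
  simpa using this

lemma BM.op {φ : S → ℝ} (h : BM φ) : BM (op Q φ) := by
  obtain ⟨C, hC⟩ := h.bdd
  exact ⟨(h.meas.stronglyMeasurable.integral_kernel).measurable, C, op_bound hC⟩

lemma BM.iter {φ : S → ℝ} (h : BM φ) (n : ℕ) : BM ((ECT.op Q)^[n] φ) := by
  induction n with
  | zero => simpa using h
  | succ n ih => rw [Function.iterate_succ_apply']; exact ih.op

lemma op_iter_bound {φ : S → ℝ} {C : ℝ} (h : ∀ x, |φ x| ≤ C) (n : ℕ) (x : S) :
    |(op Q)^[n] φ x| ≤ C := by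
  induction n generalizing x with
  | zero => simpa using h x
  | succ n ih => rw [Function.iterate_succ_apply']; exact op_bound ih x

lemma op_const (c : ℝ) : op Q (fun _ => c) = fun _ => c := by
  funext x; simp [op]

lemma op_add {φ ψ : S → ℝ} (h : BM φ) (k : BM ψ) :
    op Q (fun x => φ x + ψ x) = fun x => op Q φ x + op Q ψ x := by
  funext x; exact integral_add (h.integrable _) (k.integrable _)

lemma op_sub {φ ψ : S → ℝ} (h : BM φ) (k : BM ψ) :
    op Q (fun x => φ x - ψ x) = fun x => op Q φ x - op Q ψ x := by
  funext x; exact integral_sub (h.integrable _) (k.integrable _)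

lemma op_sum {φ : ℕ → S → ℝ} (h : ∀ i, BM (φ i)) (n : ℕ) :
    op Q (fun x => ∑ i ∈ Finset.range n, φ i x) = fun x => ∑ i ∈ Finset.range n, op Q (φ i) x := by
  funext x; exact integral_finsetSum _ fun i _ => (h i).integrable _

lemma op_iter_sub_const {φ : S → ℝ} (h : BM φ) (c : ℝ) (n : ℕ) :
    (op Q)^[n] (fun x => φ x - c) = fun x => (op Q)^[n] φ x - c := by
  induction n with
  | zero => rfl
  | succ n ih =>
    rw [Function.iterate_succ_apply', ih, op_sub (h.iter n) (BM.const c), op_const,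
      Function.iterate_succ_apply']

/-- reversibility -/
def Rev (Q : Kernel S S) (ν : Measure S) : Prop :=
  ∀ φ ψ : S → ℝ, BM φ → BM ψ → ∫ x, φ x * op Q ψ x ∂ν = ∫ x, op Q φ x * ψ x ∂ν

lemma Rev.inv {ν : Measure S} (hr : Rev Q ν) {φ : S → ℝ} (h : BM φ) :
    ∫ x, op Q φ x ∂ν = ∫ x, φ x ∂ν := by
  have := hr (fun _ => 1) φ (BM.const 1) h
  rw [op_const] at this
  simpa using this

lemma Rev.inv_iter {ν : Measure S} (hr : Rev Q ν) {φ : S → ℝ} (h : BM φ) (n : ℕ) :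
    ∫ x, (op Q)^[n] φ x ∂ν = ∫ x, φ x ∂ν := by
  induction n with
  | zero => rfl
  | succ n ih => rw [Function.iterate_succ_apply', hr.inv (h.iter n), ih]

lemma Rev.iter {ν : Measure S} (hr : Rev Q ν) {φ ψ : S → ℝ} (h : BM φ) (k : BM ψ) (n : ℕ) :
    ∫ x, φ x * (op Q)^[n] ψ x ∂ν = ∫ x, (op Q)^[n] φ x * ψ x ∂ν := by
  induction n generalizing φ with
  | zero => rfl
  | succ n ih =>
    rw [Function.iterate_succ_apply', hr _ _ h (k.iter n), ih h.op, Function.iterate_succ_apply]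

lemma Rev.iter_iter {ν : Measure S} (hr : Rev Q ν) {φ : S → ℝ} (h : BM φ) (a b : ℕ) :
    ∫ x, (op Q)^[a] φ x * (op Q)^[b] φ x ∂ν = ∫ x, φ x * (op Q)^[a + b] φ x ∂ν := by
  rw [Function.iterate_add_apply, hr.iter h (h.iter b)]

/-- chain -/
def Chain {Ω : Type} [MeasurableSpace Ω] (Q : Kernel S S) (P : Measure Ω) (X : ℕ → Ω → S) : Prop :=
  (∀ n, Measurable (X n)) ∧
  ∀ (n : ℕ) (Φ : (Fin (n + 1) → S) × S → ℂ), Measurable Φ → (∃ C, ∀ p, ‖Φ p‖ ≤ C) →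
    ∫ ω, Φ (fun i => X i ω, X (n + 1) ω) ∂P =
      ∫ ω, ∫ z, Φ (fun i => X i ω, z) ∂(Q (X n ω)) ∂P

lemma Chain.of_compProd {Ω : Type} [MeasurableSpace Ω] {P : Measure Ω} [IsProbabilityMeasure P]
    {X : ℕ → Ω → S} (hX : ∀ n, Measurable (X n))
    (h : ∀ n : ℕ, P.map (fun ω => ((fun i : Fin (n+1) => X i.1 ω), X (n+1) ω)) =
      (P.map (fun ω => (fun i : Fin (n+1) => X i.1 ω))) ⊗ₘ
        (Q.comap (fun v : Fin (n+1) → S => v (Fin.last n)) (measurable_pi_apply _))) :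
    Chain Q P X := by
  refine ⟨hX, fun n Φ hΦ ⟨C, hC⟩ => ?_⟩
  have hp : Measurable (fun ω => (fun i : Fin (n+1) => X i.1 ω)) :=
    measurable_pi_lambda _ fun i => hX _
  have : IsProbabilityMeasure (P.map (fun ω => (fun i : Fin (n+1) => X i.1 ω))) :=
    Measure.isProbabilityMeasure_map hp.aemeasurable
  have e := integral_map (μ := P) (hp.prodMk (hX (n+1))).aemeasurable
    (f := Φ) hΦ.aestronglyMeasurable
  rw [h n, Measure.integral_compProd
    (Integrable.of_bound hΦ.aestronglyMeasurable C (ae_of_all _ hC)), integral_map hp.aemeasurable] at e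
  · rw [← e]; simp [Kernel.comap_apply]
  · exact (StronglyMeasurable.integral_kernel_prod_right'
      (κ := Q.comap (fun v : Fin (n+1) → S => v (Fin.last n)) (measurable_pi_apply _))
      hΦ.stronglyMeasurable).aestronglyMeasurable

lemma Chain.of_isMarkovChainWith {Ω : Type} [MeasurableSpace Ω] {P : Measure Ω}
    [IsProbabilityMeasure P] {X : ℕ → Ω → S} (h : IsMarkovChainWith P (fun x => Q x) X) :
    Chain Q P X := by
  refine Chain.of_compProd h.1 fun n => ?_
  rw [h.2 n]
  have hp : Measurable (fun ω => (fun i : Fin (n+1) => X i.1 ω)) :=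
    measurable_pi_lambda _ fun i => h.1 _
  have : IsProbabilityMeasure (P.map (fun ω => (fun i : Fin (n+1) => X i.1 ω))) :=
    Measure.isProbabilityMeasure_map hp.aemeasurable
  rw [Measure.compProd_eq_comp_prod]
  congr 1
  funext v
  ext s hs
  rw [Kernel.prod_apply, Measure.map_apply (by fun_prop) hs, Kernel.id_apply, Kernel.comap_apply,
    Measure.dirac_prod, Measure.map_apply (by fun_prop) hs]

lemma exists_chain (Q : Kernel S S) [IsMarkovKernel Q] (ν : Measure S) [IsProbabilityMeasure ν] :
    ∃ (P : Measure (ℕ → S)) (_ : IsProbabilityMeasure P) (X : ℕ → (ℕ → S) → S),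
      Chain Q P X ∧ P.map (X 0) = ν := by
  let κ : (n : ℕ) → Kernel ((i : Finset.Iic n) → (fun _ : ℕ => S) i) ((fun _ : ℕ => S) (n+1)) :=
    fun n => Q.comap (fun v => v ⟨n, by simp⟩) (measurable_pi_apply _)
  have : ∀ n, IsMarkovKernel (κ n) := fun n => by dsimp [κ]; infer_instance
  refine ⟨Kernel.trajMeasure (X := fun _ => S) ν κ, inferInstance, fun n ω => ω n,
    Chain.of_compProd (fun n => measurable_pi_apply n) fun n => ?_, ?_⟩
  · have h := Kernel.map_frestrictLe_trajMeasure_compProd_eq_map_trajMeasure (X := fun _ => S)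
      (κ := κ) (μ₀ := ν) (a := n)
    set P := Kernel.trajMeasure (X := fun _ => S) ν κ
    let g : ((i : Finset.Iic n) → S) → (Fin (n+1) → S) :=
      fun v i => v ⟨i.1, by have := i.2; simp; omega⟩
    have hg : Measurable g := measurable_pi_lambda _ fun i => measurable_pi_apply _
    have hf : Measurable (Preorder.frestrictLe (π := fun _ : ℕ => S) n) := by fun_prop
    have e1 : P.map (fun ω => (fun i : Fin (n+1) => ω i.1)) =
        (P.map (Preorder.frestrictLe (π := fun _ : ℕ => S) n)).map g := by
      rw [Measure.map_map hg hf]; rfl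
    have e2 : P.map (fun ω => ((fun i : Fin (n+1) => ω i.1), ω (n+1))) =
        (P.map (fun x => (Preorder.frestrictLe (π := fun _ : ℕ => S) n x, x (n + 1)))).map
          (Prod.map g id) := by
      rw [Measure.map_map (hg.prodMap measurable_id) (hf.prodMk (measurable_pi_apply _))]; rfl
    have : IsProbabilityMeasure (P.map (Preorder.frestrictLe (π := fun _ : ℕ => S) n)) :=
      Measure.isProbabilityMeasure_map hf.aemeasurable
    have : IsProbabilityMeasure
        ((P.map (Preorder.frestrictLe (π := fun _ : ℕ => S) n)).map g) :=
      Measure.isProbabilityMeasure_map hg.aemeasurable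
    rw [e2, ← h, e1]
    ext s hs
    rw [Measure.map_apply (hg.prodMap measurable_id) hs, Measure.compProd_apply hs,
      Measure.compProd_apply ((hg.prodMap measurable_id) hs), lintegral_map _ hg]
    · rfl
    · exact Kernel.measurable_kernel_prodMk_left hs
  · rw [Kernel.trajMeasure, Measure.map_comp _ _ (measurable_pi_apply _)]
    have h := Kernel.traj_map_frestrictLe (X := fun _ => S) (κ := κ) 0 0
    have e : (Kernel.traj (X := fun _ => S) κ 0).map (fun ω : ℕ → S => ω 0) =
        Kernel.deterministic (fun v : (i : Finset.Iic 0) → S => v ⟨0, by simp⟩)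
          (measurable_pi_apply _) := by
      have e3 : (fun ω : ℕ → S => ω 0) = (fun v : (i : Finset.Iic 0) → S => v ⟨0, by simp⟩) ∘
        (Preorder.frestrictLe (π := fun _ : ℕ => S) 0) := rfl
      rw [e3, Kernel.map_comp_right _ (by fun_prop) (measurable_pi_apply _), h,
        Kernel.partialTraj_self, Kernel.id_map]
    rw [e, Measure.deterministic_comp_eq_map, Measure.map_map (measurable_pi_apply _) (by fun_prop)]
    exact Measure.map_id
end basics
end ECT

set_option linter.unusedSectionVars false
namespace ECT
open MeasureTheory ProbabilityTheory Filter Topology Set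

section markov
variable {S : Type} [MeasurableSpace S] {Q : Kernel S S} [IsMarkovKernel Q]
variable {Ω : Type} [MeasurableSpace Ω] {P : Measure Ω} [IsProbabilityMeasure P] {X : ℕ → Ω → S}

def Past (X : ℕ → Ω → S) (n : ℕ) (F : Ω → ℂ) : Prop :=
  ∃ F' : (Fin (n + 1) → S) → ℂ, Measurable F' ∧ (∃ C, ∀ v, ‖F' v‖ ≤ C) ∧
    ∀ ω, F ω = F' (fun i => X i ω)

lemma Past.one (n : ℕ) : Past X n (fun _ => 1) :=
  ⟨fun _ => 1, measurable_const, ⟨1, by simp⟩, fun _ => rfl⟩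

lemma Past.mul {n : ℕ} {F G : Ω → ℂ} (hF : Past X n F) (hG : Past X n G) :
    Past X n (fun ω => F ω * G ω) := by
  obtain ⟨F', h1, ⟨C, hC⟩, h2⟩ := hF
  obtain ⟨G', k1, ⟨D, hD⟩, k2⟩ := hG
  refine ⟨fun v => F' v * G' v, h1.mul k1, ⟨C * D, fun v => ?_⟩, fun ω => by simp only [h2, k2]⟩
  rw [norm_mul]
  exact mul_le_mul (hC v) (hD v) (norm_nonneg _) ((norm_nonneg _).trans (hC v))

lemma Past.succ {n : ℕ} {F : Ω → ℂ} (hF : Past X n F) : Past X (n + 1) F := by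
  obtain ⟨F', h1, ⟨C, hC⟩, h2⟩ := hF
  refine ⟨fun v => F' (fun i => v i.castSucc), h1.comp (by fun_prop), ⟨C, fun v => hC _⟩,
    fun ω => by rw [h2]; rfl⟩

lemma Past.of2 {n : ℕ} {ψ : S × S → ℂ} (hψ : Measurable ψ) (hb : ∃ C, ∀ p, ‖ψ p‖ ≤ C) :
    Past X (n + 1) (fun ω => ψ (X n ω, X (n + 1) ω)) := by
  obtain ⟨C, hC⟩ := hb
  refine ⟨fun v => ψ (v (Fin.last n).castSucc, v (Fin.last (n+1))), hψ.comp (by fun_prop),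
    ⟨C, fun v => hC _⟩, fun ω => by simp⟩

lemma Past.measurable (hX : ∀ n, Measurable (X n)) {n : ℕ} {F : Ω → ℂ} (hF : Past X n F) :
    Measurable F := by
  obtain ⟨F', h1, ⟨C, hC⟩, h2⟩ := hF
  rw [funext h2]
  exact h1.comp (measurable_pi_lambda _ fun i => hX _)

lemma Chain.markov (h : Chain Q P X) {n : ℕ} {F : Ω → ℂ} (hF : Past X n F)
    {ψ : S × S → ℂ} (hψ : Measurable ψ) (hb : ∃ C, ∀ p, ‖ψ p‖ ≤ C) :
    ∫ ω, F ω * ψ (X n ω, X (n + 1) ω) ∂P = ∫ ω, F ω * ∫ z, ψ (X n ω, z) ∂(Q (X n ω)) ∂P := by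
  obtain ⟨F', h1, ⟨C, hC⟩, h2⟩ := hF
  obtain ⟨D, hD⟩ := hb
  have := h.2 n (fun p => F' p.1 * ψ (p.1 (Fin.last n), p.2))
    ((h1.comp measurable_fst).mul (hψ.comp (by fun_prop))) ⟨C * D, fun p => by
      rw [norm_mul]
      exact mul_le_mul (hC _) (hD _) (norm_nonneg _) ((norm_nonneg _).trans (hC p.1))⟩
  simp only [Fin.val_last, integral_const_mul, ← h2] at this
  exact this

lemma Chain.iter (h : Chain Q P X) {n : ℕ} {F : Ω → ℂ} (hF : Past X n F)
    {w : S → ℝ} (hw : BM w) (l : ℕ) :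
    ∫ ω, F ω * (w (X (n + l) ω) : ℂ) ∂P = ∫ ω, F ω * ((op Q)^[l] w (X n ω) : ℂ) ∂P := by
  induction l generalizing w with
  | zero => rfl
  | succ l ih =>
    have hl : Past X (n + l) F := by
      clear ih
      induction l with
      | zero => exact hF
      | succ l ih => exact ih.succ
    obtain ⟨C, hC⟩ := hw.bdd
    have := h.markov hl (ψ := fun p => (w p.2 : ℂ))
      (Complex.measurable_ofReal.comp (hw.meas.comp measurable_snd)) ⟨C, fun p => by simpa using hC _⟩
    rw [← add_assoc, this, Function.iterate_succ_apply, ← ih hw.op]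
    simp only [op, integral_complex_ofReal]

lemma Chain.law {ν : Measure S} [IsProbabilityMeasure ν] (h : Chain Q P X) (hr : Rev Q ν)
    (h0 : P.map (X 0) = ν)
    {φ : S → ℝ} (hφ : BM φ) (n : ℕ) : ∫ ω, φ (X n ω) ∂P = ∫ x, φ x ∂ν := by
  have := h.iter (Past.one 0) hφ n
  simp only [one_mul, integral_complex_ofReal, zero_add] at this
  rw [Complex.ofReal_inj.1 this, ← hr.inv_iter hφ n, ← h0,
    integral_map (h.1 0).aemeasurable (hφ.iter n).meas.aestronglyMeasurable]

lemma Chain.two {ν : Measure S} [IsProbabilityMeasure ν] (h : Chain Q P X) (hr : Rev Q ν)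
    (h0 : P.map (X 0) = ν) {φ ψ : S → ℝ} (hφ : BM φ) (hψ : BM ψ) (n l : ℕ) :
    ∫ ω, φ (X n ω) * ψ (X (n + l) ω) ∂P = ∫ x, φ x * (op Q)^[l] ψ x ∂ν := by
  obtain ⟨C, hC⟩ := hφ.bdd
  have hp : Past X n (fun ω => (φ (X n ω) : ℂ)) :=
    ⟨fun v => (φ (v (Fin.last n)) : ℂ),
      Complex.measurable_ofReal.comp (hφ.meas.comp (measurable_pi_apply _)),
      ⟨C, fun v => by simpa using hC _⟩, fun ω => by simp⟩
  have := h.iter hp hψ l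
  simp only [← Complex.ofReal_mul, integral_complex_ofReal] at this
  rw [Complex.ofReal_inj.1 this]
  exact h.law hr h0 (hφ.mul (hψ.iter l)) n

lemma Chain.shift (h : Chain Q P X) (N : ℕ) : Chain Q P (fun n => X (N + n)) := by
  refine ⟨fun n => h.1 _, fun n Φ hΦ ⟨C, hC⟩ => ?_⟩
  have := h.2 (N + n) (fun p => Φ (fun i => p.1 ⟨N + i, by omega⟩, p.2))
    (hΦ.comp (by fun_prop)) ⟨C, fun p => hC _⟩
  exact this

/-- path functionals depend on the law of the chain only through the initial value -/
lemma path_functional (Q : Kernel S S) [IsMarkovKernel Q] (n : ℕ) (Φ : (Fin (n + 1) → S) → ℂ)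
    (hΦ : Measurable Φ) (hb : ∀ v, ‖Φ v‖ ≤ 1) :
    ∃ φ : S → ℂ, Measurable φ ∧ (∀ x, ‖φ x‖ ≤ 1) ∧
      ∀ {Ω : Type} [MeasurableSpace Ω] (P : Measure Ω) [IsProbabilityMeasure P] (X : ℕ → Ω → S),
        Chain Q P X → ∫ ω, Φ (fun i => X i ω) ∂P = ∫ ω, φ (X 0 ω) ∂P := by
  induction n with
  | zero =>
    refine ⟨fun x => Φ (fun _ => x), hΦ.comp (by fun_prop), fun x => hb _, ?_⟩
    intro Ω _ P _ X h
    congr 1; funext ω; congr 1; funext i; congr; omega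
  | succ n ih =>
    let Ψ : (Fin (n + 1) → S) × S → ℂ := fun p => Φ (Fin.snoc (α := fun _ => S) p.1 p.2)
    have hΨ : Measurable Ψ := by
      refine hΦ.comp (measurable_pi_lambda _ fun i => ?_)
      induction i using Fin.lastCases with
      | last => simpa using measurable_snd
      | cast i =>
        simp only [Fin.snoc_castSucc]
        exact (measurable_pi_apply i).comp measurable_fst
    obtain ⟨φ, h1, h2, h3⟩ := ih (fun v => ∫ z, Ψ (v, z) ∂(Q (v (Fin.last n))))
      (StronglyMeasurable.integral_kernel_prod_right'
      (κ := Q.comap (fun v : Fin (n+1) → S => v (Fin.last n)) (measurable_pi_apply _))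
      hΨ.stronglyMeasurable).measurable (fun v => by
        have := norm_integral_le_of_norm_le_const (f := fun z => Ψ (v, z))
          (μ := Q (v (Fin.last n))) (C := 1) (ae_of_all _ fun z => hb _)
        simpa using this)
    refine ⟨φ, h1, h2, ?_⟩
    intro Ω _ P _ X h
    rw [← h3 P X h]
    have := h.2 n Ψ hΨ ⟨1, fun p => hb _⟩
    simp only [Fin.val_last]
    rw [← this]
    congr 1; funext ω
    simp only [Ψ]
    congr 1
    funext i
    induction i using Fin.lastCases with
    | last => simp
    | cast i => simp
end markov
end ECT

set_option linter.unusedSectionVars false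
namespace ECT
open MeasureTheory ProbabilityTheory Filter Topology Set

section mart
variable {S : Type} [MeasurableSpace S] {Q : Kernel S S} [IsMarkovKernel Q]
variable {Ω : Type} [MeasurableSpace Ω] {P : Measure Ω} [IsProbabilityMeasure P] {X : ℕ → Ω → S}
variable {ν : Measure S} [IsProbabilityMeasure ν]

noncomputable def mD (Q : Kernel S S) (h : S → ℝ) (p : S × S) : ℝ := h p.2 - op Q h p.1
noncomputable def mV (Q : Kernel S S) (h : S → ℝ) (x : S) : ℝ :=
  op Q (fun z => h z * h z) x - op Q h x * op Q h x
noncomputable def mM (Q : Kernel S S) (h : S → ℝ) (X : ℕ → Ω → S) (j : ℕ) (ω : Ω) : ℝ :=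
  ∑ i ∈ Finset.range j, mD Q h (X i ω, X (i + 1) ω)

lemma mD_meas {h : S → ℝ} (hh : BM h) : Measurable (mD Q h) :=
  (hh.meas.comp measurable_snd).sub ((hh.op (Q := Q)).meas.comp measurable_fst)

lemma mV_BM {h : S → ℝ} (hh : BM h) : BM (mV Q h) := (hh.mul hh).op.sub (hh.op.mul hh.op)

lemma mD_int {h : S → ℝ} (hh : BM h) (x : S) : ∫ z, mD Q h (x, z) ∂(Q x) = 0 := by
  change ∫ z, (h z - op Q h x) ∂(Q x) = 0
  rw [integral_sub (hh.integrable _) (integrable_const _)]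
  simp [op]

lemma mD_int2 {h : S → ℝ} (hh : BM h) (x : S) :
    ∫ z, mD Q h (x, z) ^ 2 ∂(Q x) = mV Q h x := by
  unfold mD mV
  have : ∀ z, (h z - op Q h x) ^ 2 = h z * h z - (2 * op Q h x * h z - op Q h x * op Q h x) := by
    intro z; ring
  simp only [this]
  have i3 : Integrable (fun z => 2 * op Q h x * h z - op Q h x * op Q h x) (Q x) :=
    ((hh.integrable _).const_mul _).sub (integrable_const _)
  rw [integral_sub ((hh.mul hh).integrable _) i3,
    integral_sub ((hh.integrable _).const_mul _) (integrable_const _), integral_const_mul]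
  simp [op]; ring

lemma mV_nonneg {h : S → ℝ} (hh : BM h) (x : S) : 0 ≤ mV Q h x := by
  rw [← mD_int2 hh]; exact integral_nonneg fun z => sq_nonneg _

lemma exp_third {x : ℝ} (hx : |x| ≤ 1) :
    ‖Complex.exp (x * Complex.I) - (1 + x * Complex.I - (x ^ 2 / 2 : ℝ))‖ ≤ |x| ^ 3 := by
  have h := Complex.exp_bound (x := x * Complex.I) (by simpa using hx) (n := 3) (by norm_num)
  have e : ∑ m ∈ Finset.range 3, (x * Complex.I) ^ m / (m.factorial : ℂ) =
      1 + x * Complex.I - (x ^ 2 / 2 : ℝ) := by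
    simp [Finset.sum_range_succ, Nat.factorial, mul_pow]
    ring
  rw [e] at h
  refine h.trans ?_
  simp only [norm_mul, Complex.norm_real, Complex.norm_I, mul_one, Real.norm_eq_abs]
  have : (0:ℝ) ≤ |x| ^ 3 := by positivity
  norm_num [Nat.factorial]
  linarith

lemma one_step {h : S → ℝ} (hh : BM h) {B : ℝ} (hB : ∀ p, |mD Q h p| ≤ B) {a : ℝ}
    (ha : |a| * B ≤ 1) (x : S) :
    ‖∫ z, Complex.exp ((a * mD Q h (x, z) : ℝ) * Complex.I) ∂(Q x)
      - (1 - (a ^ 2 / 2 * mV Q h x : ℝ))‖ ≤ (|a| * B) ^ 3 := by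
  have hm : Measurable fun z => mD Q h (x, z) := (mD_meas hh).comp (by fun_prop)
  have hm2 : Measurable fun z => ((mD Q h (x, z) : ℝ) : ℂ) := Complex.measurable_ofReal.comp hm
  have hb : ∀ z, |a * mD Q h (x, z)| ≤ |a| * B := fun z => by
    rw [abs_mul]; exact mul_le_mul_of_nonneg_left (hB _) (abs_nonneg _)
  have i1 : Integrable (fun z => Complex.exp ((a * mD Q h (x, z) : ℝ) * Complex.I)) (Q x) :=
    Integrable.of_bound (Measurable.aestronglyMeasurable (by fun_prop)) 1 (ae_of_all _ fun z => by rw [Complex.norm_exp_ofReal_mul_I])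
  have j1 : Integrable (fun z => a * mD Q h (x, z)) (Q x) :=
    Integrable.of_bound (Measurable.aestronglyMeasurable (by fun_prop)) (|a| * B) (ae_of_all _ hb)
  have j2 : Integrable (fun z => (a * mD Q h (x, z)) ^ 2 / 2) (Q x) :=
    Integrable.of_bound (Measurable.aestronglyMeasurable (by fun_prop)) ((|a| * B) ^ 2 / 2) (ae_of_all _ fun z => by
      have := hb z
      rw [Real.norm_eq_abs, abs_div, abs_pow]
      rw [abs_two]
      exact div_le_div_of_nonneg_right (pow_le_pow_left₀ (abs_nonneg _) this 2) (by norm_num))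
  have i2 : Integrable (fun z => (1 + ((a * mD Q h (x, z) : ℝ) : ℂ) * Complex.I
      - (((a * mD Q h (x, z)) ^ 2 / 2 : ℝ) : ℂ))) (Q x) :=
    (((integrable_const (1:ℂ)).add ((j1.ofReal (𝕜 := ℂ)).mul_const _)).sub (j2.ofReal (𝕜 := ℂ)))
  have e2 : ∫ z, (1 + ((a * mD Q h (x, z) : ℝ) : ℂ) * Complex.I
      - (((a * mD Q h (x, z)) ^ 2 / 2 : ℝ) : ℂ)) ∂(Q x) = (1 - (a ^ 2 / 2 * mV Q h x : ℝ)) := by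
    have i4 : Integrable (fun z => (1 + ((a * mD Q h (x, z) : ℝ) : ℂ) * Complex.I)) (Q x) :=
      (integrable_const (1:ℂ)).add ((j1.ofReal (𝕜 := ℂ)).mul_const _)
    have j1' : Integrable (fun z => ((a * mD Q h (x, z) : ℝ) : ℂ) * Complex.I) (Q x) :=
      (j1.ofReal (𝕜 := ℂ)).mul_const _
    have j2' : Integrable (fun z => (((a * mD Q h (x, z)) ^ 2 / 2 : ℝ) : ℂ)) (Q x) :=
      j2.ofReal (𝕜 := ℂ)
    rw [integral_sub i4 j2',
      integral_add (integrable_const (1:ℂ)) j1',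
      integral_mul_const, integral_complex_ofReal, integral_complex_ofReal, integral_const_mul,
      mD_int hh]
    have : ∀ z, (a * mD Q h (x, z)) ^ 2 / 2 = a ^ 2 / 2 * mD Q h (x, z) ^ 2 := fun z => by ring
    simp only [this, integral_const_mul, mD_int2 hh]
    simp
  rw [← e2, ← integral_sub i1 i2]
  have := norm_integral_le_of_norm_le_const (μ := Q x) (C := (|a| * B) ^ 3)
    (f := fun z => Complex.exp ((a * mD Q h (x, z) : ℝ) * Complex.I) -
      (1 + ((a * mD Q h (x, z) : ℝ) : ℂ) * Complex.I - (((a * mD Q h (x, z)) ^ 2 / 2 : ℝ) : ℂ)))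
    (ae_of_all _ fun z => (exp_third ((hb z).trans ha)).trans
      (pow_le_pow_left₀ (abs_nonneg _) (hb z) 3))
  simpa using this

lemma past_exp {h : S → ℝ} (hh : BM h) (a : ℝ) (j : ℕ) :
    Past X j (fun ω => Complex.exp ((a * mM Q h X j ω : ℝ) * Complex.I)) := by
  induction j with
  | zero => simpa [mM] using Past.one (X := X) 0
  | succ j ih =>
    have h2 := ih.succ.mul (Past.of2 (X := X) (n := j)
      (ψ := fun p => Complex.exp ((a * mD Q h p : ℝ) * Complex.I))
      (by have := mD_meas (Q := Q) hh; fun_prop)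
      ⟨1, fun p => by rw [Complex.norm_exp_ofReal_mul_I]⟩)
    convert h2 using 2 with ω
    rw [← Complex.exp_add]
    congr 1
    simp only [mM, Finset.sum_range_succ]
    push_cast; ring

lemma norm_exp_sub_le (x y : ℝ) :
    ‖Complex.exp (x * Complex.I) - Complex.exp (y * Complex.I)‖ ≤ |x - y| := by
  have e : Complex.exp (x * Complex.I) - Complex.exp (y * Complex.I) =
      Complex.exp (y * Complex.I) * (Complex.exp (Complex.I * (x - y : ℝ)) - 1) := by
    rw [mul_sub, ← Complex.exp_add]; congr 2
    · push_cast; ring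
    · ring
  rw [e, norm_mul, Complex.norm_exp_ofReal_mul_I, one_mul]
  exact Real.norm_exp_I_mul_ofReal_sub_one_le

lemma mixing_bound (hX : Chain Q P X) (hr : Rev Q ν) (h0 : P.map (X 0) = ν)
    {h : S → ℝ} (hh : BM h) {B : ℝ} (hB : ∀ p, |mD Q h p| ≤ B) (a : ℝ)
    {v : S → ℝ} (hv : BM v) {C : ℝ} (hC : ∀ x, |v x| ≤ C) (p l : ℕ) :
    ‖∫ ω, Complex.exp ((a * mM Q h X (p + l) ω : ℝ) * Complex.I) * (v (X (p + l) ω) : ℂ) ∂P‖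
      ≤ ∫ x, |(op Q)^[l] v x| ∂ν + |a| * (l * B) * C := by
  have m1 := (past_exp (X := X) (Q := Q) hh a (p + l)).measurable hX.1
  have m2 := (past_exp (X := X) (Q := Q) hh a p).measurable hX.1
  have mv : Measurable fun ω => (v (X (p + l) ω) : ℂ) :=
    Complex.measurable_ofReal.comp (hv.meas.comp (hX.1 _))
  have i1 : Integrable (fun ω => Complex.exp ((a * mM Q h X (p + l) ω : ℝ) * Complex.I) *
      (v (X (p + l) ω) : ℂ)) P :=
    Integrable.of_bound (m1.mul mv).aestronglyMeasurable C (ae_of_all _ fun ω => by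
      rw [norm_mul, Complex.norm_exp_ofReal_mul_I]; simpa using hC _)
  have i2 : Integrable (fun ω => Complex.exp ((a * mM Q h X p ω : ℝ) * Complex.I) *
      (v (X (p + l) ω) : ℂ)) P :=
    Integrable.of_bound (m2.mul mv).aestronglyMeasurable C (ae_of_all _ fun ω => by
      rw [norm_mul, Complex.norm_exp_ofReal_mul_I]; simpa using hC _)
  have hMd : ∀ ω, |mM Q h X (p + l) ω - mM Q h X p ω| ≤ l * B := by
    intro ω
    unfold mM
    rw [Finset.sum_range_add, add_sub_cancel_left]
    refine (Finset.abs_sum_le_sum_abs _ _).trans ?_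
    refine (Finset.sum_le_sum fun i _ => hB _).trans ?_
    simp
  have e := hX.iter (past_exp (X := X) (Q := Q) hh a p) hv l
  have b1 : ‖∫ ω, Complex.exp ((a * mM Q h X p ω : ℝ) * Complex.I) * (v (X (p + l) ω) : ℂ) ∂P‖
      ≤ ∫ x, |(op Q)^[l] v x| ∂ν := by
    rw [e]
    refine (norm_integral_le_integral_norm _).trans (le_of_eq ?_)
    simp only [norm_mul, Complex.norm_exp_ofReal_mul_I, one_mul, Complex.norm_real,
      Real.norm_eq_abs]
    exact hX.law hr h0 (hv.iter l).abs p
  have b2 : ‖∫ ω, (Complex.exp ((a * mM Q h X (p + l) ω : ℝ) * Complex.I) *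
      (v (X (p + l) ω) : ℂ) - Complex.exp ((a * mM Q h X p ω : ℝ) * Complex.I) *
      (v (X (p + l) ω) : ℂ)) ∂P‖ ≤ |a| * (l * B) * C := by
    refine (norm_integral_le_of_norm_le_const (C := |a| * (l * B) * C) (ae_of_all _ fun ω => ?_)).trans (by simp)
    rw [← sub_mul, norm_mul]
    have h1 := norm_exp_sub_le (a * mM Q h X (p + l) ω) (a * mM Q h X p ω)
    rw [← mul_sub, abs_mul] at h1
    have h3 : ‖(v (X (p + l) ω) : ℂ)‖ ≤ C := by simpa using hC _
    exact mul_le_mul (h1.trans (mul_le_mul_of_nonneg_left (hMd ω) (abs_nonneg _))) h3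
      (norm_nonneg _) (mul_nonneg (abs_nonneg _) ((abs_nonneg _).trans (hMd ω)))
  rw [integral_sub i1 i2] at b2
  have := norm_add_le (∫ ω, Complex.exp ((a * mM Q h X p ω : ℝ) * Complex.I) * (v (X (p + l) ω) : ℂ) ∂P)
    (∫ ω, Complex.exp ((a * mM Q h X (p + l) ω : ℝ) * Complex.I) *
      (v (X (p + l) ω) : ℂ) ∂P - ∫ ω, Complex.exp ((a * mM Q h X p ω : ℝ) * Complex.I) *
      (v (X (p + l) ω) : ℂ) ∂P)
  rw [add_sub_cancel] at this
  linarith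

lemma step_bound (hX : Chain Q P X)
    {h : S → ℝ} (hh : BM h) {B : ℝ} (hB : ∀ p, |mD Q h p| ≤ B) {a : ℝ} (ha : |a| * B ≤ 1)
    (s : ℝ) (j : ℕ) :
    ‖∫ ω, Complex.exp ((a * mM Q h X (j + 1) ω : ℝ) * Complex.I) ∂P -
      (1 - a ^ 2 / 2 * s : ℝ) * ∫ ω, Complex.exp ((a * mM Q h X j ω : ℝ) * Complex.I) ∂P‖
    ≤ a ^ 2 / 2 * ‖∫ ω, Complex.exp ((a * mM Q h X j ω : ℝ) * Complex.I) *
        ((mV Q h (X j ω) - s : ℝ) : ℂ) ∂P‖ + (|a| * B) ^ 3 := by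
  have hF := past_exp (X := X) (Q := Q) hh a j
  have m1 := hF.measurable hX.1
  have e := hX.markov hF (ψ := fun p => Complex.exp ((a * mD Q h p : ℝ) * Complex.I))
    (by have := mD_meas (Q := Q) hh; fun_prop) ⟨1, fun p => by rw [Complex.norm_exp_ofReal_mul_I]⟩
  have e1 : ∀ ω, Complex.exp ((a * mM Q h X (j + 1) ω : ℝ) * Complex.I) =
      Complex.exp ((a * mM Q h X j ω : ℝ) * Complex.I) *
        Complex.exp ((a * mD Q h (X j ω, X (j + 1) ω) : ℝ) * Complex.I) := by
    intro ω
    rw [← Complex.exp_add]; congr 1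
    simp only [mM, Finset.sum_range_succ]
    push_cast; ring
  simp only [e1]
  rw [e]
  set F := fun ω => Complex.exp ((a * mM Q h X j ω : ℝ) * Complex.I) with hFdef
  set G : S → ℂ := fun x => ∫ z, Complex.exp ((a * mD Q h (x, z) : ℝ) * Complex.I) ∂(Q x) with hG
  have nF : ∀ ω, ‖F ω‖ = 1 := fun ω => by rw [hFdef]; simp only [Complex.norm_exp_ofReal_mul_I]
  have mG : Measurable G := by
    have : Measurable fun p : S × S => Complex.exp ((a * mD Q h p : ℝ) * Complex.I) := by
      have := mD_meas (Q := Q) hh; fun_prop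
    exact (StronglyMeasurable.integral_kernel_prod_right' (κ := Q) this.stronglyMeasurable).measurable
  have nG : ∀ x, ‖G x‖ ≤ 1 := fun x => by
    have := norm_integral_le_of_norm_le_const (μ := Q x) (C := 1)
      (f := fun z => Complex.exp ((a * mD Q h (x, z) : ℝ) * Complex.I))
      (ae_of_all _ fun z => by rw [Complex.norm_exp_ofReal_mul_I])
    rw [probReal_univ, mul_one] at this
    exact this
  have hV := mV_BM (Q := Q) hh
  obtain ⟨CV, hCV⟩ := hV.bdd
  obtain ⟨Cv, hCv⟩ := (hV.sub (BM.const s)).bdd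
  have iG : Integrable (fun ω => F ω * G (X j ω)) P :=
    Integrable.of_bound (m1.mul (mG.comp (hX.1 _))).aestronglyMeasurable 1
      (ae_of_all _ fun ω => by rw [norm_mul, nF, one_mul]; exact nG _)
  have iF : Integrable F P :=
    Integrable.of_bound m1.aestronglyMeasurable 1 (ae_of_all _ fun ω => (nF ω).le)
  have iV : Integrable (fun ω => F ω * ((mV Q h (X j ω) - s : ℝ) : ℂ)) P := by
    refine Integrable.of_bound (m1.mul (Complex.measurable_ofReal.comp
      ((hV.sub (BM.const s)).meas.comp (hX.1 j)))).aestronglyMeasurable Cv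
      (ae_of_all _ fun ω => ?_)
    rw [norm_mul, nF, one_mul, Complex.norm_real]; exact hCv _
  have key : ∫ ω, F ω * G (X j ω) ∂P - (1 - a ^ 2 / 2 * s : ℝ) * ∫ ω, F ω ∂P =
      ∫ ω, F ω * (G (X j ω) - (1 - (a ^ 2 / 2 * mV Q h (X j ω) : ℝ))) ∂P -
        (a ^ 2 / 2 : ℝ) * ∫ ω, F ω * ((mV Q h (X j ω) - s : ℝ) : ℂ) ∂P := by
    rw [← integral_const_mul, ← integral_const_mul, ← integral_sub iG (iF.const_mul _),
      ← integral_sub _ (iV.const_mul _)]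
    · congr 1; funext ω; push_cast; ring
    · have : (fun ω => F ω * (G (X j ω) - (1 - (a ^ 2 / 2 * mV Q h (X j ω) : ℝ)))) = fun ω =>
        (F ω * G (X j ω) - (1 - a ^ 2 / 2 * s : ℝ) * F ω) +
          (a ^ 2 / 2 : ℝ) * (F ω * ((mV Q h (X j ω) - s : ℝ) : ℂ)) := by
        funext ω; push_cast; ring
      rw [this]
      exact (iG.sub (iF.const_mul _)).add (iV.const_mul _)
  rw [key]
  refine (norm_sub_le _ _).trans ?_
  rw [add_comm, norm_mul]
  refine add_le_add (le_of_eq ?_) ?_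
  · rw [Complex.norm_real, Real.norm_of_nonneg (by positivity)]
  · refine (norm_integral_le_of_norm_le_const (C := (|a| * B) ^ 3) (ae_of_all _ fun ω => ?_)).trans
      (by simp)
    rw [norm_mul, nF, one_mul]
    exact one_step hh hB ha _
end mart
end ECT

set_option linter.unusedSectionVars false
namespace ECT
open MeasureTheory ProbabilityTheory Filter Topology Set

section martclt
variable {S : Type} [MeasurableSpace S] {Q : Kernel S S} [IsMarkovKernel Q]
variable {Ω : Type} [MeasurableSpace Ω] {P : Measure Ω} [IsProbabilityMeasure P] {X : ℕ → Ω → S}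
variable {ν : Measure S} [IsProbabilityMeasure ν]

/-- L1 ergodicity -/
def Erg (Q : Kernel S S) (ν : Measure S) : Prop :=
  ∀ v : S → ℝ, BM v → Tendsto (fun l => ∫ x, |(op Q)^[l] v x - ∫ z, v z ∂ν| ∂ν) atTop (𝓝 0)

lemma recur_bound {φ : ℕ → ℂ} {r : ℝ} (hr0 : 0 ≤ r) (hr1 : r ≤ 1) (h0 : φ 0 = 1) {e : ℕ → ℝ}
    (he : ∀ j, ‖φ (j + 1) - (r : ℂ) * φ j‖ ≤ e j) (n : ℕ) :
    ‖φ n - (r : ℂ) ^ n‖ ≤ ∑ j ∈ Finset.range n, e j := by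
  induction n with
  | zero => simp [h0]
  | succ n ih =>
    rw [Finset.sum_range_succ]
    have : φ (n + 1) - (r : ℂ) ^ (n + 1) = (r : ℂ) * (φ n - (r : ℂ) ^ n) + (φ (n + 1) - (r : ℂ) * φ n) := by
      ring
    rw [this]
    refine (norm_add_le _ _).trans (add_le_add ?_ (he n))
    rw [norm_mul, Complex.norm_real, Real.norm_of_nonneg hr0]
    exact (mul_le_of_le_one_left (norm_nonneg _) hr1).trans ih

lemma mart_bound (hX : Chain Q P X) (hr : Rev Q ν) (h0 : P.map (X 0) = ν)
    {h : S → ℝ} (hh : BM h) {B : ℝ} (hB : ∀ p, |mD Q h p| ≤ B) {C : ℝ} {s : ℝ}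
    (hC : ∀ x, |mV Q h x - s| ≤ C) {a : ℝ} (ha : |a| * B ≤ 1)
    (hr0 : 0 ≤ 1 - a ^ 2 / 2 * s) (hs : 0 ≤ s) (n l : ℕ) :
    ‖∫ ω, Complex.exp ((a * mM Q h X n ω : ℝ) * Complex.I) ∂P - ((1 - a ^ 2 / 2 * s : ℝ) : ℂ) ^ n‖
      ≤ n * (a ^ 2 / 2 * (∫ x, |(op Q)^[l] (fun y => mV Q h y - s) x| ∂ν + |a| * (l * B) * C)
          + (|a| * B) ^ 3) + l * (a ^ 2 / 2 * C) := by
  have hv : BM (fun y => mV Q h y - s) := (mV_BM hh).sub (BM.const s)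
  set D := ∫ x, |(op Q)^[l] (fun y => mV Q h y - s) x| ∂ν with hD
  obtain ⟨x0⟩ : Nonempty S := by
    by_contra hne
    rw [not_nonempty_iff] at hne
    have : ν univ = 0 := by rw [univ_eq_empty_iff.2 hne]; simp
    simp at this
  have hC0 : 0 ≤ C := (abs_nonneg _).trans (hC x0)
  have hB0 : 0 ≤ B := (abs_nonneg _).trans (hB (x0, x0))
  have hD0 : 0 ≤ D := integral_nonneg fun x => abs_nonneg _
  have key := recur_bound (φ := fun n => ∫ ω, Complex.exp ((a * mM Q h X n ω : ℝ) * Complex.I) ∂P)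
    (r := 1 - a ^ 2 / 2 * s) hr0 (by have : 0 ≤ a ^ 2 / 2 * s := by positivity
                                     linarith) (by simp [mM])
    (e := fun j => (a ^ 2 / 2 * (D + |a| * (l * B) * C) + (|a| * B) ^ 3) +
      if j < l then a ^ 2 / 2 * C else 0) (fun j => by
      refine (step_bound hX hh hB ha s j).trans ?_
      by_cases hj : j < l
      · simp only [hj, if_true]
        have : ‖∫ ω, Complex.exp ((a * mM Q h X j ω : ℝ) * Complex.I) *
          ((mV Q h (X j ω) - s : ℝ) : ℂ) ∂P‖ ≤ C := by
          refine (norm_integral_le_of_norm_le_const (C := C) (ae_of_all _ fun ω => ?_)).trans (by simp)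
          rw [norm_mul, Complex.norm_exp_ofReal_mul_I, one_mul, Complex.norm_real]
          exact hC _
        have h1 := mul_le_mul_of_nonneg_left this (show 0 ≤ a ^ 2 / 2 by positivity)
        have h2 : 0 ≤ a ^ 2 / 2 * (D + |a| * (l * B) * C) := by positivity
        linarith
      · simp only [hj, if_false, add_zero]
        obtain ⟨p, rfl⟩ : ∃ p, j = p + l := ⟨j - l, by omega⟩
        have := mixing_bound hX hr h0 hh hB a hv hC p l
        have h1 := mul_le_mul_of_nonneg_left this (show 0 ≤ a ^ 2 / 2 by positivity)
        linarith) n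
  refine key.trans ?_
  rw [Finset.sum_add_distrib]
  refine add_le_add (by simp [mul_add]) ?_
  rw [← Finset.sum_filter]
  rw [Finset.sum_const, nsmul_eq_mul]
  refine mul_le_mul_of_nonneg_right ?_ (by positivity)
  have : ((Finset.range n).filter (fun j => j < l)) ⊆ Finset.range l := by
    intro j; simp
  have := Finset.card_le_card this
  rw [Finset.card_range] at this
  exact_mod_cast this

lemma mart_clt (hX : Chain Q P X) (hr : Rev Q ν) (herg : Erg Q ν) (h0 : P.map (X 0) = ν)
    {h : S → ℝ} (hh : BM h) (t : ℝ) :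
    Tendsto (fun n : ℕ => ∫ ω, Complex.exp ((t / √n * mM Q h X n ω : ℝ) * Complex.I) ∂P) atTop
      (𝓝 ((Real.exp (-(t ^ 2 * (∫ x, mV Q h x ∂ν) / 2)) : ℝ) : ℂ)) := by
  set s := ∫ x, mV Q h x ∂ν with hsdef
  have hs : 0 ≤ s := integral_nonneg fun x => mV_nonneg hh x
  have hV := mV_BM (Q := Q) hh
  obtain ⟨C, hC0, hC⟩ := (hV.sub (BM.const s)).pos_bdd
  obtain ⟨A, hA0, hA⟩ := hh.pos_bdd
  have hB : ∀ p, |mD Q h p| ≤ 2 * A := fun p => by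
    refine (abs_sub _ _).trans ?_
    have := hA p.2
    have := op_bound (Q := Q) hA p.1
    linarith
  set B := 2 * A with hBdef
  have hB0 : 0 < B := by positivity
  have hsq : Tendsto (fun n : ℕ => √(n:ℝ)) atTop atTop :=
    Real.tendsto_sqrt_atTop.comp tendsto_natCast_atTop_atTop
  have hinv : Tendsto (fun n : ℕ => |t| / √(n:ℝ)) atTop (𝓝 0) := hsq.const_div_atTop _
  -- the power converges
  have hpow : Tendsto (fun n : ℕ => (((1 - (t / √n) ^ 2 / 2 * s : ℝ) : ℂ)) ^ n) atTop
      (𝓝 ((Real.exp (-(t ^ 2 * s / 2)) : ℝ) : ℂ)) := by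
    have h1 := Real.tendsto_one_add_div_pow_exp (-(t ^ 2 * s / 2))
    have h2 := (Complex.continuous_ofReal.tendsto _).comp h1
    refine h2.congr fun n => ?_
    simp only [Function.comp]
    rw [← Complex.ofReal_pow]
    congr 2
    rw [div_pow, Real.sq_sqrt (Nat.cast_nonneg n)]
    ring
  have hdiff : Tendsto (fun n : ℕ =>
      ∫ ω, Complex.exp ((t / √n * mM Q h X n ω : ℝ) * Complex.I) ∂P -
        (((1 - (t / √n) ^ 2 / 2 * s : ℝ) : ℂ)) ^ n) atTop (𝓝 0) := by
    rw [Metric.tendsto_atTop']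
    intro ε hε
    have hl : ∀ᶠ l : ℕ in atTop, t ^ 2 / 2 * ∫ x, |(op Q)^[l] (mV Q h) x - s| ∂ν < ε / 2 := by
      have := (herg _ hV).const_mul (t ^ 2 / 2)
      rw [mul_zero] at this
      exact this.eventually (gt_mem_nhds (by positivity))
    obtain ⟨l, hl⟩ := hl.exists
    have ho : ∀ x, (op Q)^[l] (mV Q h) x - s = (op Q)^[l] (fun y => mV Q h y - s) x := fun x =>
      (congrFun (op_iter_sub_const hV s l) x).symm
    simp only [ho] at hl
    set D := ∫ x, |(op Q)^[l] (fun y => mV Q h y - s) x| ∂ν with hD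
    have e1 : ∀ᶠ n : ℕ in atTop, |t| / √(n:ℝ) * B < 1 := by
      have := hinv.mul_const B
      rw [zero_mul] at this
      exact this.eventually (gt_mem_nhds one_pos)
    have e2 : ∀ᶠ n : ℕ in atTop, (|t| / √(n:ℝ)) ^ 2 / 2 * s < 1 := by
      have := ((hinv.pow 2).div_const 2).mul_const s
      norm_num at this
      exact this.eventually (gt_mem_nhds one_pos)
    have e3 : ∀ᶠ n : ℕ in atTop, t ^ 2 / 2 * (|t| / √(n:ℝ) * (l * B) * C) +
        t ^ 2 * B ^ 3 * (|t| / √(n:ℝ)) + l * ((|t| / √(n:ℝ)) ^ 2 / 2 * C) < ε / 2 := by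
      have h1 := ((((hinv.mul_const (l * B)).mul_const C).const_mul (t ^ 2 / 2)).add
        (hinv.const_mul (t ^ 2 * B ^ 3))).add (((((hinv.pow 2).div_const 2)).mul_const C).const_mul (l:ℝ))
      norm_num at h1
      exact h1.eventually (gt_mem_nhds (by positivity))
    obtain ⟨N, hN⟩ := eventually_atTop.1 (e1.and (e2.and (e3.and (eventually_gt_atTop 0))))
    refine ⟨N, fun n hn => ?_⟩
    obtain ⟨f1, f2, f3, f4⟩ := hN n hn.le
    rw [dist_zero_right]
    have habs : |t / √(n:ℝ)| = |t| / √(n:ℝ) := by rw [abs_div, abs_of_nonneg (Real.sqrt_nonneg _)]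
    have hsqe : (t / √(n:ℝ)) ^ 2 = (|t| / √(n:ℝ)) ^ 2 := by rw [← habs, sq_abs]
    have := mart_bound hX hr h0 hh hB hC (a := t / √n) (by rw [habs]; exact f1.le)
      (by rw [hsqe]; linarith) hs n l
    refine this.trans_lt ?_
    rw [hsqe, habs, ← hD]
    have hn0 : (0:ℝ) < n := by exact_mod_cast f4
    have hna : (n:ℝ) * (|t| / √(n:ℝ)) ^ 2 = t ^ 2 := by
      rw [div_pow, Real.sq_sqrt hn0.le, sq_abs]; field_simp
    set q := |t| / √(n:ℝ) with hq
    have : (n:ℝ) * (q ^ 2 / 2 * (D + q * (l * B) * C) + (q * B) ^ 3) + l * (q ^ 2 / 2 * C) =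
      t ^ 2 / 2 * D + (t ^ 2 / 2 * (q * (l * B) * C) + t ^ 2 * B ^ 3 * q + l * (q ^ 2 / 2 * C)) := by
      rw [← hna]; ring
    rw [this]
    linarith
  have := hdiff.add hpow
  simpa using this
end martclt
end ECT

set_option linter.unusedSectionVars false
namespace ECT
open MeasureTheory ProbabilityTheory Filter Topology Set

section statclt
variable {S : Type} [MeasurableSpace S] {Q : Kernel S S} [IsMarkovKernel Q]
variable {Ω : Type} [MeasurableSpace Ω] {P : Measure Ω} [IsProbabilityMeasure P] {X : ℕ → Ω → S}
variable {ν : Measure S} [IsProbabilityMeasure ν]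

noncomputable def hk (Q : Kernel S S) (f : S → ℝ) (k : ℕ) (x : S) : ℝ :=
  ∑ j ∈ Finset.range k, (op Q)^[j] f x

lemma hk_BM {f : S → ℝ} (hf : BM f) (k : ℕ) : BM (hk Q f k) := BM.sum fun j _ => hf.iter j

lemma op_hk {f : S → ℝ} (hf : BM f) (k : ℕ) (x : S) :
    op Q (hk Q f k) x = ∑ j ∈ Finset.range k, (op Q)^[j + 1] f x := by
  have := congrFun (op_sum (Q := Q) (φ := fun j => (op Q)^[j] f) (fun j => hf.iter j) k) x
  simp only [Function.iterate_succ_apply']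
  exact this

lemma hk_poisson {f : S → ℝ} (hf : BM f) (k : ℕ) (x : S) :
    hk Q f k x - op Q (hk Q f k) x = f x - (op Q)^[k] f x := by
  rw [op_hk hf, hk]
  have h1 := Finset.sum_range_succ (fun j => (op Q)^[j] f x) k
  have h2 := Finset.sum_range_succ' (fun j => (op Q)^[j] f x) k
  rw [h1] at h2
  simp only [Function.iterate_zero, id] at h2
  linarith

lemma sk_eq (hr : Rev Q ν) {f : S → ℝ} (hf : BM f) (k : ℕ) :
    ∫ x, mV Q (hk Q f k) x ∂ν =
      (∑ j ∈ Finset.range k, ((∫ x, f x * (op Q)^[j] f x ∂ν) + ∫ x, f x * (op Q)^[j + 1] f x ∂ν))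
      - ∑ j ∈ Finset.range k, ((∫ x, f x * (op Q)^[k + j] f x ∂ν)
          + ∫ x, f x * (op Q)^[k + (j + 1)] f x ∂ν) := by
  have hh := hk_BM (Q := Q) hf k
  have e1 : ∫ x, mV Q (hk Q f k) x ∂ν = ∫ x, (f x - (op Q)^[k] f x) *
      (∑ j ∈ Finset.range k, ((op Q)^[j] f x + (op Q)^[j + 1] f x)) ∂ν := by
    unfold mV
    rw [integral_sub ((hh.mul hh).op.integrable _) ((hh.op.mul hh.op).integrable _),
      hr.inv (hh.mul hh), ← integral_sub ((hh.mul hh).integrable _) ((hh.op.mul hh.op).integrable _)]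
    congr 1; funext x
    rw [← hk_poisson hf, Finset.sum_add_distrib, ← op_hk hf]
    change _ = _ * (hk Q f k x + _)
    ring
  rw [e1]
  have e2 : ∀ x, (f x - (op Q)^[k] f x) * (∑ j ∈ Finset.range k, ((op Q)^[j] f x + (op Q)^[j + 1] f x)) =
      ∑ j ∈ Finset.range k, (f x * (op Q)^[j] f x + f x * (op Q)^[j + 1] f x) -
      ∑ j ∈ Finset.range k, ((op Q)^[k] f x * (op Q)^[j] f x + (op Q)^[k] f x * (op Q)^[j + 1] f x) := by
    intro x
    rw [sub_mul, Finset.mul_sum, Finset.mul_sum]; simp only [mul_add]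
  simp only [e2]
  rw [integral_sub, integral_finsetSum, integral_finsetSum]
  · congr 1
    · refine Finset.sum_congr rfl fun j _ => ?_
      rw [integral_add ((hf.mul (hf.iter _)).integrable _) ((hf.mul (hf.iter _)).integrable _)]
    · refine Finset.sum_congr rfl fun j _ => ?_
      rw [integral_add (((hf.iter _).mul (hf.iter _)).integrable _)
        (((hf.iter _).mul (hf.iter _)).integrable _), hr.iter_iter hf, hr.iter_iter hf]
  · exact fun j _ => (((hf.iter _).mul (hf.iter _)).add ((hf.iter _).mul (hf.iter _))).integrable _
  · exact fun j _ => ((hf.mul (hf.iter _)).add (hf.mul (hf.iter _))).integrable _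
  · exact (BM.sum fun j _ => (hf.mul (hf.iter _)).add (hf.mul (hf.iter _))).integrable _
  · exact (BM.sum fun j _ => (((hf.iter _).mul (hf.iter _)).add ((hf.iter _).mul (hf.iter _)))).integrable _

lemma sk_tendsto (hr : Rev Q ν) {f : S → ℝ} (hf : BM f)
    (hs : Summable fun n : ℕ => ∫ x, f x * (op Q)^[n + 1] f x ∂ν) :
    Tendsto (fun k => ∫ x, mV Q (hk Q f k) x ∂ν) atTop
      (𝓝 ((∫ x, f x * f x ∂ν) + 2 * ∑' n : ℕ, ∫ x, f x * (op Q)^[n + 1] f x ∂ν)) := by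
  set c : ℕ → ℝ := fun n => ∫ x, f x * (op Q)^[n] f x ∂ν with hc
  have hsc : Summable c := (summable_nat_add_iff 1).1 hs
  have h0 : ∑' n, c n = (∫ x, f x * f x ∂ν) + ∑' n, c (n + 1) := by
    rw [hsc.tsum_eq_zero_add]; rfl
  have t1 := hsc.hasSum.tendsto_sum_nat
  have t2 := hs.hasSum.tendsto_sum_nat
  have t1' : Tendsto (fun k => ∑ j ∈ Finset.range (k + k), c j) atTop (𝓝 (∑' n, c n)) :=
    t1.comp (tendsto_atTop_mono (fun k => by simp) tendsto_id)
  have t2' : Tendsto (fun k => ∑ j ∈ Finset.range (k + k), c (j + 1)) atTop (𝓝 (∑' n, c (n + 1))) :=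
    t2.comp (tendsto_atTop_mono (fun k => by simp) tendsto_id)
  have := (t1.add t2).sub ((t1'.sub t1).add (t2'.sub t2))
  have e : ∑' n, c n + ∑' n, c (n + 1) - (∑' n, c n - ∑' n, c n + (∑' n, c (n+1) - ∑' n, c (n+1))) =
    (∫ x, f x * f x ∂ν) + 2 * ∑' n, c (n + 1) := by rw [h0]; ring
  rw [← e]
  refine this.congr fun k => ?_
  rw [sk_eq hr hf, Finset.sum_range_add, Finset.sum_range_add, Finset.sum_add_distrib,
    Finset.sum_add_distrib]
  simp only [add_sub_cancel_left, hc, add_assoc]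

lemma rem_bound (hX : Chain Q P X) (hr : Rev Q ν) (h0 : P.map (X 0) = ν)
    {g : S → ℝ} (hg : BM g) {τ : ℝ}
    (hτ : ∀ n, ∑ l ∈ Finset.range n, |∫ x, g x * (op Q)^[l] g x ∂ν| ≤ τ) (n : ℕ) :
    ∫ ω, (∑ j ∈ Finset.range n, g (X j ω)) ^ 2 ∂P ≤ n * (2 * τ) := by
  have hgX : ∀ j, BM (fun ω => g (X j ω)) := fun j => hg.comp (hX.1 j)
  induction n with
  | zero => simp
  | succ n ih =>
    have e : ∀ ω, (∑ j ∈ Finset.range (n + 1), g (X j ω)) ^ 2 = (∑ j ∈ Finset.range n, g (X j ω)) ^ 2 +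
      (∑ j ∈ Finset.range n, 2 * (g (X j ω) * g (X n ω)) + g (X n ω) * g (X n ω)) := fun ω => by
      rw [Finset.sum_range_succ, ← Finset.mul_sum, ← Finset.sum_mul]; ring
    simp only [e]
    have b1 : BM (fun ω => (∑ j ∈ Finset.range n, g (X j ω)) ^ 2) := by
      simp only [sq]
      exact (BM.sum fun j _ => hgX j).mul (BM.sum fun j _ => hgX j)
    have b2 : ∀ j, BM (fun ω => 2 * (g (X j ω) * g (X n ω))) := fun j =>
      (BM.const 2).mul ((hgX j).mul (hgX n))
    rw [integral_add (b1.integrable _) (((BM.sum fun j _ => b2 j).add ((hgX n).mul (hgX n))).integrable _),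
      integral_add ((BM.sum fun j _ => b2 j).integrable _) (((hgX n).mul (hgX n)).integrable _),
      integral_finsetSum _ fun j _ => (b2 j).integrable _]
    have t0 := hX.two hr h0 hg hg n 0
    have tj : ∀ j ∈ Finset.range n, ∫ ω, 2 * (g (X j ω) * g (X n ω)) ∂P ≤
        2 * |∫ x, g x * (op Q)^[(n - 1 - j) + 1] g x ∂ν| := fun j hj => by
      rw [Finset.mem_range] at hj
      have := hX.two hr h0 hg hg j ((n - 1 - j) + 1)
      rw [show j + ((n - 1 - j) + 1) = n by omega] at this
      rw [integral_const_mul, this]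
      exact mul_le_mul_of_nonneg_left (le_abs_self _) (by norm_num)
    have s1 := Finset.sum_le_sum tj
    rw [← Finset.mul_sum, Finset.sum_range_reflect
      (fun j => |∫ x, g x * (op Q)^[j + 1] g x ∂ν|) n] at s1
    have s2 := hτ (n + 1)
    rw [Finset.sum_range_succ'] at s2
    have s3 := le_abs_self (∫ x, g x * (op Q)^[0] g x ∂ν)
    have s4 := abs_nonneg (∫ x, g x * (op Q)^[0] g x ∂ν)
    simp only [add_zero] at t0
    rw [t0]
    push_cast
    linarith

lemma sum_decomp {f : S → ℝ} (hf : BM f) (k n : ℕ) (ω : Ω) :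
    ∑ j ∈ Finset.range n, f (X j ω) = mM Q (hk Q f k) X n ω + (hk Q f k (X 0 ω) - hk Q f k (X n ω))
      + ∑ j ∈ Finset.range n, (op Q)^[k] f (X j ω) := by
  induction n with
  | zero => simp [mM]
  | succ n ih =>
    rw [Finset.sum_range_succ, ih, Finset.sum_range_succ, mM, mM, Finset.sum_range_succ]
    have := hk_poisson (Q := Q) hf k (X n ω)
    simp only [mD]
    linarith

lemma stat_clt (hX : Chain Q P X) (hr : Rev Q ν) (herg : Erg Q ν) (h0 : P.map (X 0) = ν)
    {f : S → ℝ} (hf : BM f)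
    (hs : Summable fun n : ℕ => ∫ x, f x * (op Q)^[n + 1] f x ∂ν) {σ : ℝ}
    (hσ : σ = (∫ x, f x * f x ∂ν) + 2 * ∑' n : ℕ, ∫ x, f x * (op Q)^[n + 1] f x ∂ν) (t : ℝ) :
    Tendsto (fun n : ℕ => ∫ ω, Complex.exp ((t / √n * ∑ j ∈ Finset.range n, f (X j ω) : ℝ) * Complex.I) ∂P)
      atTop (𝓝 ((Real.exp (-(t ^ 2 * σ / 2)) : ℝ) : ℂ)) := by
  have hsk := sk_tendsto hr hf hs
  rw [← hσ] at hsk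
  have hsc : Summable fun n : ℕ => ∫ x, f x * (op Q)^[n] f x ∂ν := (summable_nat_add_iff 1).1 hs
  have hE : Tendsto (fun k => ((Real.exp (-(t ^ 2 * (∫ x, mV Q (hk Q f k) x ∂ν) / 2)) : ℝ) : ℂ)) atTop
      (𝓝 ((Real.exp (-(t ^ 2 * σ / 2)) : ℝ) : ℂ)) := by
    have hcont : Continuous fun s : ℝ => ((Real.exp (-(t ^ 2 * s / 2)) : ℝ) : ℂ) := by fun_prop
    exact (hcont.tendsto σ).comp hsk
  have hsq : Tendsto (fun n : ℕ => √(n:ℝ)) atTop atTop :=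
    Real.tendsto_sqrt_atTop.comp tendsto_natCast_atTop_atTop
  have hinv : Tendsto (fun n : ℕ => |t| / √(n:ℝ)) atTop (𝓝 0) := hsq.const_div_atTop _
  rw [Metric.tendsto_atTop]
  intro ε' hε'
  obtain ⟨ε, hε, hεt⟩ : ∃ ε : ℝ, 0 < ε ∧ |t| * (3 / 2 * ε) + 3 * ε < ε' := by
    refine ⟨ε' / (2 * (|t| * (3 / 2) + 3)), by positivity, ?_⟩
    have : |t| * (3 / 2 * (ε' / (2 * (|t| * (3 / 2) + 3)))) + 3 * (ε' / (2 * (|t| * (3 / 2) + 3))) = ε' / 2 := by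
      field_simp
    rw [this]; linarith
  -- choose k
  have hk1 := (Metric.tendsto_atTop.1 hE) ε hε
  have htail : Tendsto (fun k : ℕ => ∑' l, |∫ x, f x * (op Q)^[l + (k + k)] f x ∂ν|) atTop (𝓝 0) := by
    have := tendsto_sum_nat_add (fun n => |∫ x, f x * (op Q)^[n] f x ∂ν|)
    exact this.comp (tendsto_atTop_mono (fun k => by simp) tendsto_id : Tendsto (fun k => k + k) atTop atTop)
  obtain ⟨k, hkE, hkt⟩ : ∃ k, dist ((Real.exp (-(t ^ 2 * (∫ x, mV Q (hk Q f k) x ∂ν) / 2)) : ℝ) : ℂ)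
      ((Real.exp (-(t ^ 2 * σ / 2)) : ℝ) : ℂ) < ε ∧
      ∑' l, |∫ x, f x * (op Q)^[l + (k + k)] f x ∂ν| < ε ^ 2 := by
    obtain ⟨N, hN⟩ := hk1
    obtain ⟨M, hM⟩ := eventually_atTop.1 (htail.eventually (gt_mem_nhds (show 0 < ε ^ 2 by positivity)))
    exact ⟨max N M, hN _ (le_max_left _ _), hM _ (le_max_right _ _)⟩
  set h := hk Q f k with hh
  have hhB : BM h := hk_BM hf k
  obtain ⟨A, hA0, hA⟩ := hhB.pos_bdd
  have hm := mart_clt hX hr herg h0 hhB t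
  set g := (op Q)^[k] f with hg
  have hgB : BM g := hf.iter k
  have hτ : ∀ n, ∑ l ∈ Finset.range n, |∫ x, g x * (op Q)^[l] g x ∂ν| ≤ ε ^ 2 := fun n => by
    have e : ∀ l, ∫ x, g x * (op Q)^[l] g x ∂ν = ∫ x, f x * (op Q)^[l + (k + k)] f x ∂ν := fun l => by
      rw [hg]
      have := hr.iter_iter (φ := f) hf k (l + k)
      rw [← Function.iterate_add_apply, this, show k + (l + k) = l + (k + k) by omega]
    simp only [e]
    exact ((((summable_nat_add_iff (k + k)).2 hsc).abs).sum_le_tsum _ (fun _ _ => abs_nonneg _)).trans hkt.le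
  obtain ⟨N1, hN1⟩ := (Metric.tendsto_atTop.1 hm) ε hε
  obtain ⟨N2, hN2⟩ := eventually_atTop.1 (show ∀ᶠ n : ℕ in atTop, |t| / √(n:ℝ) * (2 * A) < ε by
    have := hinv.mul_const (2 * A)
    rw [zero_mul] at this
    exact this.eventually (gt_mem_nhds hε))
  refine ⟨max (max N1 N2) 1, fun n hn => ?_⟩
  have hn1 : N1 ≤ n := (le_max_left _ _).trans ((le_max_left _ _).trans hn)
  have hn2 : N2 ≤ n := (le_max_right _ _).trans ((le_max_left _ _).trans hn)
  have hn3 : 1 ≤ n := (le_max_right _ _).trans hn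
  have hnpos : (0:ℝ) < n := by exact_mod_cast hn3
  have hsn : 0 < √(n:ℝ) := Real.sqrt_pos.2 hnpos
  have hfX : ∀ j, BM (fun ω => f (X j ω)) := fun j => hf.comp (hX.1 j)
  have hgX : ∀ j, BM (fun ω => g (X j ω)) := fun j => hgB.comp (hX.1 j)
  have mS : Measurable fun ω => ∑ j ∈ Finset.range n, f (X j ω) := (BM.sum fun j _ => hfX j).meas
  have bR : BM (fun ω => ∑ j ∈ Finset.range n, g (X j ω)) := BM.sum fun j _ => hgX j
  have m2 := (past_exp (X := X) (Q := Q) hhB (t / √n) n).measurable hX.1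
  have i1 : Integrable (fun ω => Complex.exp ((t / √n * ∑ j ∈ Finset.range n, f (X j ω) : ℝ) * Complex.I)) P :=
    Integrable.of_bound (Measurable.aestronglyMeasurable (by fun_prop)) 1
      (ae_of_all _ fun ω => by rw [Complex.norm_exp_ofReal_mul_I])
  have i2 : Integrable (fun ω => Complex.exp ((t / √n * mM Q h X n ω : ℝ) * Complex.I)) P :=
    Integrable.of_bound m2.aestronglyMeasurable 1
      (ae_of_all _ fun ω => by rw [Complex.norm_exp_ofReal_mul_I])
  have bR2 : BM (fun ω => (∑ j ∈ Finset.range n, g (X j ω)) ^ 2) := by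
    simp only [sq]; exact bR.mul bR
  have hd : ‖∫ ω, Complex.exp ((t / √n * ∑ j ∈ Finset.range n, f (X j ω) : ℝ) * Complex.I) ∂P -
      ∫ ω, Complex.exp ((t / √n * mM Q h X n ω : ℝ) * Complex.I) ∂P‖ ≤
      |t| / √n * (2 * A) + |t| * (3 / 2 * ε) := by
    rw [← integral_sub i1 i2]
    have hpt : ∀ ω, ‖Complex.exp ((t / √n * ∑ j ∈ Finset.range n, f (X j ω) : ℝ) * Complex.I) -
      Complex.exp ((t / √n * mM Q h X n ω : ℝ) * Complex.I)‖ ≤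
      (|t| / √n * (2 * A) + |t| * (ε / 2)) + |t| / (2 * ε * n) * (∑ j ∈ Finset.range n, g (X j ω)) ^ 2 := by
      intro ω
      refine (norm_exp_sub_le _ _).trans ?_
      rw [sum_decomp (Q := Q) (X := X) hf k n ω, ← hh, ← hg, ← mul_sub, abs_mul, abs_div,
        abs_of_pos hsn]
      set R := ∑ j ∈ Finset.range n, g (X j ω) with hR
      have a1 : |mM Q h X n ω + (h (X 0 ω) - h (X n ω)) + R - mM Q h X n ω| ≤ 2 * A + |R| := by
        have : mM Q h X n ω + (h (X 0 ω) - h (X n ω)) + R - mM Q h X n ω =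
          (h (X 0 ω) - h (X n ω)) + R := by ring
        rw [this]
        refine (abs_add_le _ _).trans (add_le_add ((abs_sub _ _).trans ?_) le_rfl)
        linarith [hA (X 0 ω), hA (X n ω)]
      have a2 : |R| / √n ≤ ε / 2 + R ^ 2 / (2 * ε * n) := by
        have q : 0 ≤ (|R| / √n - ε) ^ 2 / (2 * ε) := by positivity
        have q2 : (|R| / √n - ε) ^ 2 / (2 * ε) = ε / 2 + R ^ 2 / (2 * ε * n) - |R| / √n := by
          have : (|R| / √n) ^ 2 = R ^ 2 / n := by rw [div_pow, sq_abs, Real.sq_sqrt hnpos.le]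
          rw [sub_sq, this]; field_simp; ring
        linarith
      calc _ ≤ |t| / √n * (2 * A + |R|) := mul_le_mul_of_nonneg_left a1 (by positivity)
        _ = |t| / √n * (2 * A) + |t| * (|R| / √n) := by ring
        _ ≤ |t| / √n * (2 * A) + |t| * (ε / 2 + R ^ 2 / (2 * ε * n)) := by gcongr
        _ = _ := by ring
    refine (norm_integral_le_of_norm_le
      (((BM.const (|t| / √n * (2 * A) + |t| * (ε / 2))).add ((BM.const _).mul bR2)).integrable _)
      (ae_of_all _ hpt)).trans ?_
    rw [integral_add (integrable_const _) (((BM.const _).mul bR2).integrable _), integral_const_mul]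
    have hrem := rem_bound hX hr h0 hgB hτ n
    have : |t| / (2 * ε * n) * ∫ ω, (∑ j ∈ Finset.range n, g (X j ω)) ^ 2 ∂P ≤ |t| * ε := by
      refine (mul_le_mul_of_nonneg_left hrem (by positivity)).trans (le_of_eq ?_)
      field_simp
    simp only [integral_const, probReal_univ, smul_eq_mul, one_mul]
    linarith
  have d1 := hN1 n hn1
  have d2 := hN2 n hn2
  rw [← dist_eq_norm] at hd
  have q1 := (dist_triangle _ _ ((Real.exp (-(t ^ 2 * σ / 2)) : ℝ) : ℂ)).trans (add_le_add hd le_rfl)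
  have q2 := (dist_triangle _ _ _).trans_lt (add_lt_add d1 hkE)
  linarith

end statclt
end ECT

set_option linter.unusedSectionVars false
namespace ECT
open MeasureTheory ProbabilityTheory Filter Topology Set

section transfer
variable {S : Type} [MeasurableSpace S] {Q : Kernel S S} [IsMarkovKernel Q]
variable {Ω : Type} [MeasurableSpace Ω] {P : Measure Ω} [IsProbabilityMeasure P] {X : ℕ → Ω → S}
variable {ν : Measure S} [IsProbabilityMeasure ν]

lemma Chain.map_eq (h : Chain Q P X) (hr : Rev Q ν) (h0 : P.map (X 0) = ν) (n : ℕ) :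
    P.map (X n) = ν := by
  have : IsProbabilityMeasure (P.map (X n)) := Measure.isProbabilityMeasure_map (h.1 n).aemeasurable
  ext A hA
  have hb : BM (A.indicator (fun _ => (1:ℝ))) :=
    ⟨measurable_const.indicator hA, 1, fun x => by
      by_cases hx : x ∈ A <;> simp [hx]⟩
  have e := h.law hr h0 hb n
  rw [← integral_map (h.1 n).aemeasurable hb.meas.aestronglyMeasurable, integral_indicator_const _ hA,
    integral_indicator_const _ hA] at e
  simp only [smul_eq_mul, mul_one] at e
  exact (measureReal_eq_measureReal_iff).1 e

lemma tv_conv (hX : Chain Q P X) (hr : Rev Q ν) (herg : Erg Q ν)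
    (hsing : ∀ ε > 0, ∃ n, ∀ A, MeasurableSet A → ν A = 0 → P.real (X n ⁻¹' A) ≤ ε) :
    ∀ ε > 0, ∃ N, ∀ φ : S → ℝ, Measurable φ → (∀ x, |φ x| ≤ 1) →
      |∫ ω, φ (X N ω) ∂P - ∫ x, φ x ∂ν| ≤ ε := by
  intro ε hε
  obtain ⟨n, hn⟩ := hsing (ε / 6) (by positivity)
  set μ := P.map (X n) with hμ
  have : IsProbabilityMeasure μ := Measure.isProbabilityMeasure_map (hX.1 n).aemeasurable
  set ρ : S → ℝ := fun x => (μ.rnDeriv ν x).toReal with hρ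
  have ρm : Measurable ρ := (Measure.measurable_rnDeriv μ ν).ennreal_toReal
  have ρ0 : ∀ x, 0 ≤ ρ x := fun x => ENNReal.toReal_nonneg
  have ρi : Integrable ρ ν := Measure.integrable_toReal_rnDeriv
  have hdec : μ = μ.singularPart ν + ν.withDensity (μ.rnDeriv ν) :=
    Measure.haveLebesgueDecomposition_add μ ν
  set sg := μ.singularPart ν with hsg
  have hsgle : sg.real univ ≤ ε / 6 := by
    obtain ⟨A, hA, h1, h2⟩ := Measure.mutuallySingular_singularPart μ ν
    have := hn Aᶜ hA.compl h2
    have e1 : sg univ = sg Aᶜ := by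
      rw [← measure_add_measure_compl hA, h1, zero_add]
    have e2 : sg Aᶜ ≤ μ Aᶜ := Measure.singularPart_le μ ν _
    rw [measureReal_def, e1]
    refine le_trans ?_ this
    rw [measureReal_def]
    rw [hμ, Measure.map_apply (hX.1 n) hA.compl] at e2
    exact ENNReal.toReal_mono (measure_ne_top _ _) e2
  have hint : ∀ ψ : S → ℝ, BM ψ → ∫ x, ψ x ∂μ = ∫ x, ψ x ∂sg + ∫ x, ρ x * ψ x ∂ν := by
    intro ψ hψ
    have : IsFiniteMeasure (ν.withDensity (μ.rnDeriv ν)) := inferInstance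
    conv_lhs => rw [hdec]
    rw [integral_add_measure (hψ.integrable _) (hψ.integrable _),
      integral_withDensity_eq_integral_toReal_smul (Measure.measurable_rnDeriv μ ν)
        (Measure.rnDeriv_lt_top μ ν)]
    rfl
  -- truncation
  have htr : Tendsto (fun M : ℕ => ∫ x, (ρ x - min (ρ x) M) ∂ν) atTop (𝓝 0) := by
    have := tendsto_integral_of_dominated_convergence (μ := ν) (F := fun (M : ℕ) x => ρ x - min (ρ x) M)
      (f := fun _ => 0) ρ (fun M => (ρm.sub (ρm.min measurable_const)).aestronglyMeasurable) ρi
      (fun M => ae_of_all _ fun x => by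
        have : 0 ≤ min (ρ x) (M:ℝ) := le_min (ρ0 x) (Nat.cast_nonneg M)
        rw [Real.norm_of_nonneg (sub_nonneg.2 (min_le_left _ _))]; linarith)
      (ae_of_all _ fun x => by
        obtain ⟨M0, hM0⟩ := exists_nat_ge (ρ x)
        refine tendsto_const_nhds.congr' ?_
        filter_upwards [eventually_ge_atTop M0] with M hM
        rw [min_eq_left (hM0.trans (by exact_mod_cast hM)), sub_self])
    simpa using this
  obtain ⟨M, hM⟩ := (htr.eventually (gt_mem_nhds (show 0 < ε / 6 by positivity))).exists
  set r : S → ℝ := fun x => min (ρ x) M with hrdef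
  have rB : BM r := ⟨ρm.min measurable_const, M, fun x => by
    rw [abs_of_nonneg (le_min (ρ0 x) (Nat.cast_nonneg M))]; exact min_le_right _ _⟩
  obtain ⟨l, hl⟩ := ((herg r rB).eventually (gt_mem_nhds (show 0 < ε / 6 by positivity))).exists
  refine ⟨n + l, fun φ hφ hφ1 => ?_⟩
  have φB : BM φ := ⟨hφ, 1, hφ1⟩
  have ψ1 : ∀ x, |(op Q)^[l] φ x| ≤ 1 := fun x => op_iter_bound hφ1 l x
  have e1 : ∫ ω, φ (X (n + l) ω) ∂P = ∫ x, (op Q)^[l] φ x ∂μ := by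
    have := hX.iter (Past.one n) φB l
    simp only [one_mul, integral_complex_ofReal] at this
    rw [Complex.ofReal_inj.1 this, hμ,
      integral_map (hX.1 n).aemeasurable (φB.iter l).meas.aestronglyMeasurable]
  have ρψi : ∀ ψ : S → ℝ, BM ψ → Integrable (fun x => ρ x * ψ x) ν := fun ψ hψ => by
    obtain ⟨C, hC⟩ := hψ.bdd
    exact ρi.mul_bdd (c := C) hψ.meas.aestronglyMeasurable (ae_of_all _ hC)
  have hb : ∀ ψ : S → ℝ, BM ψ → (∀ x, |ψ x| ≤ 1) →
      |∫ x, ψ x ∂μ - ∫ x, r x * ψ x ∂ν| ≤ ε / 3 := by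
    intro ψ hψ h1
    rw [hint ψ hψ, add_sub_assoc, ← integral_sub (ρψi ψ hψ) ((rB.mul hψ).integrable _)]
    refine (abs_add_le _ _).trans ?_
    have a1 : |∫ x, ψ x ∂sg| ≤ ε / 6 := by
      have := norm_integral_le_of_norm_le_const (μ := sg) (f := ψ) (C := 1) (ae_of_all _ h1)
      rw [one_mul] at this
      exact this.trans hsgle
    have a2 : |∫ x, (ρ x * ψ x - r x * ψ x) ∂ν| ≤ ε / 6 := by
      have hi : Integrable (fun x => ρ x - min (ρ x) (M:ℝ)) ν := ρi.sub (rB.integrable ν)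
      rw [← Real.norm_eq_abs]
      refine le_trans (norm_integral_le_of_norm_le hi (ae_of_all _ fun x => ?_)) hM.le
      rw [← sub_mul, norm_mul, Real.norm_eq_abs, Real.norm_eq_abs,
        abs_of_nonneg (sub_nonneg.2 (min_le_left _ _))]
      exact mul_le_of_le_one_right (sub_nonneg.2 (min_le_left _ _)) (h1 x)
    linarith
  have b1 := hb _ (φB.iter l) ψ1
  have b2 := hb (fun _ => 1) (BM.const 1) (fun x => by simp)
  simp only [mul_one, integral_const, probReal_univ, smul_eq_mul] at b2
  have e2 : ∫ x, r x * (op Q)^[l] φ x ∂ν = ∫ x, ((op Q)^[l] r x - ∫ z, r z ∂ν) * φ x ∂ν +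
      (∫ z, r z ∂ν) * ∫ x, φ x ∂ν := by
    rw [hr.iter rB φB, ← integral_const_mul, ← integral_add]
    · congr 1; funext x; ring
    · exact ((((rB.iter l)).sub (BM.const _)).mul φB).integrable _
    · exact ((BM.const _).mul φB).integrable _
  have b3 : |∫ x, ((op Q)^[l] r x - ∫ z, r z ∂ν) * φ x ∂ν| ≤ ε / 6 := by
    have hi : Integrable (fun x => |(op Q)^[l] r x - ∫ z, r z ∂ν|) ν :=
      (((rB.iter l)).sub (BM.const _)).abs.integrable ν
    rw [← Real.norm_eq_abs]
    refine le_trans (norm_integral_le_of_norm_le hi (ae_of_all _ fun x => ?_)) hl.le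
    rw [norm_mul]
    exact mul_le_of_le_one_right (abs_nonneg _) (hφ1 x)
  have b4 : |∫ x, φ x ∂ν| ≤ 1 := by
    have := norm_integral_le_of_norm_le_const (μ := ν) (f := φ) (C := 1) (ae_of_all _ hφ1)
    simpa using this
  rw [e1]
  have : ∫ x, (op Q)^[l] φ x ∂μ - ∫ x, φ x ∂ν = (∫ x, (op Q)^[l] φ x ∂μ - ∫ x, r x * (op Q)^[l] φ x ∂ν)
    + ∫ x, ((op Q)^[l] r x - ∫ z, r z ∂ν) * φ x ∂ν - (1 - ∫ z, r z ∂ν) * ∫ x, φ x ∂ν := by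
    rw [e2]; ring
  rw [this]
  refine (abs_sub _ _).trans ?_
  have b5 : |(1 - ∫ z, r z ∂ν) * ∫ x, φ x ∂ν| ≤ ε / 3 := by
    rw [abs_mul]; exact (mul_le_of_le_one_right (abs_nonneg _) b4).trans b2
  have := abs_add_le (∫ x, (op Q)^[l] φ x ∂μ - ∫ x, r x * (op Q)^[l] φ x ∂ν)
    (∫ x, ((op Q)^[l] r x - ∫ z, r z ∂ν) * φ x ∂ν)
  linarith

lemma tv_conv_complex (hX : Chain Q P X) (hr : Rev Q ν) (herg : Erg Q ν)
    (hsing : ∀ ε > 0, ∃ n, ∀ A, MeasurableSet A → ν A = 0 → P.real (X n ⁻¹' A) ≤ ε) :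
    ∀ ε > 0, ∃ N, ∀ φ : S → ℂ, Measurable φ → (∀ x, ‖φ x‖ ≤ 1) →
      ‖∫ ω, φ (X N ω) ∂P - ∫ x, φ x ∂ν‖ ≤ ε := by
  intro ε hε
  obtain ⟨N, hN⟩ := tv_conv hX hr herg hsing (ε / 2) (by positivity)
  refine ⟨N, fun φ hφ h1 => ?_⟩
  have i1 : Integrable (fun ω => φ (X N ω)) P :=
    Integrable.of_bound (hφ.comp (hX.1 N)).aestronglyMeasurable 1 (ae_of_all _ fun ω => h1 _)
  have i2 : Integrable φ ν := Integrable.of_bound hφ.aestronglyMeasurable 1 (ae_of_all _ h1)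
  have r1 := hN (fun x => (φ x).re) (Complex.measurable_re.comp hφ)
    fun x => (Complex.abs_re_le_norm _).trans (h1 x)
  have r2 := hN (fun x => (φ x).im) (Complex.measurable_im.comp hφ)
    fun x => (Complex.abs_im_le_norm _).trans (h1 x)
  have c1 : ∫ ω, (φ (X N ω)).re ∂P = (∫ ω, φ (X N ω) ∂P).re := integral_re i1
  have c2 : ∫ ω, (φ (X N ω)).im ∂P = (∫ ω, φ (X N ω) ∂P).im := integral_im i1
  have c3 : ∫ x, (φ x).re ∂ν = (∫ x, φ x ∂ν).re := integral_re i2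
  have c4 : ∫ x, (φ x).im ∂ν = (∫ x, φ x ∂ν).im := integral_im i2
  rw [c1, c3, ← Complex.sub_re] at r1
  rw [c2, c4, ← Complex.sub_im] at r2
  exact (Complex.norm_le_abs_re_add_abs_im _).trans (by linarith)

theorem abstract_clt (hX : Chain Q P X) (hr : Rev Q ν) (herg : Erg Q ν)
    (hsing : ∀ ε > 0, ∃ n, ∀ A, MeasurableSet A → ν A = 0 → P.real (X n ⁻¹' A) ≤ ε)
    {f : S → ℝ} (hfm : Measurable f) {f' : S → ℝ} (hf : BM f') (hff : f =ᵐ[ν] f')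
    (hs : Summable fun n : ℕ => ∫ x, f' x * (op Q)^[n + 1] f' x ∂ν) {σ : ℝ}
    (hσ : σ = (∫ x, f' x * f' x ∂ν) + 2 * ∑' n : ℕ, ∫ x, f' x * (op Q)^[n + 1] f' x ∂ν) (t : ℝ) :
    Tendsto (fun n : ℕ => ∫ ω, Complex.exp ((t / √n * ∑ j ∈ Finset.range n, f (X j ω) : ℝ) * Complex.I) ∂P)
      atTop (𝓝 ((Real.exp (-(t ^ 2 * σ / 2)) : ℝ) : ℂ)) := by
  obtain ⟨P', hP', X', hX', h0'⟩ := exists_chain Q ν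
  have hst := stat_clt hX' hr herg h0' hf hs hσ t
  have hsq : Tendsto (fun n : ℕ => √(n:ℝ)) atTop atTop :=
    Real.tendsto_sqrt_atTop.comp tendsto_natCast_atTop_atTop
  have hinv : Tendsto (fun n : ℕ => |t| / √(n:ℝ)) atTop (𝓝 0) := hsq.const_div_atTop _
  obtain ⟨C, hC0, hC⟩ := hf.pos_bdd
  rw [Metric.tendsto_atTop]
  intro ε' hε'
  set ε := ε' / 5 with hεd
  have hε : 0 < ε := by positivity
  obtain ⟨N, hN⟩ := tv_conv_complex hX hr herg hsing ε hε
  -- first difference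
  have mX := hX.1
  have mX' := hX'.1
  have mf' := hf.meas
  have mfX : ∀ j, Measurable fun ω => f (X j ω) := fun j => hfm.comp (hX.1 j)
  have mfX' : ∀ j, Measurable fun ω => f' (X' j ω) := fun j => hf.meas.comp (hX'.1 j)
  have int1 : ∀ (Ω : Type) [MeasurableSpace Ω] (P : Measure Ω) [IsProbabilityMeasure P]
      (g : Ω → ℝ), Measurable g → Integrable (fun ω => Complex.exp ((g ω : ℝ) * Complex.I)) P := by
    intro Ω _ P _ g hg
    exact Integrable.of_bound (Measurable.aestronglyMeasurable (by fun_prop)) 1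
      (ae_of_all _ fun ω => by rw [Complex.norm_exp_ofReal_mul_I])
  have d1 : Tendsto (fun n : ℕ => ∫ ω, ‖Complex.exp ((t / √((n + N : ℕ) : ℝ) * ∑ j ∈ Finset.range (n + N), f (X j ω) : ℝ) * Complex.I)
      - Complex.exp ((t / √((n + N : ℕ) : ℝ) * ∑ j ∈ Finset.range n, f (X (N + j) ω) : ℝ) * Complex.I)‖ ∂P) atTop (𝓝 0) := by
    have := tendsto_integral_of_dominated_convergence (μ := P)
      (F := fun (n : ℕ) ω => ‖Complex.exp ((t / √((n + N : ℕ) : ℝ) * ∑ j ∈ Finset.range (n + N), f (X j ω) : ℝ) * Complex.I)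
      - Complex.exp ((t / √((n + N : ℕ) : ℝ) * ∑ j ∈ Finset.range n, f (X (N + j) ω) : ℝ) * Complex.I)‖)
      (f := fun _ => 0) (fun _ => (2:ℝ))
      (fun n => (Measurable.aestronglyMeasurable (by fun_prop)))
      (integrable_const _)
      (fun n => ae_of_all _ fun ω => by
        rw [norm_norm]
        refine (norm_sub_le _ _).trans ?_
        rw [Complex.norm_exp_ofReal_mul_I, Complex.norm_exp_ofReal_mul_I]; norm_num)
      (ae_of_all _ fun ω => by
        have hz : Tendsto (fun n : ℕ => |t| / √((n + N : ℕ) : ℝ) * |∑ j ∈ Finset.range N, f (X j ω)|) atTop (𝓝 0) := by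
          have := (hinv.comp (tendsto_add_atTop_nat N)).mul_const |∑ j ∈ Finset.range N, f (X j ω)|
          rw [zero_mul] at this
          exact this
        refine squeeze_zero (fun n => norm_nonneg _) (fun n => ?_) hz
        refine (norm_exp_sub_le _ _).trans (le_of_eq ?_)
        rw [← mul_sub, add_comm n N, Finset.sum_range_add, add_sub_cancel_right, abs_mul, abs_div,
          abs_of_nonneg (Real.sqrt_nonneg _)])
    simpa using this
  have d2 : Tendsto (fun n : ℕ => |t| / √((n + N : ℕ) : ℝ) * (N * C)) atTop (𝓝 0) := by
    have := (hinv.comp (tendsto_add_atTop_nat N)).mul_const (N * C)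
    rw [zero_mul] at this
    exact this
  obtain ⟨N1, hN1⟩ := eventually_atTop.1 (d1.eventually (gt_mem_nhds hε))
  obtain ⟨N2, hN2⟩ := eventually_atTop.1 (d2.eventually (gt_mem_nhds hε))
  obtain ⟨N3, hN3⟩ := Metric.tendsto_atTop.1 hst ε hε
  refine ⟨max (max N1 N2) N3 + N, fun n' hn' => ?_⟩
  obtain ⟨n, rfl⟩ : ∃ n, n' = n + N := ⟨n' - N, by omega⟩
  have hn : max (max N1 N2) N3 ≤ n := by omega
  have q1 := hN1 n ((le_max_left _ _).trans ((le_max_left _ _).trans hn))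
  have q2 := hN2 n ((le_max_right _ _).trans ((le_max_left _ _).trans hn))
  have q3 := hN3 (n + N) (((le_max_right _ _).trans hn).trans (by omega))
  set b := t / √((n + N : ℕ) : ℝ) with hb
  have hbabs : |b| = |t| / √((n + N : ℕ) : ℝ) := by
    rw [hb, abs_div, abs_of_nonneg (Real.sqrt_nonneg _)]
  -- chain of comparisons
  have s1 : ‖∫ ω, Complex.exp ((b * ∑ j ∈ Finset.range (n + N), f (X j ω) : ℝ) * Complex.I) ∂P -
      ∫ ω, Complex.exp ((b * ∑ j ∈ Finset.range n, f (X (N + j) ω) : ℝ) * Complex.I) ∂P‖ < ε := by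
    rw [← integral_sub (int1 _ P _ (by fun_prop)) (int1 _ P _ (by fun_prop))]
    exact (norm_integral_le_integral_norm _).trans_lt q1
  obtain ⟨φ, φm, φ1, hφ⟩ := path_functional Q n
    (fun v => Complex.exp ((b * ∑ j : Fin n, f (v j.castSucc) : ℝ) * Complex.I))
    (by fun_prop) (fun v => by rw [Complex.norm_exp_ofReal_mul_I])
  have p1 := hφ P _ (hX.shift N)
  have p2 := hφ P' _ hX'
  have hsumF : ∀ (g : ℕ → ℝ), ∑ j : Fin n, g (j.castSucc : Fin (n + 1)) = ∑ j ∈ Finset.range n, g j := by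
    intro g
    rw [← Fin.sum_univ_eq_sum_range]; rfl
  have s2 : ‖∫ ω, Complex.exp ((b * ∑ j ∈ Finset.range n, f (X (N + j) ω) : ℝ) * Complex.I) ∂P -
      ∫ ω, Complex.exp ((b * ∑ j ∈ Finset.range n, f (X' j ω) : ℝ) * Complex.I) ∂P'‖ ≤ ε := by
    have p1' : ∫ ω, Complex.exp ((b * ∑ j ∈ Finset.range n, f (X (N + j) ω) : ℝ) * Complex.I) ∂P =
        ∫ ω, φ (X (N + 0) ω) ∂P := by
      rw [← p1]; congr 1; funext ω
      rw [hsumF (fun j => f (X (N + j) ω))]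
    have p2' : ∫ ω, Complex.exp ((b * ∑ j ∈ Finset.range n, f (X' j ω) : ℝ) * Complex.I) ∂P' =
        ∫ ω, φ (X' 0 ω) ∂P' := by
      rw [← p2]; congr 1; funext ω
      rw [hsumF (fun j => f (X' j ω))]
    rw [p1', p2', ← integral_map (hX'.1 0).aemeasurable φm.aestronglyMeasurable, h0']
    exact hN φ φm φ1
  have s3 : ∫ ω, Complex.exp ((b * ∑ j ∈ Finset.range n, f (X' j ω) : ℝ) * Complex.I) ∂P' =
      ∫ ω, Complex.exp ((b * ∑ j ∈ Finset.range n, f' (X' j ω) : ℝ) * Complex.I) ∂P' := by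
    refine integral_congr_ae ?_
    have : ∀ j, ∀ᵐ ω ∂P', f (X' j ω) = f' (X' j ω) := fun j => by
      have := hX'.map_eq hr h0' j
      rw [← this] at hff
      exact ae_of_ae_map (hX'.1 j).aemeasurable hff
    filter_upwards [ae_all_iff.2 this] with ω hω
    simp only [hω]
  have s4 : ‖∫ ω, Complex.exp ((b * ∑ j ∈ Finset.range n, f' (X' j ω) : ℝ) * Complex.I) ∂P' -
      ∫ ω, Complex.exp ((b * ∑ j ∈ Finset.range (n + N), f' (X' j ω) : ℝ) * Complex.I) ∂P'‖ < ε := by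
    rw [← integral_sub (int1 _ P' _ (by fun_prop)) (int1 _ P' _ (by fun_prop))]
    refine lt_of_le_of_lt (norm_integral_le_of_norm_le_const (C := |t| / √((n + N : ℕ) : ℝ) * (N * C))
      (ae_of_all _ fun ω => (norm_exp_sub_le _ _).trans ?_)) (by simpa using q2)
    rw [← mul_sub, Finset.sum_range_add, abs_mul, hbabs]
    refine mul_le_mul_of_nonneg_left ?_ (by positivity)
    rw [abs_sub_comm, add_sub_cancel_left]
    refine (Finset.abs_sum_le_sum_abs _ _).trans ((Finset.sum_le_sum fun i _ => hC _).trans ?_)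
    simp
  rw [s3, ← dist_eq_norm] at s2
  rw [← dist_eq_norm] at s1 s4
  have z1 := (dist_triangle _ _ _).trans_lt (add_lt_add_of_lt_of_le s1 s2)
  have z2 := (dist_triangle _ _ _).trans_lt (add_lt_add z1 s4)
  have z3 := (dist_triangle _ _ _).trans_lt (add_lt_add z2 q3)
  linarith

end transfer
end ECT

set_option linter.unusedSectionVars false
namespace ECT
open MeasureTheory ProbabilityTheory Filter Topology Set

section ergo
variable {S : Type} [MeasurableSpace S] {Q : Kernel S S} [IsMarkovKernel Q]
variable {ν : Measure S} [IsProbabilityMeasure ν]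

lemma abs_op_le {φ : S → ℝ} (x : S) : |op Q φ x| ≤ op Q (fun z => |φ z|) x := by
  unfold op
  exact abs_integral_le_integral_abs

lemma op_L1 (hr : Rev Q ν) {φ : S → ℝ} (h : BM φ) : ∫ x, |op Q φ x| ∂ν ≤ ∫ x, |φ x| ∂ν := by
  rw [← hr.inv h.abs]
  exact integral_mono (h.op.abs.integrable _) (h.abs.op.integrable _) fun x => abs_op_le x

lemma op_L1_iter (hr : Rev Q ν) {φ : S → ℝ} (h : BM φ) (n : ℕ) :
    ∫ x, |(op Q)^[n] φ x| ∂ν ≤ ∫ x, |φ x| ∂ν := by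
  induction n with
  | zero => simp
  | succ n ih => rw [Function.iterate_succ_apply']; exact (op_L1 hr (h.iter n)).trans ih

lemma op_iter_sub {φ ψ : S → ℝ} (h : BM φ) (k : BM ψ) (n : ℕ) :
    (op Q)^[n] (fun x => φ x - ψ x) = fun x => (op Q)^[n] φ x - (op Q)^[n] ψ x := by
  induction n with
  | zero => rfl
  | succ n ih =>
    rw [Function.iterate_succ_apply', ih, op_sub (h.iter n) (k.iter n),
      Function.iterate_succ_apply', Function.iterate_succ_apply']

lemma op_L2 (hr : Rev Q ν) {φ : S → ℝ} (h : BM φ) :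
    ∫ x, op Q φ x * op Q φ x ∂ν ≤ ∫ x, φ x * φ x ∂ν := by
  rw [← hr.inv (h.mul h)]
  refine integral_mono ((h.op.mul h.op).integrable _) ((h.mul h).op.integrable _) fun x => ?_
  have := mV_nonneg (Q := Q) h x
  unfold mV at this
  linarith

lemma L1_le_L2 {φ : S → ℝ} (h : BM φ) {η : ℝ} (hη : 0 < η) :
    ∫ x, |φ x| ∂ν ≤ (∫ x, φ x * φ x ∂ν) / (2 * η) + η / 2 := by
  have : ∀ x, |φ x| ≤ (φ x * φ x) / (2 * η) + η / 2 := fun x => by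
    have q : 0 ≤ (|φ x| - η) ^ 2 / (2 * η) := by positivity
    have q2 : (|φ x| - η) ^ 2 / (2 * η) = (φ x * φ x) / (2 * η) + η / 2 - |φ x| := by
      rw [sub_sq, sq_abs]; field_simp; ring
    linarith
  have i : Integrable (fun x => (φ x * φ x) / (2 * η)) ν := ((h.mul h).integrable _).div_const _
  refine (integral_mono (h.abs.integrable _) (i.add (integrable_const _)) this).trans (le_of_eq ?_)
  change ∫ x, (φ x * φ x / (2 * η) + η / 2) ∂ν = _
  rw [integral_add i (integrable_const _), integral_div]
  simp

lemma erg_of_irr (hr : Rev Q ν)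
    (hirr : ∀ h : S → ℝ, BM h → (∀ᵐ x ∂ν, op Q (op Q h) x = h x) → ∃ c, ∀ᵐ x ∂ν, h x = c) :
    Erg Q ν := by
  intro v hv
  obtain ⟨C, hC0, hC⟩ := hv.pos_bdd
  set g : ℕ → S → ℝ := fun n => (op Q)^[n + n] v with hg
  have gB : ∀ n, BM (g n) := fun n => hv.iter _
  have gC : ∀ n x, |g n x| ≤ C := fun n x => op_iter_bound hC _ x
  set a : ℕ → ℝ := fun n => ∫ x, (op Q)^[n] v x * (op Q)^[n] v x ∂ν with ha
  have anti : Antitone a := antitone_nat_of_succ_le fun n => by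
    simp only [ha, Function.iterate_succ_apply']
    exact op_L2 hr (hv.iter n)
  have hbdd : BddBelow (range a) := ⟨0, by
    rintro _ ⟨n, rfl⟩
    exact integral_nonneg fun x => mul_self_nonneg _⟩
  obtain ⟨L, hL⟩ : ∃ L, Tendsto a atTop (𝓝 L) := ⟨_, tendsto_atTop_ciInf anti hbdd⟩
  have hdist : ∀ n k, ∫ x, (g n x - g k x) * (g n x - g k x) ∂ν = a (n + n) - 2 * a (n + k) + a (k + k) := by
    intro n k
    have e : ∀ x, (g n x - g k x) * (g n x - g k x) = g n x * g n x - 2 * (g n x * g k x) + g k x * g k x :=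
      fun x => by ring
    simp only [e]
    have b1 := (gB n).mul (gB n)
    have b2 := (BM.const 2).mul ((gB n).mul (gB k))
    have b3 := (gB k).mul (gB k)
    rw [integral_add ((b1.sub b2).integrable _) (b3.integrable _),
      integral_sub (b1.integrable _) (b2.integrable _), integral_const_mul]
    congr 3
    simp only [hg, ha]
    rw [hr.iter_iter hv, hr.iter_iter hv, show n + n + (k + k) = n + k + (n + k) by omega]
  have hcau : ∀ ε > 0, ∃ N, ∀ n ≥ N, ∀ k ≥ N, ∫ x, |g n x - g k x| ∂ν < ε := by
    intro ε hε
    obtain ⟨N, hN⟩ := Metric.tendsto_atTop.1 hL (ε ^ 2 / 4) (by positivity)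
    refine ⟨N, fun n hn k hk => ?_⟩
    have := L1_le_L2 (ν := ν) ((gB n).sub (gB k)) hε
    rw [hdist] at this
    have n1 := abs_lt.1 (hN (n + n) (by omega))
    have n2 := abs_lt.1 (hN (n + k) (by omega))
    have n3 := abs_lt.1 (hN (k + k) (by omega))
    have : (a (n + n) - 2 * a (n + k) + a (k + k)) / (2 * ε) < ε / 2 := by
      rw [div_lt_iff₀ (by positivity)]
      nlinarith [n1.1, n1.2, n2.1, n2.2, n3.1, n3.2]
    linarith
  -- L1 limit
  set u : ℕ → (S →₁[ν] ℝ) := fun n => ((gB n).integrable ν).toL1 (g n) with hu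
  have hunorm : ∀ n k, dist (u n) (u k) = ∫ x, |g n x - g k x| ∂ν := fun n k => by
    rw [dist_eq_norm, L1.norm_eq_integral_norm]
    refine integral_congr_ae ?_
    filter_upwards [Lp.coeFn_sub (u n) (u k), ((gB n).integrable ν).coeFn_toL1,
      ((gB k).integrable ν).coeFn_toL1] with x h1 h2 h3
    rw [h1, Pi.sub_apply, h2, h3, Real.norm_eq_abs]
  have huc : CauchySeq u := Metric.cauchySeq_iff.2 fun ε hε => by
    obtain ⟨N, hN⟩ := hcau ε hε
    exact ⟨N, fun n hn k hk => by rw [hunorm]; exact hN n hn k hk⟩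
  obtain ⟨U, hU⟩ := cauchySeq_tendsto_of_complete huc
  have hUm := (Lp.stronglyMeasurable U).measurable
  set w : S → ℝ := fun x => max (-C) (min (U x) C) with hw
  have wB : BM w := ⟨measurable_const.max (hUm.min measurable_const), C, fun x =>
    abs_le.2 ⟨le_max_left _ _, max_le (by linarith) (min_le_right _ _)⟩⟩
  have hconv : Tendsto (fun n => ∫ x, |g n x - w x| ∂ν) atTop (𝓝 0) := by
    have h1 := tendsto_iff_dist_tendsto_zero.1 hU
    refine squeeze_zero (fun n => integral_nonneg fun x => abs_nonneg _) (fun n => ?_) h1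
    rw [dist_eq_norm, L1.norm_eq_integral_norm]
    refine integral_mono_ae (((gB n).sub wB).abs.integrable _) (L1.integrable_coeFn (u n - U)).norm ?_
    filter_upwards [Lp.coeFn_sub (u n) U, ((gB n).integrable ν).coeFn_toL1] with x h1 h2
    rw [h1, Pi.sub_apply, h2, Real.norm_eq_abs]
    have := abs_le.1 (gC n x)
    have e : g n x = max (-C) (min (g n x) C) := by
      rw [min_eq_left this.2, max_eq_right this.1]
    conv_lhs => rw [e]
    simp only [hw]
    rw [max_comm (-C), max_comm (-C)]
    exact (abs_max_sub_max_le_abs _ _ _).trans (abs_inf_sub_inf_le_abs _ _ _)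
  have hinv : ∀ᵐ x ∂ν, op Q (op Q w) x = w x := by
    have hz : ∫ x, |op Q (op Q w) x - w x| ∂ν = 0 := by
      refine le_antisymm ?_ (integral_nonneg fun x => abs_nonneg _)
      have h2 := hconv.add (hconv.comp (tendsto_add_atTop_nat 1))
      rw [add_zero] at h2
      refine ge_of_tendsto' h2 fun n => ?_
      have e1 : ∀ x, op Q (op Q w) x - w x = (g (n + 1) x - w x) - (op Q)^[2] (fun y => g n y - w y) x := by
        intro x
        rw [op_iter_sub (gB n) wB]
        have : (op Q)^[2] (g n) = g (n + 1) := by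
          simp only [hg]
          rw [← Function.iterate_add_apply]
          congr 1; omega
        rw [this]
        simp [Function.iterate_succ]
      have bb := (((gB n).sub wB).iter (Q := Q) 2)
      calc ∫ x, |op Q (op Q w) x - w x| ∂ν ≤ ∫ x, (|g (n + 1) x - w x| + |(op Q)^[2] (fun y => g n y - w y) x|) ∂ν := by
            refine integral_mono ((wB.op.op.sub wB).abs.integrable _)
              ((((gB (n+1)).sub wB).abs.add bb.abs).integrable _) fun x => ?_
            simp only [e1]
            exact abs_sub _ _
        _ = ∫ x, |g (n + 1) x - w x| ∂ν + ∫ x, |(op Q)^[2] (fun y => g n y - w y) x| ∂ν :=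
            integral_add (((gB (n+1)).sub wB).abs.integrable _) (bb.abs.integrable _)
        _ ≤ _ := by
            have := op_L1_iter hr ((gB n).sub wB) 2
            simp only [Function.comp]
            linarith
    have := (integral_eq_zero_iff_of_nonneg (fun x => abs_nonneg _)
      ((wB.op.op.sub wB).abs.integrable _)).1 hz
    filter_upwards [this] with x hx
    simpa [sub_eq_zero] using hx
  obtain ⟨c, hc⟩ := hirr w wB hinv
  have hconv2 : Tendsto (fun n => ∫ x, |g n x - c| ∂ν) atTop (𝓝 0) := by
    refine hconv.congr fun n => integral_congr_ae ?_
    filter_upwards [hc] with x hx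
    simp only [hx]
  have hcv : c = ∫ x, v x ∂ν := by
    have h3 : ∀ n, |∫ x, v x ∂ν - c| ≤ ∫ x, |g n x - c| ∂ν := fun n => by
      have := abs_integral_le_integral_abs (μ := ν) (f := fun x => g n x - c)
      rw [integral_sub ((gB n).integrable _) (integrable_const _), hr.inv_iter hv] at this
      simpa using this
    have h4 := ge_of_tendsto' hconv2 h3
    have := abs_nonpos_iff.1 h4
    linarith
  rw [← hcv]
  have hmono : Antitone fun l => ∫ x, |(op Q)^[l] v x - c| ∂ν := antitone_nat_of_succ_le fun l => by
    have := op_L1 hr (((hv.iter (Q := Q) l)).sub (BM.const c))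
    rw [op_sub (hv.iter l) (BM.const c), op_const] at this
    simp only [Function.iterate_succ_apply']
    exact this
  rw [Metric.tendsto_atTop]
  intro ε hε
  obtain ⟨N, hN⟩ := Metric.tendsto_atTop.1 hconv2 ε hε
  refine ⟨N + N, fun l hl => ?_⟩
  have h5 := hN N le_rfl
  rw [Real.dist_0_eq_abs, abs_of_nonneg (integral_nonneg fun x => abs_nonneg _)] at h5 ⊢
  exact (hmono hl).trans_lt h5
end ergo
end ECT

set_option linter.unusedSectionVars false
namespace ECT
open MeasureTheory ProbabilityTheory Filter Topology Set
open scoped ENNReal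

lemma cov1 (c s : ℝ) (hc : 0 < c) (g : ℝ → ℝ≥0∞) :
    ENNReal.ofReal (√c) * ∫⁻ u in Ioo (0:ℝ) 1, g (s - u ^ 2 * c) =
      ∫⁻ t in Ioo (s - c) s, g t * ENNReal.ofReal (1 / (2 * √(s - t))) := by
  have himg : (fun u : ℝ => s - u ^ 2 * c) '' Ioo 0 1 = Ioo (s - c) s := by
    ext t
    constructor
    · rintro ⟨u, ⟨h0, h1⟩, rfl⟩
      have : u ^ 2 < 1 := by nlinarith
      constructor
      · simp only; nlinarith
      · simp only; nlinarith [mul_pos (mul_pos h0 h0) hc]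
    · rintro ⟨h0, h1⟩
      refine ⟨√((s - t) / c), ⟨Real.sqrt_pos.2 (div_pos (by linarith) hc), ?_⟩, ?_⟩
      · rw [Real.sqrt_lt' one_pos, div_lt_iff₀ hc]; linarith
      · simp only
        rw [Real.sq_sqrt (div_nonneg (by linarith) hc.le), div_mul_cancel₀ _ hc.ne']; ring
  have := lintegral_image_eq_lintegral_abs_deriv_mul (s := Ioo (0:ℝ) 1) measurableSet_Ioo
    (f := fun u => s - u ^ 2 * c) (f' := fun u => - (2 * u * c))
    (fun u _ => by
      have h1 := ((hasDerivAt_pow 2 u).mul_const c).const_sub s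
      simpa using h1.hasDerivWithinAt)
    (fun u hu v hv h => by
      simp only [sub_right_inj] at h
      have h2 := mul_right_cancel₀ hc.ne' h
      exact (pow_left_inj₀ hu.1.le hv.1.le (by norm_num)).1 h2)
    (fun t => g t * ENNReal.ofReal (1 / (2 * √(s - t))))
  rw [himg] at this
  rw [this, ← lintegral_const_mul' _ _ ENNReal.ofReal_ne_top]
  refine setLIntegral_congr_fun measurableSet_Ioo fun u hu => ?_
  have hu0 := hu.1
  have e1 : s - (s - u ^ 2 * c) = u ^ 2 * c := by ring
  beta_reduce
  rw [e1, Real.sqrt_mul (by positivity), Real.sqrt_sq hu0.le, abs_neg, abs_of_pos (by positivity)]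
  rw [mul_comm (g _), ← mul_assoc, ← ENNReal.ofReal_mul (by positivity)]
  congr 2
  have hs : 0 < √c := Real.sqrt_pos.2 hc
  rw [eq_comm, ← mul_div_assoc, mul_one, div_eq_iff (by positivity)]
  nlinarith [Real.mul_self_sqrt hc.le]

lemma lint_ins {n : ℕ} (i : Fin (n + 1)) (F : (Fin (n + 1) → ℝ) → ℝ≥0∞) (hF : Measurable F) :
    ∫⁻ x, F x = ∫⁻ a : ℝ, ∫⁻ r : Fin n → ℝ, F (i.insertNth a r) := by
  have h := (volume_preserving_piFinSuccAbove (fun _ : Fin (n + 1) => ℝ) i).symm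
  have h2 : ∀ p : ℝ × (Fin n → ℝ), (MeasurableEquiv.piFinSuccAbove (fun _ : Fin (n + 1) => ℝ) i).symm p =
    i.insertNth p.1 p.2 := fun p => rfl
  have mI : Measurable fun p : ℝ × (Fin n → ℝ) => F (i.insertNth p.1 p.2) :=
    hF.comp (MeasurableEquiv.piFinSuccAbove (fun _ : Fin (n + 1) => ℝ) i).symm.measurable
  rw [← h.lintegral_comp hF]
  simp only [h2]
  exact lintegral_prod _ mI.aemeasurable

lemma swap_lint {m : ℕ} (i : Fin m) (F : (Fin m → ℝ) → ℝ → ℝ≥0∞)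
    (hF : Measurable (Function.uncurry F)) :
    ∫⁻ x, ∫⁻ t, F x t = ∫⁻ x : Fin m → ℝ, ∫⁻ t : ℝ, F (Function.update x i t) (x i) := by
  obtain ⟨n, rfl⟩ : ∃ n, m = n + 1 := ⟨m - 1, by have := i.2; omega⟩
  have mins : Measurable fun p : ℝ × (Fin n → ℝ) => (i.insertNth p.1 p.2 : Fin (n + 1) → ℝ) :=
    (MeasurableEquiv.piFinSuccAbove (fun _ : Fin (n + 1) => ℝ) i).symm.measurable
  have mins' : ∀ {β : Type} [MeasurableSpace β] {a : β → ℝ} {r : β → Fin n → ℝ}, Measurable a →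
      Measurable r → Measurable fun b => (i.insertNth (a b) (r b) : Fin (n + 1) → ℝ) :=
    fun ha hr => mins.comp (ha.prodMk hr)
  have mF : ∀ {β : Type} [MeasurableSpace β] {a : β → (Fin (n + 1) → ℝ)} {r : β → ℝ}, Measurable a →
      Measurable r → Measurable fun b => F (a b) (r b) :=
    fun ha hr => hF.comp (ha.prodMk hr)
  have mup : Measurable fun p : (Fin (n + 1) → ℝ) × ℝ => Function.update p.1 i p.2 :=
    measurable_update'
  have m1 : Measurable fun x => ∫⁻ t, F x t :=
    Measurable.lintegral_prod_right' (f := Function.uncurry F) hF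
  have m2 : Measurable fun x : Fin (n + 1) → ℝ => ∫⁻ t : ℝ, F (Function.update x i t) (x i) :=
    Measurable.lintegral_prod_right' (f := fun p : (Fin (n + 1) → ℝ) × ℝ =>
      F (Function.update p.1 i p.2) (p.1 i)) (mF mup (by fun_prop))
  rw [lint_ins i _ m1, lint_ins i _ m2]
  simp only [Fin.insertNth_apply_same, Fin.update_insertNth]
  have e1 : ∀ a : ℝ, ∫⁻ r : Fin n → ℝ, ∫⁻ t : ℝ, F (i.insertNth a r) t =
      ∫⁻ t : ℝ, ∫⁻ r : Fin n → ℝ, F (i.insertNth a r) t := fun a =>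
    lintegral_lintegral_swap (mF (mins' measurable_const measurable_fst) measurable_snd).aemeasurable
  have e2 : ∀ a : ℝ, ∫⁻ r : Fin n → ℝ, ∫⁻ t : ℝ, F (i.insertNth t r) a =
      ∫⁻ t : ℝ, ∫⁻ r : Fin n → ℝ, F (i.insertNth t r) a := fun a =>
    lintegral_lintegral_swap (mF (mins' measurable_snd measurable_fst) measurable_const).aemeasurable
  simp only [e1, e2]
  refine lintegral_lintegral_swap (Measurable.aemeasurable ?_)
  exact Measurable.lintegral_prod_right' (f := fun p : (ℝ × ℝ) × (Fin n → ℝ) =>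
    F (i.insertNth p.1.1 p.2) p.1.2) (mF (mins' (by fun_prop) (by fun_prop)) (by fun_prop))

end ECT

set_option linter.unusedSectionVars false
namespace ECT
open MeasureTheory ProbabilityTheory Filter Topology Set
open scoped ENNReal

variable {m : ℕ} {E : ℝ}

lemma meas_coord (i : Fin m) : Measurable fun x : Delta m E => x.1 i :=
  (measurable_pi_apply i).comp measurable_subtype_coe

lemma meas_Texch (i : Fin m) : Measurable fun p : ℝ × Delta m E => Texch m E i p.1 p.2 := by
  have h : Measurable fun p : ℝ × Delta m E => (Texch m E i p.1 p.2).1 := by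
    have e : (fun p : ℝ × Delta m E => (Texch m E i p.1 p.2).1) =
        fun p => (if p.1 ∈ Ioo (0:ℝ) 1 then T0 m E i p.1 p.2.1 else p.2.1) := by
      funext p
      unfold Texch
      split_ifs <;> rfl
    rw [e]
    refine Measurable.ite (measurable_fst measurableSet_Ioo) ?_ (by fun_prop)
    unfold T0
    refine (measurable_update' (a := i)).comp (Measurable.prodMk (f := fun p : ℝ × Delta m E => p.2.1)
      (g := fun p : ℝ × Delta m E => (E - ∑ j, p.2.1 j) + (1 - p.1 ^ 2) * p.2.1 i) ?_ ?_)
    · fun_prop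
    · have hc : ∀ j : Fin m, Measurable fun p : ℝ × Delta m E => p.2.1 j := fun j =>
        (meas_coord j).comp measurable_snd
      have := hc i
      exact (measurable_const.sub (Finset.measurable_fun_sum _ fun j _ => hc j)).add
        ((by fun_prop : Measurable fun p : ℝ × Delta m E => 1 - p.1 ^ 2).mul (hc i))
  exact h.subtype_mk (h := fun p => (Texch m E i p.1 p.2).2)

lemma meas_Texch' (i : Fin m) (x : Delta m E) : Measurable fun u : ℝ => Texch m E i u x :=
  (meas_Texch i).comp (measurable_id.prodMk measurable_const)

instance : IsProbabilityMeasure unif01 := ⟨by simp [unif01]⟩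

lemma lint_ustep (x : Delta m E) {φ : Delta m E → ℝ≥0∞} (hφ : Measurable φ) :
    ∫⁻ z, φ z ∂(ustep m E x) = ENNReal.ofReal (1 - jumpRate m E x / Lam m E) * φ x +
      (ENNReal.ofReal (Lam m E))⁻¹ * ∑ i, ENNReal.ofReal (√(x.1 i)) *
        ∫⁻ u in Ioo (0:ℝ) 1, φ (Texch m E i u x) := by
  unfold ustep
  rw [lintegral_add_measure, lintegral_smul_measure, lintegral_smul_measure,
    lintegral_dirac' _ hφ, lintegral_sum_measure, tsum_fintype]
  simp only [smul_eq_mul, lintegral_smul_measure, lintegral_map hφ (meas_Texch' _ x), unif01]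

lemma meas_ustep : Measurable (ustep m E) := by
  refine Measure.measurable_of_measurable_coe _ fun s hs => ?_
  have hI : Measurable (s.indicator (fun _ => (1:ℝ≥0∞)) : Delta m E → ℝ≥0∞) :=
    measurable_const.indicator hs
  have e : (fun x => ustep m E x s) = fun x =>
      ENNReal.ofReal (1 - jumpRate m E x / Lam m E) * s.indicator (fun _ => (1:ℝ≥0∞)) x +
      (ENNReal.ofReal (Lam m E))⁻¹ * ∑ i, ENNReal.ofReal (√(x.1 i)) *
        ∫⁻ u in Ioo (0:ℝ) 1, s.indicator (fun _ => (1:ℝ≥0∞)) (Texch m E i u x) := by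
    funext x
    rw [← lint_ustep x hI, lintegral_indicator hs]; simp
  rw [e]
  have h1 : Measurable fun x : Delta m E => ENNReal.ofReal (1 - jumpRate m E x / Lam m E) := by
    unfold jumpRate
    exact (measurable_const.sub ((Finset.measurable_fun_sum _ fun j _ =>
      (meas_coord j).sqrt).div_const _)).ennreal_ofReal
  have h2 : ∀ i : Fin m, Measurable fun x : Delta m E =>
      ∫⁻ u in Ioo (0:ℝ) 1, s.indicator (fun _ => (1:ℝ≥0∞)) (Texch m E i u x) := fun i =>
    Measurable.lintegral_prod_left' (f := fun p : ℝ × Delta m E =>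
      s.indicator (fun _ => (1:ℝ≥0∞)) (Texch m E i p.1 p.2)) (hI.comp (meas_Texch i))
  have h3 : ∀ i : Fin m, Measurable fun x : Delta m E => ENNReal.ofReal (√(x.1 i)) := by
    intro i; exact (meas_coord i).sqrt.ennreal_ofReal
  exact (h1.mul hI).add (measurable_const.mul (Finset.measurable_fun_sum _ fun i _ => (h3 i).mul (h2 i)))

lemma Lam_pos (hm : 1 ≤ m) (hE : 0 < E) : 0 < Lam m E := by
  unfold Lam
  have : (0:ℝ) < m := by exact_mod_cast hm
  positivity

lemma jumpRate_le (x : Delta m E) : jumpRate m E x ≤ Lam m E := by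
  unfold jumpRate Lam
  apply Real.le_sqrt_of_sq_le
  have h := sq_sum_le_card_mul_sum_sq (s := (Finset.univ : Finset (Fin m))) (f := fun i => √(x.1 i))
  have h2 : ∑ i, (√(x.1 i)) ^ 2 = ∑ i, x.1 i := Finset.sum_congr rfl fun i _ => Real.sq_sqrt (x.2.1 i).le
  rw [h2, Finset.card_univ, Fintype.card_fin] at h
  have h3 := x.2.2
  have : (0:ℝ) ≤ m := by positivity
  nlinarith

lemma ustep_prob (hm : 1 ≤ m) (hE : 0 < E) (x : Delta m E) : IsProbabilityMeasure (ustep m E x) := by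
  constructor
  have h := lint_ustep x (φ := fun _ => 1) measurable_const
  have hL := Lam_pos hm hE
  rw [lintegral_one] at h
  rw [h]
  simp only [lintegral_const, mul_one, MeasurableSet.univ, Measure.restrict_apply, univ_inter,
    Real.volume_Ioo, sub_zero, ENNReal.ofReal_one]
  rw [← ENNReal.ofReal_sum_of_nonneg (fun i _ => Real.sqrt_nonneg _), ← ENNReal.ofReal_inv_of_pos hL,
    ← ENNReal.ofReal_mul (by positivity), ← ENNReal.ofReal_add, ← ENNReal.ofReal_one]
  · congr 1
    change 1 - jumpRate m E x / Lam m E + (Lam m E)⁻¹ * jumpRate m E x = 1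
    field_simp; ring
  · rw [sub_nonneg, div_le_one hL]; exact jumpRate_le x
  · positivity

/-- one-step kernel -/
noncomputable def KK (m : ℕ) (E : ℝ) : Kernel (Delta m E) (Delta m E) := ⟨ustep m E, meas_ustep⟩

lemma KK_apply (x : Delta m E) : KK m E x = ustep m E x := rfl

lemma meas_ustepIter (n : ℕ) : Measurable (ustepIter m E n) := by
  induction n with
  | zero => exact Measure.measurable_dirac
  | succ n ih =>
    exact (Measure.measurable_bind' ih).comp meas_ustep

noncomputable def KI (m : ℕ) (E : ℝ) (n : ℕ) : Kernel (Delta m E) (Delta m E) :=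
  ⟨ustepIter m E n, meas_ustepIter n⟩

lemma lint_KI_zero (x : Delta m E) {φ : Delta m E → ℝ≥0∞} (hφ : Measurable φ) :
    ∫⁻ z, φ z ∂(ustepIter m E 0 x) = φ x := lintegral_dirac' _ hφ

lemma lint_KI_succ (n : ℕ) (x : Delta m E) {φ : Delta m E → ℝ≥0∞} (hφ : Measurable φ) :
    ∫⁻ z, φ z ∂(ustepIter m E (n + 1) x) = ∫⁻ y, ∫⁻ z, φ z ∂(ustepIter m E n y) ∂(ustep m E x) :=
  Measure.lintegral_bind (meas_ustepIter n).aemeasurable hφ.aemeasurable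

lemma meas_lint_KI (n : ℕ) {φ : Delta m E → ℝ≥0∞} (hφ : Measurable φ) :
    Measurable fun x => ∫⁻ z, φ z ∂(ustepIter m E n x) :=
  (Measure.measurable_lintegral hφ).comp (meas_ustepIter n)

lemma meas_lint_ustep {φ : Delta m E → ℝ≥0∞} (hφ : Measurable φ) :
    Measurable fun x => ∫⁻ z, φ z ∂(ustep m E x) :=
  (Measure.measurable_lintegral hφ).comp meas_ustep

lemma lint_KI_add (a b : ℕ) (x : Delta m E) {φ : Delta m E → ℝ≥0∞} (hφ : Measurable φ) :
    ∫⁻ z, φ z ∂(ustepIter m E (a + b) x) =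
      ∫⁻ y, ∫⁻ z, φ z ∂(ustepIter m E b y) ∂(ustepIter m E a x) := by
  induction a generalizing x with
  | zero => rw [lint_KI_zero x (meas_lint_KI b hφ), zero_add]
  | succ a ih =>
    rw [show a + 1 + b = (a + b) + 1 by ring, lint_KI_succ _ _ hφ, lint_KI_succ _ _ (meas_lint_KI b hφ)]
    exact lintegral_congr ih

lemma KI_prob (hm : 1 ≤ m) (hE : 0 < E) (n : ℕ) (x : Delta m E) :
    IsProbabilityMeasure (ustepIter m E n x) := by
  induction n generalizing x with
  | zero => exact Measure.dirac.isProbabilityMeasure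
  | succ n ih =>
    constructor
    have h := lint_KI_succ n x (φ := fun _ => 1) measurable_const
    have := ustep_prob hm hE x
    simpa using h

/-- Poisson weights -/
noncomputable def pw (m : ℕ) (E t : ℝ) (n : ℕ) : ℝ≥0∞ :=
  ENNReal.ofReal (Real.exp (-(Lam m E) * t) * ((Lam m E) * t) ^ n / n.factorial)

lemma Lam_nonneg : 0 ≤ Lam m E := Real.sqrt_nonneg _

lemma tsum_pw_pow {t : ℝ} (ht : 0 ≤ t) (a : ℝ) (ha : 0 ≤ a) :
    ∑' n, pw m E t n * ENNReal.ofReal (a ^ n) =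
      ENNReal.ofReal (Real.exp (-(Lam m E) * t) * Real.exp (Lam m E * t * a)) := by
  have hL : 0 ≤ Lam m E * t := mul_nonneg Lam_nonneg ht
  have e : ∀ n : ℕ, pw m E t n * ENNReal.ofReal (a ^ n) = ENNReal.ofReal
      (Real.exp (-(Lam m E) * t) * ((Lam m E * t * a) ^ n / n.factorial)) := by
    intro n
    unfold pw
    rw [← ENNReal.ofReal_mul (by positivity)]
    congr 1
    rw [mul_pow (Lam m E * t)]; ring
  simp only [e]
  have hs : HasSum (fun n : ℕ => (Lam m E * t * a) ^ n / n.factorial) (Real.exp (Lam m E * t * a)) := by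
    rw [Real.exp_eq_exp_ℝ]; exact NormedSpace.expSeries_div_hasSum_exp (Lam m E * t * a)
  have hs2 := hs.mul_left (Real.exp (-(Lam m E) * t))
  rw [← ENNReal.ofReal_tsum_of_nonneg (fun n => by positivity) hs2.summable, hs2.tsum_eq]

lemma tsum_pw {t : ℝ} (ht : 0 ≤ t) : ∑' n, pw m E t n = 1 := by
  have h := tsum_pw_pow (m := m) (E := E) ht 1 zero_le_one
  simpa [← Real.exp_add] using h

lemma lint_Pt (t : ℝ) (x : Delta m E) (φ : Delta m E → ℝ≥0∞) :
    ∫⁻ z, φ z ∂(Pt m E t x) = ∑' n, pw m E t n * ∫⁻ z, φ z ∂(ustepIter m E n x) := by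
  unfold Pt
  rw [lintegral_sum_measure]
  simp only [lintegral_smul_measure, smul_eq_mul, pw]

lemma meas_Pt (t : ℝ) : Measurable (Pt m E t) := by
  refine Measure.measurable_of_measurable_coe _ fun s hs => ?_
  have e : (fun x => Pt m E t x s) = fun x => ∑' n, pw m E t n * ustepIter m E n x s := by
    funext x
    unfold Pt
    rw [Measure.sum_apply _ hs]; rfl
  rw [e]
  exact Measurable.tsum fun n => ((Measure.measurable_coe hs).comp (meas_ustepIter n)).const_mul _

lemma Pt_prob (hm : 1 ≤ m) (hE : 0 < E) {t : ℝ} (ht : 0 ≤ t) (x : Delta m E) :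
    IsProbabilityMeasure (Pt m E t x) := by
  constructor
  have h := lint_Pt t x (fun _ => 1)
  have := fun n => KI_prob hm hE n x
  simpa [tsum_pw ht] using h

lemma pw_add (s t : ℝ) (hs : 0 ≤ s) (ht : 0 ≤ t) (n : ℕ) :
    ∑ p ∈ Finset.HasAntidiagonal.antidiagonal n, pw m E s p.1 * pw m E t p.2 = pw m E (s + t) n := by
  have hL := Lam_nonneg (m := m) (E := E)
  unfold pw
  have : ∀ p : ℕ × ℕ, ENNReal.ofReal (Real.exp (-Lam m E * s) * (Lam m E * s) ^ p.1 / p.1.factorial) *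
      ENNReal.ofReal (Real.exp (-Lam m E * t) * (Lam m E * t) ^ p.2 / p.2.factorial) =
      ENNReal.ofReal (Real.exp (-Lam m E * s) * (Lam m E * s) ^ p.1 / p.1.factorial *
        (Real.exp (-Lam m E * t) * (Lam m E * t) ^ p.2 / p.2.factorial)) := fun p =>
    (ENNReal.ofReal_mul (by positivity)).symm
  simp only [this]
  rw [← ENNReal.ofReal_sum_of_nonneg (fun p _ => by positivity)]
  congr 1
  have e1 : -Lam m E * (s + t) = -Lam m E * s + -Lam m E * t := by ring
  rw [e1, mul_add, Real.exp_add, Commute.add_pow' (Commute.all _ _), Finset.mul_sum, Finset.sum_div]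
  refine Finset.sum_congr rfl fun p hp => ?_
  have hp' := Finset.HasAntidiagonal.mem_antidiagonal.1 hp
  have h2 : (n.factorial : ℝ) = n.choose p.1 * p.1.factorial * p.2.factorial := by
    rw [← hp', ← Nat.add_choose_mul_factorial_mul_factorial p.1 p.2, Nat.choose_symm_add]; push_cast; ring
  have h3 : (0:ℝ) < n.choose p.1 := by
    exact_mod_cast Nat.choose_pos (by omega)
  rw [h2, nsmul_eq_mul]
  field_simp

lemma meas_lint_Pt (t : ℝ) {φ : Delta m E → ℝ≥0∞} (hφ : Measurable φ) :
    Measurable fun x => ∫⁻ z, φ z ∂(Pt m E t x) :=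
  (Measure.measurable_lintegral hφ).comp (meas_Pt t)

lemma lint_Pt_add {s t : ℝ} (hs : 0 ≤ s) (ht : 0 ≤ t) (x : Delta m E) {φ : Delta m E → ℝ≥0∞}
    (hφ : Measurable φ) :
    ∫⁻ z, φ z ∂(Pt m E (s + t) x) = ∫⁻ y, ∫⁻ z, φ z ∂(Pt m E t y) ∂(Pt m E s x) := by
  have e : ∀ y : Delta m E, ∫⁻ z, φ z ∂(Pt m E t y) = ∑' n, pw m E t n * ∫⁻ z, φ z ∂(ustepIter m E n y) :=
    fun y => lint_Pt t y φ
  simp only [e, lint_Pt]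
  have e2 : ∀ a : ℕ, ∫⁻ y, ∑' n, pw m E t n * ∫⁻ z, φ z ∂(ustepIter m E n y) ∂(ustepIter m E a x) =
      ∑' n, pw m E t n * ∫⁻ z, φ z ∂(ustepIter m E (a + n) x) := by
    intro a
    rw [lintegral_tsum fun n => ((meas_lint_KI n hφ).const_mul _).aemeasurable]
    refine tsum_congr fun n => ?_
    rw [lintegral_const_mul _ (meas_lint_KI n hφ), lint_KI_add a n x hφ]
  simp only [e2]
  have e3 : ∀ a : ℕ, pw m E s a * ∑' n, pw m E t n * ∫⁻ z, φ z ∂(ustepIter m E (a + n) x) =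
      ∑' n, pw m E s a * pw m E t n * ∫⁻ z, φ z ∂(ustepIter m E (a + n) x) := by
    intro a; rw [← ENNReal.tsum_mul_left]; simp only [mul_assoc]
  simp only [e3]
  rw [← ENNReal.tsum_prod (f := fun a n => pw m E s a * pw m E t n * ∫⁻ z, φ z ∂(ustepIter m E (a + n) x)),
    ← Finset.HasAntidiagonal.sigmaAntidiagonalEquivProd.tsum_eq, ENNReal.tsum_sigma']
  refine tsum_congr fun n => ?_
  rw [← pw_add s t hs ht, Finset.sum_mul, tsum_fintype, ← Finset.sum_coe_sort]
  refine Finset.sum_congr rfl fun p _ => ?_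
  have := Finset.HasAntidiagonal.mem_antidiagonal.1 p.2
  simp [Finset.HasAntidiagonal.sigmaAntidiagonalEquivProd, this]

lemma Pt_zero (x : Delta m E) {φ : Delta m E → ℝ≥0∞} (hφ : Measurable φ) :
    ∫⁻ z, φ z ∂(Pt m E 0 x) = φ x := by
  rw [lint_Pt, tsum_eq_single 0]
  · simp [pw, lint_KI_zero x hφ]
  · intro n hn
    simp [pw, hn]

/-- transition kernel -/
noncomputable def PK (m : ℕ) (E t : ℝ) : Kernel (Delta m E) (Delta m E) := ⟨Pt m E t, meas_Pt t⟩

lemma PK_apply (t : ℝ) (x : Delta m E) : PK m E t x = Pt m E t x := rfl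

lemma PK_markov (hm : 1 ≤ m) (hE : 0 < E) {t : ℝ} (ht : 0 ≤ t) : IsMarkovKernel (PK m E t) :=
  ⟨fun x => Pt_prob hm hE ht x⟩

end ECT

set_option linter.unusedSectionVars false
namespace ECT
open MeasureTheory ProbabilityTheory Filter Topology Set
open scoped ENNReal

variable {m : ℕ} {E : ℝ}

lemma simU_meas : MeasurableSet (simU m E) := by
  unfold simU
  refine MeasurableSet.inter (s₁ := {x : Fin m → ℝ | ∀ i, 0 < x i}) (s₂ := {x : Fin m → ℝ | ∑ i, x i < E}) ?_ ?_
  · rw [ofPred_forall]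
    exact MeasurableSet.iInter fun i => measurableSet_lt measurable_const (measurable_pi_apply i)
  · exact measurableSet_lt (by fun_prop) measurable_const

/-- ambient density -/
noncomputable def dw (E : ℝ) (x : Fin m → ℝ) : ℝ≥0∞ := ENNReal.ofReal ((E - ∑ i, x i) ^ (-(1/2) : ℝ))

lemma meas_dw : Measurable (dw (m := m) E) := by
  unfold dw
  exact ((measurable_const.sub (by fun_prop)).pow_const _).ennreal_ofReal

lemma lint_piPre {Φ : (Fin m → ℝ) → ℝ≥0∞} (hΦ : Measurable Φ) :
    ∫⁻ x, Φ x.1 ∂(piPre m E) = ∫⁻ x in simU m E, dw E x * Φ x := by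
  have h := lintegral_withDensity_eq_lintegral_mul (lebU m E)
    (show Measurable fun x : Delta m E => dw E x.1 from meas_dw.comp measurable_subtype_coe)
    (hΦ.comp measurable_subtype_coe)
  refine h.trans ?_
  exact lintegral_subtype_comap simU_meas (fun x => dw E x * Φ x)

/-- extension by zero to the ambient space -/
noncomputable def ext2 (H : Delta m E × Delta m E → ℝ≥0∞) : (Fin m → ℝ) × (Fin m → ℝ) → ℝ≥0∞ :=
  Function.extend (Prod.map Subtype.val Subtype.val) H 0

lemma emb2 : MeasurableEmbedding (Prod.map (Subtype.val : Delta m E → _) (Subtype.val : Delta m E → _)) :=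
  (MeasurableEmbedding.subtype_coe simU_meas).prodMap (MeasurableEmbedding.subtype_coe simU_meas)

lemma meas_ext2 {H : Delta m E × Delta m E → ℝ≥0∞} (hH : Measurable H) : Measurable (ext2 H) :=
  emb2.measurable_extend hH measurable_const

lemma ext2_val (H : Delta m E × Delta m E → ℝ≥0∞) (x z : Delta m E) : ext2 H (x.1, z.1) = H (x, z) :=
  emb2.injective.extend_apply H 0 (x, z)

lemma ext2_zero (H : Delta m E × Delta m E → ℝ≥0∞) {x z : Fin m → ℝ}
    (h : ¬ (x ∈ simU m E ∧ z ∈ simU m E)) : ext2 H (x, z) = 0 := by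
  refine Function.extend_apply' _ _ _ ?_
  rintro ⟨⟨a, b⟩, hab⟩
  simp only [Prod.map_apply, Prod.mk.injEq] at hab
  exact h ⟨hab.1 ▸ a.2, hab.2 ▸ b.2⟩

open Classical in
/-- symmetric exchange density -/
noncomputable def GG (i : Fin m) (H : Delta m E × Delta m E → ℝ≥0∞) (x : Fin m → ℝ) (t : ℝ) : ℝ≥0∞ :=
  if E < ∑ j, x j + t then
    ext2 H (x, Function.update x i t) * (dw E x * dw E (Function.update x i t) * ENNReal.ofReal (1/2))
  else 0

lemma meas_upd (i : Fin m) : Measurable fun p : (Fin m → ℝ) × ℝ => Function.update p.1 i p.2 :=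
  measurable_update'

lemma meas_GG (i : Fin m) {H : Delta m E × Delta m E → ℝ≥0∞} (hH : Measurable H) :
    Measurable (Function.uncurry (GG i H)) := by
  unfold GG Function.uncurry
  refine Measurable.ite (measurableSet_lt measurable_const (by fun_prop)) ?_ measurable_const
  exact ((meas_ext2 hH).comp (measurable_fst.prodMk (meas_upd i))).mul
    (((meas_dw.comp measurable_fst).mul (meas_dw.comp (meas_upd i))).mul_const _)

lemma sum_upd (x : Fin m → ℝ) (i : Fin m) (t : ℝ) :
    ∑ j, Function.update x i t j = ∑ j, x j - x i + t := by
  rw [Finset.sum_update_of_mem (Finset.mem_univ i), ← Finset.erase_eq,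
    Finset.sum_erase_eq_sub (Finset.mem_univ i)]
  ring

lemma exch_amb (i : Fin m) {H : Delta m E × Delta m E → ℝ≥0∞} (hH : Measurable H) :
    ∫⁻ x, ENNReal.ofReal (√(x.1 i)) * (∫⁻ u in Ioo (0:ℝ) 1, H (x, Texch m E i u x)) ∂(piPre m E) =
      ∫⁻ x, ∫⁻ t, GG i H x t := by
  have mB : Measurable fun p : (Fin m → ℝ) × ℝ => (Ioo (E - ∑ j, p.1 j) (p.1 i + (E - ∑ j, p.1 j))).indicator
      (fun t => ext2 H (p.1, Function.update p.1 i t) *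
        ENNReal.ofReal (1 / (2 * √(p.1 i + (E - ∑ j, p.1 j) - t)))) p.2 := by
    have hs : MeasurableSet {p : (Fin m → ℝ) × ℝ | p.2 ∈ Ioo (E - ∑ j, p.1 j) (p.1 i + (E - ∑ j, p.1 j))} :=
      (measurableSet_lt (f := fun p : (Fin m → ℝ) × ℝ => E - ∑ j, p.1 j) (g := fun p => p.2)
        (by fun_prop) (by fun_prop)).inter (measurableSet_lt (f := fun p : (Fin m → ℝ) × ℝ => p.2)
        (g := fun p => p.1 i + (E - ∑ j, p.1 j)) (by fun_prop) (by fun_prop))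
    have hh : Measurable fun p : (Fin m → ℝ) × ℝ => ext2 H (p.1, Function.update p.1 i p.2) *
        ENNReal.ofReal (1 / (2 * √(p.1 i + (E - ∑ j, p.1 j) - p.2))) :=
      ((meas_ext2 hH).comp (measurable_fst.prodMk (meas_upd i))).mul (by fun_prop)
    exact hh.indicator hs
  set Φ : (Fin m → ℝ) → ℝ≥0∞ := fun x => ∫⁻ t, (Ioo (E - ∑ j, x j) (x i + (E - ∑ j, x j))).indicator
      (fun t => ext2 H (x, Function.update x i t) *
        ENNReal.ofReal (1 / (2 * √(x i + (E - ∑ j, x j) - t)))) t with hΦ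
  have mΦ : Measurable Φ := Measurable.lintegral_prod_right' mB
  have e1 : ∀ x : Delta m E, ENNReal.ofReal (√(x.1 i)) * ∫⁻ u in Ioo (0:ℝ) 1, H (x, Texch m E i u x) =
      Φ x.1 := by
    intro x
    have h := cov1 (x.1 i) (x.1 i + (E - ∑ j, x.1 j)) (x.2.1 i)
      (fun t => ext2 H (x.1, Function.update x.1 i t))
    rw [add_sub_cancel_left] at h
    rw [hΦ]
    beta_reduce
    rw [lintegral_indicator measurableSet_Ioo, ← h]
    congr 1
    refine setLIntegral_congr_fun measurableSet_Ioo fun u hu => ?_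
    rw [← ext2_val H]
    congr 2
    simp only [Texch, hu, dite_true, T0]
    congr 1
    ring
  rw [lintegral_congr e1, lint_piPre mΦ, ← lintegral_indicator simU_meas]
  refine lintegral_congr fun x => ?_
  by_cases hx : x ∈ simU m E
  · rw [indicator_of_mem hx, hΦ]
    beta_reduce
    rw [← lintegral_const_mul]
    · refine lintegral_congr fun t => ?_
      unfold GG
      by_cases hu : Function.update x i t ∈ simU m E
      · have h2 := hu.2
        rw [sum_upd] at h2
        by_cases hc : E < ∑ j, x j + t
        · rw [if_pos hc, indicator_of_mem (show t ∈ Ioo _ _ from ⟨by linarith, by linarith⟩), mul_left_comm]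
          congr 1
          rw [mul_assoc]
          congr 1
          unfold dw
          rw [← ENNReal.ofReal_mul (Real.rpow_nonneg (by rw [sum_upd]; linarith) _), sum_upd]
          have : x i + (E - ∑ j, x j) - t = E - (∑ j, x j - x i + t) := by ring
          rw [this, Real.rpow_neg (by linarith), ← Real.sqrt_eq_rpow]
          congr 1
          rw [one_div, mul_inv]; ring
        · rw [if_neg hc, indicator_of_notMem, mul_zero]
          intro h; exact hc (by linarith [h.1])
      · rw [ext2_zero H (fun h => hu h.2)]
        simp only [zero_mul, ite_self]
        rw [mul_eq_zero]; right
        rw [indicator_apply]; split_ifs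
        · rw [ext2_zero H (fun h => hu h.2), zero_mul]
        · rfl
    · exact mB.comp (measurable_const.prodMk measurable_id)
  · rw [indicator_of_notMem hx]
    symm
    rw [lintegral_eq_zero_of_ae_eq_zero]
    refine ae_of_all _ fun t => ?_
    simp [GG, ext2_zero H (fun h => hx h.1)]

lemma ext2_swap (H : Delta m E × Delta m E → ℝ≥0∞) (x z : Fin m → ℝ) :
    ext2 (fun p => H p.swap) (x, z) = ext2 H (z, x) := by
  by_cases h : x ∈ simU m E ∧ z ∈ simU m E
  · have h1 := ext2_val (fun p => H p.swap) ⟨x, h.1⟩ ⟨z, h.2⟩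
    have h2 := ext2_val H ⟨z, h.2⟩ ⟨x, h.1⟩
    exact h1.trans h2.symm
  · rw [ext2_zero _ h, ext2_zero _ (fun h' => h h'.symm)]

lemma exch_symm (i : Fin m) {H : Delta m E × Delta m E → ℝ≥0∞} (hH : Measurable H) :
    ∫⁻ x, ENNReal.ofReal (√(x.1 i)) * (∫⁻ u in Ioo (0:ℝ) 1, H (x, Texch m E i u x)) ∂(piPre m E) =
    ∫⁻ x, ENNReal.ofReal (√(x.1 i)) * (∫⁻ u in Ioo (0:ℝ) 1, H (Texch m E i u x, x)) ∂(piPre m E) := by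
  have h2 := exch_amb i (H := fun p => H p.swap) (hH.comp measurable_swap)
  simp only [Prod.swap_prod_mk] at h2
  rw [h2, exch_amb i hH, swap_lint i _ (meas_GG i hH)]
  refine lintegral_congr fun x => lintegral_congr fun t => ?_
  unfold GG
  rw [sum_upd, Function.update_idem, Function.update_eq_self, ext2_swap, mul_comm (dw E x)]
  congr 1
  rw [eq_iff_iff]
  constructor <;> intro h <;> linarith

def LSym {S : Type} [MeasurableSpace S] (κ : S → Measure S) (ν : Measure S) : Prop :=
  ∀ φ ψ : S → ℝ≥0∞, Measurable φ → Measurable ψ →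
    ∫⁻ x, φ x * ∫⁻ z, ψ z ∂(κ x) ∂ν = ∫⁻ x, (∫⁻ z, φ z ∂(κ x)) * ψ x ∂ν

lemma meas_lint_T (i : Fin m) {φ : Delta m E → ℝ≥0∞} (hφ : Measurable φ) :
    Measurable fun x : Delta m E => ENNReal.ofReal (√(x.1 i)) * ∫⁻ u in Ioo (0:ℝ) 1, φ (Texch m E i u x) :=
  (meas_coord i).sqrt.ennreal_ofReal.mul (Measurable.lintegral_prod_left' (f := fun p : ℝ × Delta m E =>
      φ (Texch m E i p.1 p.2)) (hφ.comp (meas_Texch i)))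

lemma meas_stay : Measurable fun x : Delta m E => ENNReal.ofReal (1 - jumpRate m E x / Lam m E) := by
  unfold jumpRate
  exact (measurable_const.sub ((Finset.measurable_fun_sum _ fun j _ =>
      (meas_coord j).sqrt).div_const _)).ennreal_ofReal

lemma lsym_ustep : LSym (ustep m E) (piPre m E) := by
  intro φ ψ hφ hψ
  have key : ∀ φ ψ : Delta m E → ℝ≥0∞, Measurable φ → Measurable ψ →
      ∫⁻ x, φ x * ∫⁻ z, ψ z ∂(ustep m E x) ∂(piPre m E) =
      ∫⁻ x, φ x * ψ x * ENNReal.ofReal (1 - jumpRate m E x / Lam m E) ∂(piPre m E) +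
        (ENNReal.ofReal (Lam m E))⁻¹ * ∑ i, ∫⁻ x, ENNReal.ofReal (√(x.1 i)) *
          (∫⁻ u in Ioo (0:ℝ) 1, φ x * ψ (Texch m E i u x)) ∂(piPre m E) := by
    intro φ ψ hφ hψ
    have hI : ∀ i : Fin m, Measurable fun x : Delta m E =>
        φ x * (ENNReal.ofReal (√(x.1 i)) * ∫⁻ u in Ioo (0:ℝ) 1, ψ (Texch m E i u x)) := fun i =>
      hφ.mul (meas_lint_T i hψ)
    have e2 : ∀ i : Fin m, ∫⁻ x, ENNReal.ofReal (√(x.1 i)) *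
          (∫⁻ u in Ioo (0:ℝ) 1, φ x * ψ (Texch m E i u x)) ∂(piPre m E) =
        ∫⁻ x, φ x * (ENNReal.ofReal (√(x.1 i)) * (∫⁻ u in Ioo (0:ℝ) 1, ψ (Texch m E i u x))) ∂(piPre m E) := by
      intro i
      refine lintegral_congr fun x => ?_
      have hx : Measurable fun u => ψ (Texch m E i u x) := hψ.comp (meas_Texch' i x)
      rw [lintegral_const_mul _ hx, mul_left_comm]
    simp only [e2]
    have h0 : Measurable fun x : Delta m E => φ x * ψ x * ENNReal.ofReal (1 - jumpRate m E x / Lam m E) :=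
      (hφ.mul hψ).mul meas_stay
    rw [← lintegral_finsetSum _ (fun i _ => hI i), ← lintegral_const_mul _ (Finset.measurable_fun_sum _ fun i _ => hI i),
      ← lintegral_add_left h0]
    refine lintegral_congr fun x => ?_
    rw [lint_ustep x hψ, ← Finset.mul_sum]
    ring
  have e : ∫⁻ x, (∫⁻ z, φ z ∂(ustep m E x)) * ψ x ∂(piPre m E) =
      ∫⁻ x, ψ x * (∫⁻ z, φ z ∂(ustep m E x)) ∂(piPre m E) := lintegral_congr fun x => mul_comm _ _
  rw [e, key φ ψ hφ hψ, key ψ φ hψ hφ]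
  congr 1
  · exact lintegral_congr fun x => by ring
  · congr 1
    refine Finset.sum_congr rfl fun i _ => ?_
    rw [exch_symm i (H := fun p => φ p.1 * ψ p.2) ((hφ.comp measurable_fst).mul (hψ.comp measurable_snd))]
    simp only [mul_comm]

lemma lsym_KI (n : ℕ) : LSym (ustepIter m E n) (piPre m E) := by
  induction n with
  | zero =>
    intro φ ψ hφ hψ
    simp only [lint_KI_zero _ hφ, lint_KI_zero _ hψ]
  | succ n ih =>
    intro φ ψ hφ hψ
    have e : ∀ x : Delta m E, ∫⁻ z, φ z ∂(ustepIter m E (n + 1) x) =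
        ∫⁻ y, ∫⁻ z, φ z ∂(ustep m E y) ∂(ustepIter m E n x) := by
      intro x
      rw [lint_KI_add n 1 x hφ]
      refine lintegral_congr fun y => ?_
      rw [show 1 = 0 + 1 from rfl, lint_KI_succ 0 y hφ]
      exact lintegral_congr fun z => lint_KI_zero z hφ
    simp only [e]
    rw [← ih _ _ (meas_lint_ustep hφ) hψ, ← lsym_ustep _ _ hφ (meas_lint_KI n hψ)]
    exact lintegral_congr fun x => by rw [lint_KI_succ n x hψ]

lemma lsym_Pt_pre (t : ℝ) : LSym (Pt m E t) (piPre m E) := by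
  intro φ ψ hφ hψ
  simp only [lint_Pt]
  have e1 : ∀ x : Delta m E, φ x * ∑' n, pw m E t n * ∫⁻ z, ψ z ∂(ustepIter m E n x) =
      ∑' n, pw m E t n * (φ x * ∫⁻ z, ψ z ∂(ustepIter m E n x)) := by
    intro x
    rw [← ENNReal.tsum_mul_left]; exact tsum_congr fun n => by ring
  have e2 : ∀ x : Delta m E, (∑' n, pw m E t n * ∫⁻ z, φ z ∂(ustepIter m E n x)) * ψ x =
      ∑' n, pw m E t n * ((∫⁻ z, φ z ∂(ustepIter m E n x)) * ψ x) := by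
    intro x
    rw [← ENNReal.tsum_mul_right]; exact tsum_congr fun n => by ring
  simp only [e1, e2]
  have m1 : ∀ n, Measurable fun x : Delta m E => φ x * ∫⁻ z, ψ z ∂(ustepIter m E n x) := fun n =>
    hφ.mul (meas_lint_KI n hψ)
  have m2 : ∀ n, Measurable fun x : Delta m E => (∫⁻ z, φ z ∂(ustepIter m E n x)) * ψ x := fun n =>
    (meas_lint_KI n hφ).mul hψ
  rw [lintegral_tsum fun n => ((m1 n).const_mul _).aemeasurable,
    lintegral_tsum fun n => ((m2 n).const_mul _).aemeasurable]
  refine tsum_congr fun n => ?_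
  rw [lintegral_const_mul _ (m1 n), lintegral_const_mul _ (m2 n), lsym_KI n φ ψ hφ hψ]

lemma lsym_Pt (t : ℝ) : LSym (Pt m E t) (piMeasure m E) := by
  intro φ ψ hφ hψ
  unfold piMeasure
  rw [lintegral_smul_measure, lintegral_smul_measure, lsym_Pt_pre t φ ψ hφ hψ]

end ECT

set_option linter.unusedSectionVars false
namespace ECT
open MeasureTheory ProbabilityTheory Filter Topology Set
open scoped ENNReal

section gen
variable {S : Type} [MeasurableSpace S] {Q : Kernel S S} [IsMarkovKernel Q] {ν : Measure S}
  [IsFiniteMeasure ν]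

lemma ofReal_op {ψ : S → ℝ} (hψ : BM ψ) (h0 : ∀ x, 0 ≤ ψ x) (x : S) :
    ENNReal.ofReal (op Q ψ x) = ∫⁻ z, ENNReal.ofReal (ψ z) ∂(Q x) :=
  ofReal_integral_eq_lintegral_ofReal (hψ.integrable _) (ae_of_all _ h0)

lemma rev_nonneg (h : LSym (fun x => Q x) ν) {φ ψ : S → ℝ} (hφ : BM φ) (hψ : BM ψ)
    (h0 : ∀ x, 0 ≤ φ x) (h1 : ∀ x, 0 ≤ ψ x) :
    ∫ x, φ x * op Q ψ x ∂ν = ∫ x, op Q φ x * ψ x ∂ν := by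
  have n1 : ∀ x, 0 ≤ op Q φ x := fun x => integral_nonneg h0
  have n2 : ∀ x, 0 ≤ op Q ψ x := fun x => integral_nonneg h1
  rw [integral_eq_lintegral_of_nonneg_ae (ae_of_all _ fun x => mul_nonneg (h0 x) (n2 x))
      (hφ.mul hψ.op).meas.aestronglyMeasurable,
    integral_eq_lintegral_of_nonneg_ae (ae_of_all _ fun x => mul_nonneg (n1 x) (h1 x))
      (hφ.op.mul hψ).meas.aestronglyMeasurable]
  congr 1
  have := h (fun x => ENNReal.ofReal (φ x)) (fun x => ENNReal.ofReal (ψ x)) hφ.meas.ennreal_ofReal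
    hψ.meas.ennreal_ofReal
  simp only [← ofReal_op hφ h0, ← ofReal_op hψ h1] at this
  simpa only [ENNReal.ofReal_mul (h0 _), ENNReal.ofReal_mul (n1 _)] using this

lemma rev_of_lsym (h : LSym (fun x => Q x) ν) : Rev Q ν := by
  have shift : ∀ φ : S → ℝ, BM φ → ∃ C, BM (fun x => φ x + C) ∧ ∀ x, 0 ≤ φ x + C := by
    intro φ hφ
    obtain ⟨C, hC⟩ := hφ.bdd
    exact ⟨C, hφ.add (BM.const C), fun x => by have := (abs_le.1 (hC x)).1; linarith⟩
  have inv : ∀ φ : S → ℝ, BM φ → ∫ x, op Q φ x ∂ν = ∫ x, φ x ∂ν := by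
    intro φ hφ
    obtain ⟨C, hC, hC0⟩ := shift φ hφ
    have := rev_nonneg h (BM.const 1) hC (fun _ => zero_le_one) hC0
    rw [op_const, op_add hφ (BM.const C), op_const] at this
    simp only [one_mul] at this
    rw [integral_add (hφ.op.integrable _) ((BM.const C).integrable _),
      integral_add (hφ.integrable _) ((BM.const C).integrable _)] at this
    linarith
  intro φ ψ hφ hψ
  obtain ⟨C, hC, hC0⟩ := shift φ hφ
  obtain ⟨D, hD, hD0⟩ := shift ψ hψ
  have := rev_nonneg h hC hD hC0 hD0
  rw [op_add hφ (BM.const C), op_const, op_add hψ (BM.const D), op_const] at this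
  have e1 : ∀ a b : S → ℝ, BM a → BM b → ∫ x, (a x + C) * (b x + D) ∂ν =
      ∫ x, a x * b x ∂ν + D * ∫ x, a x ∂ν + C * ∫ x, b x ∂ν + ∫ x, C * D ∂ν := by
    intro a b ha hb
    have e : ∀ x, (a x + C) * (b x + D) = a x * b x + D * a x + C * b x + C * D := fun x => by ring
    simp only [e]
    rw [integral_add, integral_add, integral_add, integral_const_mul, integral_const_mul]
    · exact (ha.mul hb).integrable _
    · exact (ha.integrable _).const_mul _
    · exact ((ha.mul hb).integrable _).add ((ha.integrable _).const_mul _)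
    · exact (hb.integrable _).const_mul _
    · exact (((ha.mul hb).integrable _).add ((ha.integrable _).const_mul _)).add ((hb.integrable _).const_mul _)
    · exact (BM.const _).integrable _
  rw [e1 _ _ hφ hψ.op, e1 _ _ hφ.op hψ, inv φ hφ, inv ψ hψ] at this
  linarith
end gen

variable {m : ℕ} {E : ℝ}

lemma piPre_univ : piPre m E univ = ∫⁻ x in simU m E, dw E x := by
  have := lint_piPre (m := m) (E := E) (Φ := fun _ => 1) measurable_const
  simpa using this

lemma piPre_lt_top (hm : 1 ≤ m) (hE : 0 < E) : piPre m E univ < ∞ := by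
  obtain ⟨n, rfl⟩ : ∃ n, m = n + 1 := ⟨m - 1, by omega⟩
  rw [piPre_univ, ← lintegral_indicator simU_meas, lint_ins 0 _ (meas_dw.indicator simU_meas)]
  have mI : Measurable fun p : ℝ × (Fin n → ℝ) => (simU (n+1) E).indicator (dw E)
      ((0 : Fin (n+1)).insertNth p.1 p.2) :=
    (meas_dw.indicator simU_meas).comp
      (MeasurableEquiv.piFinSuccAbove (fun _ : Fin (n + 1) => ℝ) 0).symm.measurable
  rw [lintegral_lintegral_swap mI.aemeasurable]
  have hb : ∀ r : Fin n → ℝ, ∫⁻ a : ℝ, (simU (n+1) E).indicator (dw E) ((0 : Fin (n+1)).insertNth a r) ≤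
      (Set.pi univ fun _ : Fin n => Icc (0:ℝ) E).indicator (fun _ => 2 * ENNReal.ofReal (√E)) r := by
    intro r
    set s := E - ∑ j, r j with hs
    by_cases hr : ∀ j, 0 < r j
    swap
    · rw [lintegral_eq_zero_of_ae_eq_zero]; · exact zero_le
      refine ae_of_all _ fun a => indicator_of_notMem (fun h => hr fun j => ?_) _
      have := h.1 ((0 : Fin (n+1)).succAbove j)
      rwa [Fin.insertNth_apply_succAbove] at this
    by_cases hs0 : 0 < s
    swap
    · rw [lintegral_eq_zero_of_ae_eq_zero]; · exact zero_le
      refine ae_of_all _ fun a => indicator_of_notMem (fun h => hs0 ?_) _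
      have h1 := h.1 0
      have h2 := h.2
      rw [Fin.sum_univ_succAbove _ 0] at h2
      simp only [Fin.insertNth_apply_succAbove, Fin.insertNth_apply_same] at h2 h1
      linarith
    have hbox : r ∈ Set.pi univ fun _ : Fin n => Icc (0:ℝ) E := by
      intro j _
      have := Finset.single_le_sum (f := r) (fun i _ => (hr i).le) (Finset.mem_univ j)
      exact ⟨(hr j).le, by linarith⟩
    rw [indicator_of_mem hbox]
    have h := cov1 s s hs0 (fun _ => 2)
    rw [sub_self] at h
    have hsum : 0 ≤ ∑ j, r j := Finset.sum_nonneg fun j _ => (hr j).le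
    calc _ ≤ ∫⁻ a in Ioo 0 s, 2 * ENNReal.ofReal (1 / (2 * √(s - a))) := by
          rw [← lintegral_indicator measurableSet_Ioo]
          refine lintegral_mono fun a => ?_
          by_cases ha : (0 : Fin (n+1)).insertNth a r ∈ simU (n+1) E
          · rw [indicator_of_mem ha]
            have h1 := ha.1 0
            have h2 := ha.2
            rw [Fin.sum_univ_succAbove _ 0] at h2
            simp only [Fin.insertNth_apply_succAbove, Fin.insertNth_apply_same] at h2 h1
            rw [indicator_of_mem (show a ∈ Ioo 0 s from ⟨h1, by linarith⟩)]
            unfold dw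
            rw [Fin.sum_univ_succAbove _ 0]
            simp only [Fin.insertNth_apply_succAbove, Fin.insertNth_apply_same]
            rw [show (2:ℝ≥0∞) = ENNReal.ofReal 2 by simp, ← ENNReal.ofReal_mul (by norm_num)]
            apply le_of_eq
            congr 1
            rw [show E - (a + ∑ j, r j) = s - a by rw [hs]; ring, Real.rpow_neg (by linarith),
              ← Real.sqrt_eq_rpow, one_div, mul_inv]
            ring
          · rw [indicator_of_notMem ha]; exact zero_le
      _ = ENNReal.ofReal √s * 2 := by rw [← h]; simp
      _ ≤ 2 * ENNReal.ofReal (√E) := by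
          rw [mul_comm]
          gcongr
          linarith
  refine (lintegral_mono hb).trans_lt ?_
  rw [lintegral_indicator (MeasurableSet.univ_pi fun _ => measurableSet_Icc), setLIntegral_const]
  refine ENNReal.mul_lt_top (by finiteness) ?_
  rw [volume_pi_pi]
  exact ENNReal.prod_lt_top fun i _ => by simp

lemma simU_open : IsOpen (simU m E) := by
  unfold simU
  refine IsOpen.inter (s := {x : Fin m → ℝ | ∀ i, 0 < x i}) (t := {x : Fin m → ℝ | ∑ i, x i < E}) ?_ ?_
  · rw [ofPred_forall]
    exact isOpen_iInter_of_finite fun i => isOpen_lt continuous_const (continuous_apply i)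
  · exact isOpen_lt (by fun_prop) continuous_const

lemma simU_nonempty (hE : 0 < E) : (simU m E).Nonempty := by
  refine ⟨fun _ => E / (m + 1), fun i => by positivity, ?_⟩
  simp only [Finset.sum_const, Finset.card_univ, Fintype.card_fin, nsmul_eq_mul]
  rw [← mul_div_assoc, div_lt_iff₀ (by positivity)]
  nlinarith

lemma dw_pos {x : Fin m → ℝ} (hx : x ∈ simU m E) : dw E x ≠ 0 := by
  unfold dw
  rw [ENNReal.ofReal_ne_zero_iff]
  exact Real.rpow_pos_of_pos (sub_pos.2 hx.2) _

lemma piPre_pos (hE : 0 < E) : piPre m E univ ≠ 0 := by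
  rw [piPre_univ]
  intro h
  rw [lintegral_eq_zero_iff meas_dw, Filter.EventuallyEq, ae_restrict_iff' simU_meas] at h
  have : volume (simU m E) = 0 := by
    refine measure_mono_null (fun x hx => ?_) h
    exact fun h' => dw_pos hx (h' hx)
  exact (simU_open.measure_pos volume (simU_nonempty hE)).ne' this

lemma pi_prob (hm : 1 ≤ m) (hE : 0 < E) : IsProbabilityMeasure (piMeasure m E) := by
  constructor
  unfold piMeasure
  rw [Measure.smul_apply, smul_eq_mul]
  exact ENNReal.inv_mul_cancel (piPre_pos hE) (piPre_lt_top hm hE).ne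

lemma pi_null (hm : 1 ≤ m) (hE : 0 < E) {A : Set (Delta m E)} : piMeasure m E A = 0 ↔ piPre m E A = 0 := by
  unfold piMeasure
  rw [Measure.smul_apply, smul_eq_mul, mul_eq_zero, ENNReal.inv_eq_zero]
  simp [(piPre_lt_top hm hE).ne]

lemma rev_PK (hm : 1 ≤ m) (hE : 0 < E) {t : ℝ} (ht : 0 ≤ t) : Rev (PK m E t) (piMeasure m E) := by
  have := PK_markov hm hE ht
  have := pi_prob hm hE
  exact rev_of_lsym (lsym_Pt t)

lemma op_PK_add (hm : 1 ≤ m) (hE : 0 < E) {s t : ℝ} (hs : 0 ≤ s) (ht : 0 ≤ t) {φ : Delta m E → ℝ}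
    (hφ : BM φ) : op (PK m E (s + t)) φ = op (PK m E s) (op (PK m E t) φ) := by
  have := PK_markov hm hE hs
  have := PK_markov hm hE ht
  have := PK_markov hm hE (add_nonneg hs ht)
  obtain ⟨C, hC⟩ := hφ.bdd
  have h1 : BM (fun x => φ x + C) := hφ.add (BM.const C)
  have h0 : ∀ x, 0 ≤ φ x + C := fun x => by have := (abs_le.1 (hC x)).1; linarith
  have n1 : ∀ t' x, 0 ≤ op (PK m E t') (fun x => φ x + C) x := fun _ x => integral_nonneg h0
  have key : op (PK m E (s + t)) (fun x => φ x + C) = op (PK m E s) (op (PK m E t) (fun x => φ x + C)) := by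
    funext x
    rw [← ENNReal.ofReal_eq_ofReal_iff (n1 _ x) (show 0 ≤ op (PK m E s) (op (PK m E t) (fun x => φ x + C)) x from integral_nonneg (n1 t)), ofReal_op h1 h0,
      ofReal_op h1.op (n1 t)]
    simp only [ofReal_op h1 h0]
    exact lint_Pt_add hs ht x h1.meas.ennreal_ofReal
  rw [op_add hφ (BM.const C), op_add hφ (BM.const C), op_const, op_const, op_add hφ.op (BM.const C), op_const] at key
  funext x
  have := congrFun key x
  simpa using this

lemma op_PK_iter (hm : 1 ≤ m) (hE : 0 < E) {δ : ℝ} (hδ : 0 ≤ δ) {φ : Delta m E → ℝ}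
    (hφ : BM φ) (n : ℕ) : (op (PK m E δ))^[n] φ = op (PK m E (n * δ)) φ := by
  have := PK_markov hm hE hδ
  induction n with
  | zero =>
    have := PK_markov hm hE le_rfl
    have e : ((0:ℕ):ℝ) * δ = 0 := by simp
    rw [e]
    funext x
    have : PK m E 0 x = Measure.dirac x := by
      ext s hs
      have h := Pt_zero x (φ := s.indicator (fun _ => 1)) (measurable_const.indicator hs)
      rw [lintegral_indicator hs] at h
      rw [Measure.dirac_apply' _ hs, PK_apply]
      simpa [Pi.one_def] using h
    simp only [op, this]
    rw [integral_dirac' _ _ hφ.meas.stronglyMeasurable]; rfl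
  | succ n ih =>
    rw [Function.iterate_succ_apply', ih, ← op_PK_add hm hE hδ (by positivity) hφ]
    congr 2; push_cast; ring

end ECT

set_option linter.unusedSectionVars false
namespace ECT
open MeasureTheory ProbabilityTheory Filter Topology Set
open scoped ENNReal

lemma upd_ae {m : ℕ} (i : Fin m) {P : (Fin m → ℝ) → Prop} (h : ∀ᵐ x, P x) :
    ∀ᵐ x : Fin m → ℝ, ∀ᵐ t : ℝ, P (Function.update x i t) := by
  obtain ⟨N, hN, mN, h0⟩ := exists_measurable_superset_of_null (ae_iff.1 h)
  have mI : Measurable (N.indicator (fun _ => (1:ℝ≥0∞))) := measurable_const.indicator mN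
  have h1 := swap_lint i (fun x _ => N.indicator (fun _ => (1:ℝ≥0∞)) x) (mI.comp measurable_fst)
  have h2 : ∫⁻ x, ∫⁻ _ : ℝ, N.indicator (fun _ => (1:ℝ≥0∞)) x = 0 := by
    refine lintegral_eq_zero_of_ae_eq_zero ?_
    filter_upwards [measure_eq_zero_iff_ae_notMem.1 h0] with x hx
    simp [hx]
  rw [h2] at h1
  have mU : Measurable fun p : (Fin m → ℝ) × ℝ => N.indicator (fun _ => (1:ℝ≥0∞)) (Function.update p.1 i p.2) :=
    mI.comp (meas_upd i)
  have h3 := (lintegral_eq_zero_iff mU.lintegral_prod_right').1 h1.symm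
  filter_upwards [h3] with x hx
  have h4 := (lintegral_eq_zero_iff (mU.comp (measurable_const.prodMk measurable_id))).1 hx
  filter_upwards [h4] with t ht
  by_contra hP
  have : Function.update x i t ∈ N := hN hP
  simp [this] at ht

lemma mix_ae {m : ℕ} (J : Finset (Fin m)) {P : (Fin m → ℝ) → Prop} (h : ∀ᵐ x, P x) :
    ∀ᵐ x : Fin m → ℝ, ∀ᵐ z : Fin m → ℝ, P (J.piecewise z x) := by
  have h1 : Measure.QuasiMeasurePreserving (fun p : (Fin m → ℝ) × (Fin m → ℝ) => J.piecewise p.2 p.1)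
      (volume.prod volume) volume := by
    have e1 := (volume_measurePreserving_arrowProdEquivProdArrow ℝ ℝ (Fin m)).symm
    have e2 : MeasurePreserving (fun (f : Fin m → ℝ × ℝ) i => if i ∈ J then (f i).swap else f i)
        volume volume :=
      volume_preserving_pi (f := fun i => fun p : ℝ × ℝ => if i ∈ J then p.swap else p) (fun i => by
        by_cases hi : i ∈ J
        · simp only [hi, if_true]; exact Measure.measurePreserving_swap
        · simp only [hi, if_false]; exact MeasurePreserving.id _)
    have e3 := (volume_measurePreserving_arrowProdEquivProdArrow ℝ ℝ (Fin m))
    have e4 := Measure.quasiMeasurePreserving_fst.comp (e3.comp (e2.comp e1)).quasiMeasurePreserving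
    refine Eq.mp ?_ e4
    congr 1
    funext p
    funext i
    symm
    simp only [Function.comp, Finset.piecewise]
    change _ = (if i ∈ J then ((p.1 i, p.2 i) : ℝ × ℝ).swap else (p.1 i, p.2 i)).1
    split_ifs <;> rfl
  exact Measure.ae_ae_of_ae_prod (h1.ae h)

variable {m : ℕ} {E : ℝ}

lemma irr_sq {S : Type} [MeasurableSpace S] {R : Kernel S S} [IsMarkovKernel R] {ν : Measure S}
    [IsProbabilityMeasure ν] (hr : Rev R ν) {h : S → ℝ} (hh : BM h) (he : ∀ᵐ x ∂ν, op R h x = h x) :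
    ∀ᵐ x ∂ν, ∫⁻ z, ENNReal.ofReal ((h x - h z) ^ 2) ∂(R x) = 0 := by
  have hsq : BM (fun x => h x * h x) := hh.mul hh
  have e : ∀ x, ∫ z, (h x - h z) ^ 2 ∂(R x) = h x * h x - 2 * h x * op R h x + op R (fun x => h x * h x) x := by
    intro x
    have e1 : ∀ z, (h x - h z) ^ 2 = h x * h x - 2 * h x * h z + h z * h z := fun z => by ring
    simp only [e1]
    rw [integral_add, integral_sub, integral_const_mul]
    · simp [op, integral_const_mul]
    · exact (BM.const _).integrable _
    · exact (hh.integrable _).const_mul _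
    · exact ((BM.const _).integrable _).sub ((hh.integrable _).const_mul _)
    · exact hsq.integrable _
  have i0 : ∫ x, (∫ z, (h x - h z) ^ 2 ∂(R x)) ∂ν = 0 := by
    have : ∀ᵐ x ∂ν, ∫ z, (h x - h z) ^ 2 ∂(R x) = op R (fun x => h x * h x) x - h x * h x := by
      filter_upwards [he] with x hx
      rw [e, hx]; ring
    rw [integral_congr_ae this, integral_sub (hsq.op.integrable _) (hsq.integrable _), hr.inv hsq, sub_self]
  have iB : BM (fun x => ∫ z, (h x - h z) ^ 2 ∂(R x)) := by
    have : (fun x => ∫ z, (h x - h z) ^ 2 ∂(R x)) =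
        fun x => h x * h x - 2 * h x * op R h x + op R (fun x => h x * h x) x := funext e
    rw [this]
    exact (hsq.sub (((BM.const 2).mul hh).mul hh.op)).add hsq.op
  have := (integral_eq_zero_iff_of_nonneg (fun x => integral_nonneg fun z => sq_nonneg _) (iB.integrable ν)).1 i0
  filter_upwards [this] with x hx
  have hb : BM (fun z => (h x - h z) ^ 2) := by
    have := ((BM.const (h x)).sub hh)
    simpa only [pow_two] using this.mul this
  rw [← ofReal_integral_eq_lintegral_ofReal (hb.integrable _) (ae_of_all _ fun z => sq_nonneg _)]
  simp only [Pi.zero_apply] at hx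
  rw [hx, ENNReal.ofReal_zero]

lemma irr_line (hm : 1 ≤ m) (hE : 0 < E) {τ : ℝ} (hτ : 0 < τ) {h : Delta m E → ℝ} (hh : BM h)
    (he : ∀ᵐ x ∂(piMeasure m E), op (PK m E τ) h x = h x) (i : Fin m) :
    ∀ᵐ x : Fin m → ℝ, ∀ᵐ t : ℝ, ∀ (hx : x ∈ simU m E) (hz : Function.update x i t ∈ simU m E),
      E < ∑ j, x j + t → h ⟨x, hx⟩ = h ⟨_, hz⟩ := by
  have := PK_markov hm hE hτ.le
  have := pi_prob hm hE
  have h1 := irr_sq (rev_PK hm hE hτ.le) hh he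
  have mH : Measurable fun p : Delta m E × Delta m E => ENNReal.ofReal ((h p.1 - h p.2) ^ 2) :=
    (((hh.meas.comp measurable_fst).sub (hh.meas.comp measurable_snd)).pow_const 2).ennreal_ofReal
  have h2 : ∀ᵐ x ∂(piPre m E), ENNReal.ofReal (√(x.1 i)) *
      (∫⁻ u in Ioo (0:ℝ) 1, ENNReal.ofReal ((h x - h (Texch m E i u x)) ^ 2)) = 0 := by
    have h1' : ∀ᵐ x ∂(piPre m E), ∫⁻ z, ENNReal.ofReal ((h x - h z) ^ 2) ∂(PK m E τ x) = 0 := by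
      rw [ae_iff] at h1 ⊢
      exact (pi_null hm hE).1 h1
    filter_upwards [h1'] with x hx
    have mx : Measurable fun z => ENNReal.ofReal ((h x - h z) ^ 2) :=
      mH.comp (measurable_const.prodMk measurable_id)
    rw [PK_apply, lint_Pt, ENNReal.tsum_eq_zero] at hx
    have hx1 := hx 1
    rw [mul_eq_zero] at hx1
    have hL := Lam_pos hm hE
    rcases hx1 with hx1 | hx1
    · unfold pw at hx1
      rw [ENNReal.ofReal_eq_zero] at hx1
      have : 0 < Real.exp (-Lam m E * τ) * (Lam m E * τ) ^ 1 / (Nat.factorial 1) := by positivity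
      exact absurd hx1 (not_le.2 this)
    · rw [show 1 = 0 + 1 from rfl, lint_KI_succ 0 x mx] at hx1
      simp only [lint_KI_zero _ mx] at hx1
      rw [lint_ustep x mx, add_eq_zero, mul_eq_zero (a := (ENNReal.ofReal (Lam m E))⁻¹), Finset.sum_eq_zero_iff] at hx1
      rcases hx1.2 with h' | h'
      · simp at h'
      · exact h' i (Finset.mem_univ i)
  have h3 := exch_amb i mH
  rw [lintegral_congr_ae h2] at h3
  simp only [lintegral_zero] at h3
  have mG := meas_GG i mH
  have h4 := (lintegral_eq_zero_iff (mG.lintegral_prod_right')).1 h3.symm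
  filter_upwards [h4] with x hx
  have h5 := (lintegral_eq_zero_iff (mG.comp (measurable_const.prodMk measurable_id))).1 hx
  filter_upwards [h5] with t ht hx hz hc
  simp only [Function.comp, Function.uncurry, GG, id, if_pos hc, Pi.zero_apply] at ht
  rw [mul_eq_zero, mul_eq_zero, mul_eq_zero] at ht
  rcases ht with ht | (ht | ht) | ht
  · have e := ext2_val (fun p : Delta m E × Delta m E => ENNReal.ofReal ((h p.1 - h p.2) ^ 2)) ⟨x, hx⟩ ⟨_, hz⟩
    rw [ht] at e
    have e2 := ENNReal.ofReal_eq_zero.1 e.symm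
    have e3 := pow_eq_zero_iff (two_ne_zero) |>.1 (le_antisymm e2 (sq_nonneg _))
    exact sub_eq_zero.1 e3
  · exact absurd ht (dw_pos hx)
  · exact absurd ht (dw_pos hz)
  · simp at ht

lemma irr_const (hE : 0 < E) {h : Delta m E → ℝ}
    (hl : ∀ i : Fin m, ∀ᵐ x : Fin m → ℝ, ∀ᵐ t : ℝ, ∀ (hx : x ∈ simU m E)
      (hz : Function.update x i t ∈ simU m E), E < ∑ j, x j + t → h ⟨x, hx⟩ = h ⟨_, hz⟩) :
    ∃ c, ∀ᵐ x : Fin m → ℝ, ∀ hx : x ∈ simU m E, h ⟨x, hx⟩ = c := by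
  classical
  set G : (Fin m → ℝ) → Prop := fun x => ∀ i, ∀ᵐ t : ℝ, ∀ (hx : x ∈ simU m E)
      (hz : Function.update x i t ∈ simU m E), E < ∑ j, x j + t → h ⟨x, hx⟩ = h ⟨_, hz⟩ with hG
  have aeG : ∀ᵐ x, G x := ae_all_iff.2 hl
  -- one coordinate
  have one : ∀ (i : Fin m) (x : Fin m → ℝ) (t : ℝ) (hx : x ∈ simU m E)
      (hz : Function.update x i t ∈ simU m E), G x → G (Function.update x i t) →
      h ⟨x, hx⟩ = h ⟨_, hz⟩ := by
    intro i x t hx hz gx gz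
    set a := max (E - ∑ j, x j) (E - ∑ j, Function.update x i t j)
    set b := E - ∑ j, x j + x i
    have hzi := hz.1 i
    rw [Function.update_self] at hzi
    have hab : a < b := by
      have h1 := hx.1 i
      refine max_lt (by linarith) ?_
      rw [sum_upd]
      linarith
    have hpos : volume (Ioo a b) ≠ 0 := by simp [hab]
    have hex : ∃ t' ∈ Ioo a b, (∀ (hx : x ∈ simU m E)
      (hz : Function.update x i t' ∈ simU m E), E < ∑ j, x j + t' → h ⟨x, hx⟩ = h ⟨_, hz⟩) ∧
      (∀ (hx : Function.update x i t ∈ simU m E)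
      (hz : Function.update (Function.update x i t) i t' ∈ simU m E),
        E < ∑ j, Function.update x i t j + t' → h ⟨_, hx⟩ = h ⟨_, hz⟩) := by
      by_contra hcon
      push Not at hcon
      refine hpos (measure_mono_null (fun t' ht' => ?_) ((gx i).and (gz i)))
      intro hh
      obtain ⟨p, q, r, s⟩ := hcon t' ht' (hh.1)
      exact s (hh.2 p q r)
    obtain ⟨t', ⟨h1, h2⟩, p1, p2⟩ := hex
    have ha1 := le_max_left (E - ∑ j, x j) (E - ∑ j, Function.update x i t j)
    have ha2 := le_max_right (E - ∑ j, x j) (E - ∑ j, Function.update x i t j)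
    have hw : Function.update x i t' ∈ simU m E := by
      constructor
      · intro j
        by_cases hj : j = i
        · subst hj
          rw [Function.update_self]
          have := hx.2
          linarith
        · rw [Function.update_of_ne hj]; exact hx.1 j
      · rw [sum_upd]; linarith
    have hw' : Function.update (Function.update x i t) i t' ∈ simU m E := by
      rw [Function.update_idem]; exact hw
    have q1 := p1 hx hw (by linarith)
    have q2 := p2 hz hw' (by linarith)
    rw [q1, q2]
    congr 2
    rw [Function.update_idem]
  -- mix
  have hmix : ∀ᵐ x : Fin m → ℝ, ∀ᵐ z : Fin m → ℝ, ∀ J : Finset (Fin m), G (J.piecewise z x) := by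
    have : ∀ J : Finset (Fin m), ∀ᵐ x : Fin m → ℝ, ∀ᵐ z : Fin m → ℝ, G (J.piecewise z x) :=
      fun J => mix_ae J aeG
    filter_upwards [ae_all_iff.2 this] with x hx
    exact ae_all_iff.2 hx
  have two : ∀ x z : Fin m → ℝ, (∀ J : Finset (Fin m), G (J.piecewise z x)) → ∀ (hx : x ∈ simU m E)
      (hz : z ∈ simU m E), ∑ j, x j + ∑ j, z j < E → h ⟨x, hx⟩ = h ⟨z, hz⟩ := by
    intro x z hJ hx hz hs
    have hU : ∀ J : Finset (Fin m), J.piecewise z x ∈ simU m E := by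
      intro J
      constructor
      · intro j
        simp only [Finset.piecewise]; split_ifs
        · exact hz.1 j
        · exact hx.1 j
      · refine lt_of_le_of_lt ?_ hs
        rw [← Finset.sum_add_distrib]
        refine Finset.sum_le_sum fun j _ => ?_
        have := hz.1 j
        have := hx.1 j
        simp only [Finset.piecewise]; split_ifs <;> linarith
    have key : ∀ J : Finset (Fin m), h ⟨x, hx⟩ = h ⟨J.piecewise z x, hU J⟩ := by
      intro J
      induction J using Finset.induction_on with
      | empty => congr 2
      | insert i J hi ih =>
        rw [ih]
        have e : (insert i J).piecewise z x = Function.update (J.piecewise z x) i (z i) := by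
          rw [Finset.piecewise_insert]
        have hU' := hU (insert i J)
        have gJ := hJ (insert i J)
        rw [e] at hU' gJ
        rw [one i _ (z i) (hU J) hU' (hJ J) gJ]
        congr 2
        exact e.symm
    rw [key Finset.univ]
    congr 2
    simp
  have small : ∀ ε : ℝ, 0 < ε → volume {z : Fin m → ℝ | z ∈ simU m E ∧ ∑ j, z j < ε} ≠ 0 := by
    intro ε hε
    have : {z : Fin m → ℝ | z ∈ simU m E ∧ ∑ j, z j < ε} = simU m (min E ε) := by
      ext z
      simp only [simU, mem_ofPred_eq, lt_min_iff, and_assoc]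
    rw [this]
    exact (simU_open.measure_pos volume (simU_nonempty (lt_min hE hε))).ne'
  -- pick
  have pair : ∀ x x' : Fin m → ℝ, (∀ᵐ z : Fin m → ℝ, ∀ J : Finset (Fin m), G (J.piecewise z x)) →
      (∀ᵐ z : Fin m → ℝ, ∀ J : Finset (Fin m), G (J.piecewise z x')) →
      ∀ (hx : x ∈ simU m E) (hx' : x' ∈ simU m E), h ⟨x, hx⟩ = h ⟨x', hx'⟩ := by
    intro x x' g g' hx hx'
    have hε : 0 < min (E - ∑ j, x j) (E - ∑ j, x' j) :=
      lt_min (by linarith [hx.2]) (by linarith [hx'.2])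
    by_contra hne
    refine small _ hε (measure_mono_null (fun z hz => ?_) (g.and g'))
    intro hh
    have h1 := lt_min_iff.1 hz.2
    have a1 := two x z hh.1 hx hz.1 (by linarith)
    have a2 := two x' z hh.2 hx' hz.1 (by linarith)
    exact hne (a1.trans a2.symm)
  have hex : ∃ x0, x0 ∈ simU m E ∧ ∀ᵐ z : Fin m → ℝ, ∀ J : Finset (Fin m), G (J.piecewise z x0) := by
    by_contra hcon
    refine (simU_open.measure_pos volume (simU_nonempty hE)).ne' (measure_mono_null (fun z hz => ?_) hmix)
    intro hh
    exact hcon ⟨z, hz, hh⟩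
  obtain ⟨x0, hx0, g0⟩ := hex
  refine ⟨h ⟨x0, hx0⟩, ?_⟩
  filter_upwards [hmix] with x g hx
  exact pair x x0 g g0 hx hx0

lemma ae_pi (hm : 1 ≤ m) (hE : 0 < E) {P : Delta m E → Prop}
    (h : ∀ᵐ x : Fin m → ℝ, ∀ hx : x ∈ simU m E, P ⟨x, hx⟩) : ∀ᵐ x ∂(piMeasure m E), P x := by
  rw [ae_iff, pi_null hm hE]
  have ac : piPre m E ≪ lebU m E := withDensity_absolutelyContinuous _ _
  refine ac ?_
  unfold lebU
  rw [comap_subtype_coe_apply simU_meas]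
  refine measure_mono_null ?_ (ae_iff.1 h)
  rintro _ ⟨x, hx, rfl⟩ h'
  exact hx (h' x.2)

lemma erg_PK (hm : 1 ≤ m) (hE : 0 < E) {δ : ℝ} (hδ : 0 < δ) : Erg (PK m E δ) (piMeasure m E) := by
  have := PK_markov hm hE hδ.le
  have := pi_prob hm hE
  refine erg_of_irr (rev_PK hm hE hδ.le) fun h hh he => ?_
  simp only [← op_PK_add hm hE hδ.le hδ.le hh] at he
  obtain ⟨c, hc⟩ := irr_const hE (irr_line hm hE (add_pos hδ hδ) hh he)
  exact ⟨c, ae_pi hm hE hc⟩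

end ECT

set_option linter.unusedSectionVars false
namespace ECT
open MeasureTheory ProbabilityTheory Filter Topology Set
open scoped ENNReal

lemma u_ae (c s : ℝ) (hc : 0 < c) {P : ℝ → Prop} (h : ∀ᵐ t, P t) :
    ∀ᵐ u ∂(volume.restrict (Ioo (0:ℝ) 1)), P (s - u ^ 2 * c) := by
  obtain ⟨N, hN, mN, h0⟩ := exists_measurable_superset_of_null (ae_iff.1 h)
  have mI : Measurable (N.indicator (fun _ => (1:ℝ≥0∞))) := measurable_const.indicator mN
  have h1 := cov1 c s hc (N.indicator (fun _ => (1:ℝ≥0∞)))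
  have h2 : ∫⁻ t in Ioo (s - c) s, N.indicator (fun _ => (1:ℝ≥0∞)) t * ENNReal.ofReal (1 / (2 * √(s - t))) = 0 := by
    refine lintegral_eq_zero_of_ae_eq_zero (ae_restrict_of_ae ?_)
    filter_upwards [measure_eq_zero_iff_ae_notMem.1 h0] with x hx
    simp [hx]
  rw [h2, mul_eq_zero] at h1
  rcases h1 with h1 | h1
  · rw [ENNReal.ofReal_eq_zero] at h1
    exact absurd (Real.sqrt_pos.2 hc) (not_lt.2 h1)
  · have h3 := (lintegral_eq_zero_iff (mI.comp (by fun_prop))).1 h1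
    filter_upwards [h3] with u hu
    by_contra hP
    have : s - u ^ 2 * c ∈ N := hN hP
    simp [this] at hu

variable {m : ℕ} {E : ℝ}

noncomputable def aj (E : ℝ) (x : Fin m → ℝ) (j : Fin m) : ℝ := 1 - √(x j) / Lam m E

lemma aj_nonneg (hm : 1 ≤ m) (hE : 0 < E) {x : Fin m → ℝ} (hx : x ∈ simU m E) (j : Fin m) : 0 ≤ aj E x j := by
  unfold aj
  rw [sub_nonneg, div_le_one (Lam_pos hm hE)]
  refine le_trans ?_ (jumpRate_le ⟨x, hx⟩)
  exact Finset.single_le_sum (f := fun i => √(x i)) (fun i _ => Real.sqrt_nonneg _) (Finset.mem_univ j)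

lemma upd_pw (J : Finset (Fin m)) (i : Fin m) (z x : Fin m → ℝ) (t : ℝ) :
    (insert i J).piecewise (Function.update z i t) x = Function.update (J.piecewise z x) i t := by
  funext j
  by_cases h : j = i
  · subst h; simp [Finset.piecewise]
  · simp [Finset.piecewise, h]

lemma sing_id (J : Finset (Fin m)) (w b : Fin m → ℝ) {L : ℝ} (hL : 0 < L) :
    (1 - (∑ i, w i) / L) * ∑ j ∈ Jᶜ, b j + L⁻¹ * ∑ i, w i * ∑ j ∈ (insert i J)ᶜ, b j =
      ∑ j ∈ Jᶜ, (1 - w j / L) * b j := by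
  have e1 : ∀ i, ∑ j ∈ (insert i J)ᶜ, b j = ∑ j ∈ Jᶜ, if j = i then 0 else b j := by
    intro i
    have : (insert i J)ᶜ = Jᶜ.filter (fun j => ¬ j = i) := by
      ext j; simp [not_or, and_comm]
    rw [this, Finset.sum_filter]
    refine Finset.sum_congr rfl fun j _ => ?_
    by_cases h : j = i <;> simp [h]
  simp only [e1, Finset.mul_sum]
  rw [Finset.sum_comm, ← Finset.sum_add_distrib]
  refine Finset.sum_congr rfl fun j _ => ?_
  have e2 : ∑ i, L⁻¹ * (w i * if j = i then 0 else b j) = L⁻¹ * (((∑ i, w i) - w j) * b j) := by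
    rw [← Finset.mul_sum]
    congr 1
    have : ∀ i, (w i * if j = i then 0 else b j) = w i * b j - if j = i then w i * b j else 0 := by
      intro i; by_cases h : j = i <;> simp [h]
    simp only [this]
    rw [Finset.sum_sub_distrib, Finset.sum_ite_eq, ← Finset.sum_mul]
    simp; ring
  rw [e2]
  field_simp
  ring

lemma sing (hm : 1 ≤ m) (hE : 0 < E) {A : Set (Delta m E)} (mA : MeasurableSet A)
    (hA : ∀ᵐ z : Fin m → ℝ, ∀ hz : z ∈ simU m E, (⟨z, hz⟩ : Delta m E) ∉ A) (n : ℕ) :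
    ∀ (J : Finset (Fin m)) (x : Fin m → ℝ), ∀ᵐ z : Fin m → ℝ, ∀ hw : J.piecewise z x ∈ simU m E,
      ustepIter m E n ⟨_, hw⟩ A ≤ ENNReal.ofReal (∑ j ∈ Jᶜ, (aj E (J.piecewise z x) j) ^ n) := by
  have hL := Lam_pos hm hE
  induction n with
  | zero =>
    intro J x
    by_cases hJ : J = Finset.univ
    · subst hJ
      filter_upwards [hA] with z hz hw
      have hw' : z ∈ simU m E := by simpa using hw
      have e : (⟨_, hw⟩ : Delta m E) = ⟨z, hw'⟩ := by
        apply Subtype.ext; simp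
      rw [e]
      change Measure.dirac _ A ≤ _
      rw [Measure.dirac_apply' _ mA, indicator_of_notMem (hz hw')]
      exact zero_le
    · refine ae_of_all _ fun z hw => ?_
      have := KI_prob hm hE 0 ⟨_, hw⟩
      refine prob_le_one.trans ?_
      simp only [pow_zero, Finset.sum_const, nsmul_eq_mul, mul_one]
      rw [ENNReal.one_le_ofReal]
      have : 1 ≤ (Jᶜ).card := by
        rw [Nat.one_le_iff_ne_zero, Finset.card_ne_zero]
        rw [Finset.nonempty_iff_ne_empty]
        intro h
        exact hJ (by simpa using h)
      exact_mod_cast this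
  | succ n ih =>
    intro J x
    have hi : ∀ i : Fin m, ∀ᵐ z : Fin m → ℝ, ∀ᵐ t : ℝ,
        ∀ hw : (insert i J).piecewise (Function.update z i t) x ∈ simU m E,
        ustepIter m E n ⟨_, hw⟩ A ≤ ENNReal.ofReal (∑ j ∈ (insert i J)ᶜ,
          (aj E ((insert i J).piecewise (Function.update z i t) x) j) ^ n) :=
      fun i => upd_ae i (ih (insert i J) x)
    filter_upwards [ih J x, ae_all_iff.2 hi] with z hz1 hz2 hw
    set w := J.piecewise z x with hwd
    have mφ : Measurable fun y => ustepIter m E n y A := (Measure.measurable_coe mA).comp (meas_ustepIter n)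
    have e1 : ustepIter m E (n + 1) ⟨w, hw⟩ A = ∫⁻ y, ustepIter m E n y A ∂(ustep m E ⟨w, hw⟩) :=
      Measure.bind_apply mA (meas_ustepIter n).aemeasurable
    have a0 := aj_nonneg hm hE hw
    have b : ∀ i, ∫⁻ u in Ioo (0:ℝ) 1, ustepIter m E n (Texch m E i u ⟨w, hw⟩) A ≤
        ENNReal.ofReal (∑ j ∈ (insert i J)ᶜ, (aj E w j) ^ n) := by
      intro i
      have hu := u_ae (w i) (w i + (E - ∑ j, w j)) (hw.1 i) (hz2 i)
      have hu' : ∀ᵐ u ∂(volume.restrict (Ioo (0:ℝ) 1)), ustepIter m E n (Texch m E i u ⟨w, hw⟩) A ≤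
          ENNReal.ofReal (∑ j ∈ (insert i J)ᶜ, (aj E w j) ^ n) := by
        filter_upwards [hu, ae_restrict_mem measurableSet_Ioo] with u h1 h2
        have e : (insert i J).piecewise (Function.update z i (w i + (E - ∑ j, w j) - u ^ 2 * w i)) x =
            T0 m E i u w := by
          rw [upd_pw, T0, ← hwd]
          congr 1; ring
        rw [e] at h1
        have h3 := h1 (T0_mem hw h2)
        have e2 : Texch m E i u ⟨w, hw⟩ = ⟨T0 m E i u w, T0_mem hw h2⟩ := by
          simp [Texch, h2.1, h2.2]
        rw [e2]
        refine h3.trans (le_of_eq ?_)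
        congr 1
        refine Finset.sum_congr rfl fun j hj => ?_
        have hji : j ≠ i := by
          rintro rfl; simp at hj
        simp [aj, T0, Function.update_of_ne hji]
      refine (lintegral_mono_ae hu').trans ?_
      simp
    rw [e1, lint_ustep _ mφ]
    have c0 : ∀ (J' : Finset (Fin m)), 0 ≤ ∑ j ∈ J'ᶜ, (aj E w j) ^ n := fun J' =>
      Finset.sum_nonneg fun j _ => pow_nonneg (a0 j) n
    have r0 : 0 ≤ 1 - jumpRate m E ⟨w, hw⟩ / Lam m E := by
      rw [sub_nonneg, div_le_one hL]; exact jumpRate_le _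
    have r0' : 0 ≤ 1 - (∑ i, √(w i)) / Lam m E := r0
    calc _ ≤ ENNReal.ofReal (1 - jumpRate m E ⟨w, hw⟩ / Lam m E) * ENNReal.ofReal (∑ j ∈ Jᶜ, (aj E w j) ^ n) +
          (ENNReal.ofReal (Lam m E))⁻¹ * ∑ i, ENNReal.ofReal (√(w i)) *
            ENNReal.ofReal (∑ j ∈ (insert i J)ᶜ, (aj E w j) ^ n) := by
          gcongr with i
          · exact hz1 hw
          · exact b i
      _ = ENNReal.ofReal ((1 - (∑ i, √(w i)) / Lam m E) * (∑ j ∈ Jᶜ, (aj E w j) ^ n) +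
          (Lam m E)⁻¹ * ∑ i, √(w i) * (∑ j ∈ (insert i J)ᶜ, (aj E w j) ^ n)) := by
          rw [ENNReal.ofReal_add (mul_nonneg r0' (c0 J)) (mul_nonneg (by positivity)
            (Finset.sum_nonneg fun i _ => mul_nonneg (Real.sqrt_nonneg _) (c0 _))),
            ENNReal.ofReal_mul r0', ENNReal.ofReal_mul (by positivity), ENNReal.ofReal_inv_of_pos hL,
            ENNReal.ofReal_sum_of_nonneg (fun i _ => mul_nonneg (Real.sqrt_nonneg _) (c0 _))]
          simp only [ENNReal.ofReal_mul (Real.sqrt_nonneg _)]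
          rfl
      _ ≤ _ := by
          rw [sing_id J (fun i => √(w i)) _ hL]
          apply le_of_eq
          congr 1
          refine Finset.sum_congr rfl fun j _ => ?_
          rw [pow_succ, mul_comm]; rfl

lemma amb_null (hm : 1 ≤ m) (hE : 0 < E) {A : Set (Delta m E)} (h0 : piMeasure m E A = 0) :
    ∀ᵐ z : Fin m → ℝ, ∀ hz : z ∈ simU m E, (⟨z, hz⟩ : Delta m E) ∉ A := by
  rw [pi_null hm hE] at h0
  have md : Measurable fun x : Delta m E => ENNReal.ofReal ((tank m E x) ^ (-(1/2) : ℝ)) :=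
    meas_dw.comp measurable_subtype_coe
  have ac : lebU m E ≪ piPre m E := withDensity_absolutelyContinuous' md.aemeasurable
    (ae_of_all _ fun x => dw_pos x.2)
  have h1 := ac h0
  unfold lebU at h1
  rw [comap_subtype_coe_apply simU_meas] at h1
  filter_upwards [measure_eq_zero_iff_ae_notMem.1 h1] with z hz hzU hzA
  exact hz ⟨_, hzA, rfl⟩

lemma sing_Pt (hm : 1 ≤ m) (hE : 0 < E) {A : Set (Delta m E)} (mA : MeasurableSet A)
    (h0 : piMeasure m E A = 0) {t : ℝ} (ht : 0 ≤ t) (x : Delta m E) :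
    Pt m E t x A ≤ ENNReal.ofReal (∑ j, Real.exp (-(t * √(x.1 j)))) := by
  have hL := Lam_pos hm hE
  have h1 : ∀ n, ustepIter m E n x A ≤ ∑ j, ENNReal.ofReal ((aj E x.1 j) ^ n) := by
    intro n
    have h := (sing hm hE mA (amb_null hm hE h0) n ∅ x.1).exists
    obtain ⟨z, hz⟩ := h
    simp only [Finset.piecewise_empty, Finset.compl_empty] at hz
    rw [← ENNReal.ofReal_sum_of_nonneg fun j _ => pow_nonneg (aj_nonneg hm hE x.2 j) n]
    exact hz x.2
  have e : Pt m E t x A = ∑' n, pw m E t n * ustepIter m E n x A := by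
    unfold Pt
    rw [Measure.sum_apply _ mA]; rfl
  rw [e]
  calc _ ≤ ∑' n, pw m E t n * ∑ j, ENNReal.ofReal ((aj E x.1 j) ^ n) := by
        gcongr with n; exact h1 n
    _ = ∑ j, ∑' n, pw m E t n * ENNReal.ofReal ((aj E x.1 j) ^ n) := by
        simp only [Finset.mul_sum]
        rw [Summable.tsum_finsetSum fun j _ => ENNReal.summable]
    _ = ENNReal.ofReal (∑ j, Real.exp (-(t * √(x.1 j)))) := by
        rw [ENNReal.ofReal_sum_of_nonneg fun j _ => (Real.exp_pos _).le]
        refine Finset.sum_congr rfl fun j _ => ?_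
        rw [tsum_pw_pow ht _ (aj_nonneg hm hE x.2 j), ← Real.exp_add]
        congr 2
        unfold aj
        field_simp
        ring

end ECT

set_option linter.unusedSectionVars false
namespace ECT
open MeasureTheory ProbabilityTheory Filter Topology Set
open scoped ENNReal

lemma hsing_PK {m : ℕ} {E : ℝ} (hm : 1 ≤ m) (hE : 0 < E) {δ : ℝ} (hδ : 0 < δ)
    {Ω : Type} [MeasurableSpace Ω] {P : Measure Ω} [IsProbabilityMeasure P] {X : ℕ → Ω → Delta m E}
    (h : Chain (PK m E δ) P X) (ε : ℝ) (hε : 0 < ε) :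
    ∃ n, ∀ A, MeasurableSet A → piMeasure m E A = 0 → P.real (X n ⁻¹' A) ≤ ε := by
  haveI := PK_markov hm hE hδ.le
  have mb : ∀ n : ℕ, Measurable fun ω => ∑ j, Real.exp (-((n * δ) * √((X 0 ω).1 j))) := fun n =>
    Finset.measurable_sum _ fun j _ => Real.measurable_exp.comp
      (((((meas_coord j).comp (h.1 0)).sqrt).const_mul _).neg)
  have bd : ∀ (n : ℕ) (ω : Ω), ‖∑ j, Real.exp (-((n * δ) * √((X 0 ω).1 j)))‖ ≤ m := by
    intro n ω
    rw [Real.norm_of_nonneg (Finset.sum_nonneg fun j _ => (Real.exp_pos _).le)]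
    calc _ ≤ ∑ j : Fin m, (1:ℝ) := Finset.sum_le_sum fun j _ => by
          rw [Real.exp_le_one_iff, neg_nonpos]; positivity
      _ = m := by simp
  have lim : Tendsto (fun n : ℕ => ∫ ω, ∑ j, Real.exp (-((n * δ) * √((X 0 ω).1 j))) ∂P) atTop
      (𝓝 (∫ ω, (0:ℝ) ∂P)) := by
    refine tendsto_integral_of_dominated_convergence (fun _ => (m:ℝ))
      (fun n => (mb n).aestronglyMeasurable) (integrable_const _) (fun n => ae_of_all _ (bd n))
      (ae_of_all _ fun ω => ?_)
    rw [show (0:ℝ) = ∑ j : Fin m, (0:ℝ) by simp]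
    refine tendsto_finsetSum _ fun j _ => Real.tendsto_exp_neg_atTop_nhds_zero.comp ?_
    exact (tendsto_natCast_atTop_atTop.atTop_mul_const hδ).atTop_mul_const
      (Real.sqrt_pos.2 ((X 0 ω).2.1 j))
  rw [integral_zero] at lim
  obtain ⟨n, hn⟩ := (lim.eventually (gt_mem_nhds hε)).exists
  refine ⟨n, fun A mA h0 => le_trans ?_ hn.le⟩
  have hb : BM (A.indicator (fun _ => (1:ℝ))) :=
    ⟨measurable_const.indicator mA, 1, fun x => by
      by_cases hx : x ∈ A <;> simp [hx]⟩
  have e := h.iter (Past.one 0) hb n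
  simp only [one_mul, integral_complex_ofReal, zero_add] at e
  have e := Complex.ofReal_inj.1 e
  have e1 : ∫ ω, A.indicator (fun _ => (1:ℝ)) (X n ω) ∂P = P.real (X n ⁻¹' A) := by
    rw [← integral_indicator_one ((h.1 n) mA)]
    rfl
  rw [← e1, e]
  refine integral_mono ((((hb.iter n).comp (h.1 0))).integrable P)
    (Integrable.of_bound (mb n).aestronglyMeasurable m (ae_of_all _ (bd n))) fun ω => ?_
  have ht : 0 ≤ (n:ℝ) * δ := by positivity
  show (op (PK m E δ))^[n] _ (X 0 ω) ≤ _
  rw [op_PK_iter hm hE hδ.le hb]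
  unfold op
  rw [integral_indicator_const _ mA, smul_eq_mul, mul_one]
  refine ENNReal.toReal_le_of_le_ofReal (Finset.sum_nonneg fun j _ => (Real.exp_pos _).le) ?_
  exact sing_Pt hm hE mA h0 ht _

lemma ae_Pt {m : ℕ} {E : ℝ} (hm : 1 ≤ m) (hE : 0 < E) {t : ℝ} (ht : 0 ≤ t) {A : Set (Delta m E)}
    (mA : MeasurableSet A) (h0 : piMeasure m E A = 0) :
    ∀ᵐ x ∂(piMeasure m E), Pt m E t x A = 0 := by
  haveI := PK_markov hm hE ht
  have h := lsym_Pt (m := m) (E := E) t (fun _ => 1) (A.indicator (fun _ => 1)) measurable_const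
    (measurable_const.indicator mA)
  have hp : ∀ x, Pt m E t x univ = 1 := fun x => measure_univ (μ := PK m E t x)
  simp only [one_mul, lintegral_const, hp, lintegral_indicator_const mA, h0] at h
  have hmeas : Measurable fun x => Pt m E t x A := (PK m E t).measurable_coe mA
  exact (lintegral_eq_zero_iff hmeas).1 h


end ECT

set_option linter.unusedSectionVars false
namespace ECT
open MeasureTheory ProbabilityTheory Filter Topology Set
open scoped ENNReal

lemma levy_final {Ω : Type} [MeasurableSpace Ω] {P : Measure Ω} [IsProbabilityMeasure P]
    {Y : ℕ → Ω → ℝ} (hY : ∀ n, Measurable (Y n)) {σ : ℝ} (hσ : 0 ≤ σ)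
    (h : ∀ t : ℝ, Tendsto (fun n : ℕ => ∫ ω, Complex.exp ((t * Y n ω : ℝ) * Complex.I) ∂P) atTop
      (𝓝 ((Real.exp (-(t ^ 2 * σ / 2)) : ℝ) : ℂ)))
    (g : ℝ → ℝ) (hg : Continuous g) (hb : ∃ C : ℝ, ∀ y, |g y| ≤ C) :
    Tendsto (fun n : ℕ => ∫ ω, g (Y n ω) ∂P) atTop
      (𝓝 (∫ y, g y ∂(gaussianReal 0 (Real.toNNReal σ)))) := by
  obtain ⟨C, hC⟩ := hb
  let μ : ℕ → ProbabilityMeasure ℝ := fun n =>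
    ⟨P.map (Y n), Measure.isProbabilityMeasure_map (hY n).aemeasurable⟩
  let μ₀ : ProbabilityMeasure ℝ := ⟨gaussianReal 0 (Real.toNNReal σ), inferInstance⟩
  have hT : Tendsto μ atTop (𝓝 μ₀) := by
    rw [ProbabilityMeasure.tendsto_iff_tendsto_charFun]
    intro t
    have e1 : ∀ n, charFun (μ n : Measure ℝ) t = ∫ ω, Complex.exp ((t * Y n ω : ℝ) * Complex.I) ∂P := by
      intro n
      show charFun (P.map (Y n)) t = _
      rw [charFun_apply_real, integral_map (hY n).aemeasurable (by fun_prop)]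
      simp
    have e2 : charFun (μ₀ : Measure ℝ) t = ((Real.exp (-(t ^ 2 * σ / 2)) : ℝ) : ℂ) := by
      show charFun (gaussianReal 0 (Real.toNNReal σ)) t = _
      rw [charFun_gaussianReal, Real.coe_toNNReal _ hσ]
      push_cast
      congr 1
      ring
    rw [e2]
    simp only [e1]
    exact h t
  rw [ProbabilityMeasure.tendsto_iff_forall_integral_tendsto] at hT
  have h2 := hT (BoundedContinuousFunction.ofNormedAddCommGroup g hg C hC)
  refine h2.congr fun n => ?_
  show ∫ y, g y ∂(P.map (Y n)) = _
  rw [integral_map (hY n).aemeasurable hg.aestronglyMeasurable]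

theorem main (m : ℕ) (hm : 1 ≤ m) (E : ℝ) (hE : 0 < E)
    (f : Delta m E → ℝ) (hfm : Measurable f)
    (hfb : ∃ C : ℝ, ∀ᵐ x ∂(piMeasure m E), |f x| ≤ C)
    (δ : ℝ) (hδ : 0 < δ)
    (fmean fvar : ℝ) (fcov : ℕ → ℝ)
    (hmean : fmean = ∫ x, f x ∂(piMeasure m E))
    (hvar : fvar = (∫ x, (f x) ^ 2 ∂(piMeasure m E)) - fmean ^ 2)
    (hcov : ∀ i : ℕ, fcov i =
      (∫ x, f x * (∫ z, f z ∂(Pt m E (i * δ) x)) ∂(piMeasure m E)) - fmean ^ 2)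
    (hsum : Summable fun i : ℕ => fcov (i + 1))
    (σ2 : ℝ) (hσ2 : σ2 = fvar + 2 * ∑' i : ℕ, fcov (i + 1))
    (Ω : Type) [MeasurableSpace Ω] (P : Measure Ω) (hP : IsProbabilityMeasure P)
    (Xp : ℕ → Ω → Delta m E) (hchain : IsMarkovChainWith P (Pt m E δ) Xp)
    (g : ℝ → ℝ) (hg : Continuous g) (hgb : ∃ C : ℝ, ∀ y, |g y| ≤ C) :
      Tendsto (fun n : ℕ =>
          ∫ ω, g (Real.sqrt n * ((1 / n) * ∑ i ∈ Finset.range n, f (Xp i ω) - fmean)) ∂P)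
        atTop
        (𝓝 (∫ y, g y ∂(gaussianReal 0 (Real.toNNReal σ2)))) := by
  have := PK_markov hm hE hδ.le
  have := pi_prob hm hE
  have hX : Chain (PK m E δ) P Xp := Chain.of_isMarkovChainWith hchain
  have hr := rev_PK hm hE hδ.le
  have herg := erg_PK hm hE hδ
  obtain ⟨C, hC⟩ := hfb
  set ν := piMeasure m E with hν
  let fc : Delta m E → ℝ := fun x => max (-|C|) (min |C| (f x))
  have hfc : BM fc := by
    refine ⟨measurable_const.max (measurable_const.min hfm), |C|, fun x => abs_le.2 ⟨le_max_left _ _, ?_⟩⟩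
    exact max_le (by linarith [abs_nonneg C]) (min_le_left _ _)
  have key : ∀ x, |f x| ≤ C → f x = fc x := by
    intro x hx
    have h := abs_le.1 (hx.trans (le_abs_self C))
    show _ = max _ (min _ _)
    rw [min_eq_right h.2, max_eq_right h.1]
  have hae : f =ᵐ[ν] fc := hC.mono key
  have mbad : MeasurableSet {x | f x ≠ fc x} := (measurableSet_eq_fun hfm hfc.meas).compl
  have hbad : ν {x | f x ≠ fc x} = 0 := hae
  have hmc : ∫ x, fc x ∂ν = fmean := by rw [hmean]; exact (integral_congr_ae hae).symm
  let f' : Delta m E → ℝ := fun x => fc x - fmean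
  have hf' : BM f' := hfc.sub (BM.const _)
  have gen : ∀ w : Delta m E → ℝ, BM w → ∫ x, w x ∂ν = fmean →
      ∫ x, f' x * (w x - fmean) ∂ν = (∫ x, fc x * w x ∂ν) - fmean ^ 2 := by
    intro w hw hwm
    have e : ∀ x, f' x * (w x - fmean) = fc x * w x - (fmean * fc x + fmean * w x - fmean ^ 2) :=
      fun x => by simp only [f']; ring
    simp only [e]
    have b1 := (BM.const fmean).mul hfc
    have b2 := (BM.const fmean).mul hw
    rw [integral_sub ((hfc.mul hw).integrable ν)
      (((b1.add b2).sub (BM.const (fmean ^ 2))).integrable ν),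
      integral_sub ((b1.add b2).integrable ν) ((BM.const (fmean ^ 2)).integrable ν),
      integral_add (b1.integrable ν) (b2.integrable ν),
      integral_const_mul, integral_const_mul, hmc, hwm]
    simp
    ring
  have evar : ∫ x, f' x * f' x ∂ν = fvar := by
    rw [gen fc hfc hmc, hvar]
    congr 1
    refine integral_congr_ae ?_
    filter_upwards [hae] with x hx
    rw [hx]; ring
  have ecov : ∀ i : ℕ, ∫ x, f' x * (op (PK m E δ))^[i] f' x ∂ν = fcov i := by
    intro i
    rw [op_iter_sub_const hfc, gen _ (hfc.iter i) ((hr.inv_iter hfc i).trans hmc), hcov,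
      op_PK_iter hm hE hδ.le hfc]
    congr 1
    refine integral_congr_ae ?_
    have h1 := ae_Pt hm hE (t := i * δ) (by positivity) mbad hbad
    filter_upwards [hae, h1] with x hx h2
    rw [hx]
    congr 1
    exact (integral_congr_ae (show f =ᵐ[Pt m E (i * δ) x] fc from h2)).symm
  have hs : Summable fun n : ℕ => ∫ x, f' x * (op (PK m E δ))^[n + 1] f' x ∂ν := by
    simpa only [ecov] using hsum
  have hσ : σ2 = (∫ x, f' x * f' x ∂ν) + 2 * ∑' n : ℕ, ∫ x, f' x * (op (PK m E δ))^[n + 1] f' x ∂ν := by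
    simp only [ecov, evar]; exact hσ2
  have hσ0 : 0 ≤ σ2 := by
    rw [hσ]
    exact ge_of_tendsto' (sk_tendsto hr hf' hs) fun k =>
      integral_nonneg fun x => mV_nonneg (hk_BM hf' k) x
  refine levy_final (Y := fun n ω => Real.sqrt n * ((1 / n) * ∑ i ∈ Finset.range n, f (Xp i ω) - fmean))
    (fun n => ?_) hσ0 (fun t => ?_) g hg hgb
  · exact (((Finset.measurable_sum _ fun i _ => hfm.comp (hX.1 i)).const_mul _).sub_const _).const_mul _
  · have ha := abstract_clt hX hr herg (hsing_PK hm hE hδ hX) (f := fun x => f x - fmean)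
      (hfm.sub_const _) hf' (hae.mono fun x hx => by simp only [f', hx]) hs hσ t
    refine ha.congr' ?_
    filter_upwards [eventually_gt_atTop 0] with n hn
    refine integral_congr_ae (ae_of_all _ fun ω => ?_)
    have hn' : (0:ℝ) < n := by exact_mod_cast hn
    have e : t / √(n:ℝ) * ∑ j ∈ Finset.range n, (f (Xp j ω) - fmean) =
        t * (√(n:ℝ) * ((1 / n) * ∑ i ∈ Finset.range n, f (Xp i ω) - fmean)) := by
      rw [Finset.sum_sub_distrib]
      simp only [Finset.sum_const, Finset.card_range, nsmul_eq_mul]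
      have h0 := Real.sqrt_pos.2 hn'
      have h1 : (n:ℝ) = √(n:ℝ) * √(n:ℝ) := (Real.mul_self_sqrt hn'.le).symm
      generalize √(n:ℝ) = s at *
      rw [h1]
      field_simp
    simp only [e]

end ECT

/-- Theorem 5, central limit theorem. Let `f : Δ → ℝ` be Borel and
uniformly bounded `π`-a.s., let `δ > 0`, and consider the time-`δ` chain `(x_{nδ})`.
If `σ_f² = var_π(f) + 2 ∑_{i≥1} cov_π(f(x_0), f(x_{iδ}))` is finite (the series of
stationary covariances converges), then for every initial distribution the normalized
ergodic averages `√n ((1/n) ∑_{i<n} f(x_{iδ}) - E_π f)` converge in distribution to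
`N(0, σ_f²)`. -/
theorem energy_exchange_clt (m : ℕ) (hm : 1 ≤ m) (E : ℝ) (hE : 0 < E)
    (f : Delta m E → ℝ) (hfm : Measurable f)
    (hfb : ∃ C : ℝ, ∀ᵐ x ∂(piMeasure m E), |f x| ≤ C)
    (δ : ℝ) (hδ : 0 < δ)
    -- the stationary mean, variance and covariances of the time-`δ` chain:
    (fmean fvar : ℝ) (fcov : ℕ → ℝ)
    (hmean : fmean = ∫ x, f x ∂(piMeasure m E))
    (hvar : fvar = (∫ x, (f x) ^ 2 ∂(piMeasure m E)) - fmean ^ 2)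
    (hcov : ∀ i : ℕ, fcov i =
      (∫ x, f x * (∫ z, f z ∂(Pt m E (i * δ) x)) ∂(piMeasure m E)) - fmean ^ 2)
    -- `σ_f² < ∞`: the covariance series converges
    (hsum : Summable fun i : ℕ => fcov (i + 1))
    (σ2 : ℝ) (hσ2 : σ2 = fvar + 2 * ∑' i : ℕ, fcov (i + 1))
    -- any probability space carrying the time-`δ` chain, with arbitrary initial distribution:
    (Ω : Type) [MeasurableSpace Ω] (ℙ : Measure Ω) (hℙ : IsProbabilityMeasure ℙ)
    (Xp : ℕ → Ω → Delta m E) (hchain : IsMarkovChainWith ℙ (Pt m E δ) Xp) :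
    -- convergence in distribution to `N(0, σ_f²)`:
    ∀ g : ℝ → ℝ, Continuous g → (∃ C : ℝ, ∀ y, |g y| ≤ C) →
      Tendsto (fun n : ℕ =>
          ∫ ω, g (Real.sqrt n * ((1 / n) * ∑ i ∈ Finset.range n, f (Xp i ω) - fmean)) ∂ℙ)
        atTop
        (nhds (∫ y, g y ∂(ProbabilityTheory.gaussianReal 0 (Real.toNNReal σ2)))) := by
  intro g hg hgb
  exact ECT.main m hm E hE f hfm hfb δ hδ fmean fvar fcov hmean hvar hcov hsum σ2 hσ2 Ω ℙ hℙ Xp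
    hchain g hg hgb
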